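/- Let χ₁ be a real-valued, even, nonprincipal, primitive Dirichlet character modulo N > 1, let q > 1 and let χ be an even, nonprincipal, primitive Dirichlet character modulo q, and let ρ > 1 be real. Then, as the real variable x → ∞, (1/Γ(ρ+1)) Σ_{n ≤ x} (x² − n²)^ρ 𝒟_χ(n) = −(G(χ) √π L(1, χ₁))/(2q Γ(ρ+3/2)) · x^{1+2ρ} · Σ_{n=1}^{q−1} χ̄(n) log(2 sin(πn/q)) + O(x^{(5ρ+1)/3}). -/

import Mathlib

open scoped Real Classical
open Filter Asymptotics

/-- `d_χ(n) = ∑_{k ∣ n} χ(k)`. -/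
noncomputable def divisorSumChar {N : ℕ} (χ : DirichletCharacter ℂ N) (n : ℕ) : ℂ :=
  ∑ k ∈ n.divisors, χ (k : ZMod N)

/-- `𝒟_χ(n) = ∑_{k ∣ n} d_{χ₁}(k) χ(n/k)`. -/
noncomputable def scrDchi {N q : ℕ} (χ₁ : DirichletCharacter ℂ N)
    (χ : DirichletCharacter ℂ q) (n : ℕ) : ℂ :=
  ∑ k ∈ n.divisors, divisorSumChar χ₁ k * χ ((n / k : ℕ) : ZMod q)

/-- Gauss sum `G(χ) = ∑_{h=1}^{q-1} χ(h) e^{2πih/q}`. -/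
noncomputable def gaussSum' {q : ℕ} (χ : DirichletCharacter ℂ q) : ℂ :=
  ∑ h ∈ Finset.Ico 1 q, χ (h : ZMod q) * Complex.exp (2 * π * Complex.I * h / q)

namespace RieszVoronoi

open MeasureTheory
open scoped Topology

open Complex in
theorem log_eq_log_add_log_div {z w : ℂ} (hz : 0 < z.im) (hw : 0 < w.im) :
    log w = log z + log (w / z) := by
  have hz0 : z ≠ 0 := by rintro rfl; simp at hz
  have hw0 : w ≠ 0 := by rintro rfl; simp at hw
  have hza : z.arg ∈ Set.Ioo 0 π := by
    refine ⟨lt_of_le_of_ne (arg_nonneg_iff.2 hz.le) ?_, arg_lt_pi_iff.2 (Or.inr hz.ne')⟩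
    intro h
    exact hz.ne' (arg_eq_zero_iff.1 h.symm).2
  have hwa : w.arg ∈ Set.Ioo 0 π := by
    refine ⟨lt_of_le_of_ne (arg_nonneg_iff.2 hw.le) ?_, arg_lt_pi_iff.2 (Or.inr hw.ne')⟩
    intro h
    exact hw.ne' (arg_eq_zero_iff.1 h.symm).2
  have h1 : exp (log w - log z) = w / z := by
    rw [exp_sub, exp_log hz0, exp_log hw0]
  rw [← h1, log_exp]
  · ring
  · simp only [sub_im, log_im]
    linarith [hza.2, hwa.1]
  · simp only [sub_im, log_im]
    linarith [hza.1, hwa.2]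

/-- The summand in the Binet-type series for `log Γ`. -/
noncomputable def binetTerm (u : ℂ) : ℂ := (u + 1 / 2) * Complex.log (1 + 1 / u) - 1

/-- The main term of Stirling's formula for `log Γ`, up to the constant. -/
noncomputable def stirlingMain (u : ℂ) : ℂ := (u - 1 / 2) * Complex.log u - u

theorem norm_binetTerm_le {u : ℂ} (hu : 2 ≤ ‖u‖) : ‖binetTerm u‖ ≤ 2 / ‖u‖ ^ 2 := by
  have hu0 : u ≠ 0 := by rintro rfl; simp at hu; linarith
  have hpos : 0 < ‖u‖ := by linarith
  have hsm : ‖1 / u‖ ≤ 1 / 2 := by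
    rw [norm_div, norm_one]; gcongr
  have h := Complex.norm_log_sub_logTaylor_le 2 (z := 1 / u) (by linarith)
  have hT : Complex.logTaylor (2 + 1) (1 / u) = 1 / u - 1 / (2 * u ^ 2) := by
    simp [Complex.logTaylor, Finset.sum_range_succ]
    field_simp
    ring
  rw [hT] at h
  set r := Complex.log (1 + 1 / u) - (1 / u - 1 / (2 * u ^ 2)) with hr
  have hr' : ‖r‖ ≤ (1 / ‖u‖) ^ 3 * (2 / 3) := by
    refine h.trans ?_
    have : (1 - ‖1 / u‖)⁻¹ ≤ 2 := by
      rw [inv_le_comm₀ (by linarith) (by norm_num)]; linarith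
    rw [norm_div, norm_one] at *
    calc _ ≤ (1 / ‖u‖) ^ (2 + 1) * 2 / (((2 : ℕ) : ℝ) + 1) := by gcongr
      _ = _ := by norm_num; ring
  have hb : binetTerm u = -1 / (4 * u ^ 2) + (u + 1 / 2) * r := by
    have : Complex.log (1 + 1 / u) = r + (1 / u - 1 / (2 * u ^ 2)) := by rw [hr]; ring
    rw [binetTerm, this]
    field_simp
    ring
  rw [hb]
  have h1 : ‖-1 / (4 * u ^ 2)‖ = 1 / (4 * ‖u‖ ^ 2) := by simp
  have h2 : ‖u + 1 / 2‖ ≤ ‖u‖ + 1 / 2 := by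
    refine (norm_add_le _ _).trans ?_
    norm_num
  calc _ ≤ ‖-1 / (4 * u ^ 2)‖ + ‖(u + 1 / 2) * r‖ := norm_add_le _ _
    _ ≤ 1 / (4 * ‖u‖ ^ 2) + (‖u‖ + 1 / 2) * ((1 / ‖u‖) ^ 3 * (2 / 3)) := by
        rw [h1, norm_mul]; gcongr
    _ ≤ 2 / ‖u‖ ^ 2 := by
        rw [div_add' _ _ _ (by positivity), div_le_div_iff₀ (by positivity) (by positivity)]
        field_simp
        nlinarith

theorem add_nat_le_norm {M : ℝ} (hM : 0 ≤ M) {z : ℂ} (hx : |z.re| ≤ M) (hy : 2 ≤ z.im) (n : ℕ) :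
    z.im + n ≤ (M + 2) * ‖z + n‖ := by
  have h1 : z.im ≤ ‖z + n‖ := by
    have := Complex.abs_im_le_norm (z + n)
    simp at this
    exact (le_abs_self _).trans this
  have h2 : z.re + n ≤ ‖z + n‖ := by
    have := Complex.abs_re_le_norm (z + n)
    simp at this
    exact (le_abs_self _).trans this
  have := abs_le.1 hx
  nlinarith

theorem summable_binetTerm {M : ℝ} (hM : 0 ≤ M) {z : ℂ} (hx : |z.re| ≤ M) (hy : 2 ≤ z.im) :
    Summable (fun n : ℕ => binetTerm (z + n)) ∧
      ‖∑' n : ℕ, binetTerm (z + n)‖ ≤ 4 * (M + 2) ^ 2 / z.im := by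
  set y := z.im with hydef
  have hb : ∀ n : ℕ, ‖binetTerm (z + n)‖ ≤
      2 * (M + 2) ^ 2 * (1 / (y + n - 1) - 1 / (y + (n + 1 : ℕ) - 1)) := by
    intro n
    have hn := add_nat_le_norm hM hx hy n
    have h0 : (0 : ℝ) ≤ n := n.cast_nonneg
    have h1 : y ≤ ‖z + n‖ := by
      have := Complex.abs_im_le_norm (z + n)
      simp at this
      exact (le_abs_self _).trans this
    refine (norm_binetTerm_le (hy.trans h1)).trans ?_
    have h3 : (y + n) ^ 2 ≤ (M + 2) ^ 2 * ‖z + n‖ ^ 2 := by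
      rw [← mul_pow]
      exact pow_le_pow_left₀ (by linarith) hn 2
    have hp : 0 < ‖z + n‖ := by linarith
    have h4 : 2 / ‖z + n‖ ^ 2 ≤ 2 * (M + 2) ^ 2 / (y + n) ^ 2 := by
      rw [div_le_div_iff₀ (by positivity) (by positivity)]
      linarith
    refine h4.trans ?_
    have h5 : 1 / (y + n - 1) - 1 / (y + (n + 1 : ℕ) - 1) = 1 / ((y + n - 1) * (y + n)) := by
      push_cast
      have : y + n - 1 ≠ 0 := by linarith
      have : y + n ≠ 0 := by linarith
      have h : y + (n + 1) - 1 = y + n := by ring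
      rw [h]
      field_simp
      ring
    rw [h5, mul_one_div]
    gcongr
    · nlinarith
    · nlinarith
  have htend : Tendsto (fun n : ℕ => 1 / (y + n - 1)) atTop (nhds 0) := by
    have : Tendsto (fun n : ℕ => y + n - 1) atTop atTop := by
      refine tendsto_atTop_add_const_right _ _ (tendsto_atTop_add_const_left _ _ ?_)
      exact tendsto_natCast_atTop_atTop
    simpa [one_div] using! this.inv_tendsto_atTop
  have hmono : ∀ n : ℕ, 0 ≤ 1 / (y + n - 1) - 1 / (y + (n + 1 : ℕ) - 1) := by
    intro n
    have h0 : (0 : ℝ) ≤ n := n.cast_nonneg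
    rw [sub_nonneg]
    push_cast
    gcongr <;> linarith
  have htel : HasSum (fun n : ℕ => 1 / (y + n - 1) - 1 / (y + (n + 1 : ℕ) - 1)) (1 / (y - 1)) := by
    rw [hasSum_iff_tendsto_nat_of_nonneg hmono]
    have : ∀ n : ℕ, ∑ i ∈ Finset.range n, (1 / (y + i - 1) - 1 / (y + (i + 1 : ℕ) - 1)) =
        1 / (y - 1) - 1 / (y + n - 1) := by
      intro n
      rw [Finset.sum_range_sub' (fun i : ℕ => 1 / (y + i - 1))]
      simp
    simp_rw [this]
    simpa using htend.const_sub (1 / (y - 1))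
  have hS := htel.mul_left (2 * (M + 2) ^ 2)
  refine ⟨Summable.of_norm_bounded hS.summable hb, (tsum_of_norm_bounded hS hb).trans ?_⟩
  rw [mul_one_div, div_le_div_iff₀ (by linarith) (by linarith)]
  nlinarith [sq_nonneg (M + 2)]

theorem exp_stirlingMain_mul {z : ℂ} (hy : 0 < z.im) (m : ℕ) :
    Complex.exp (stirlingMain z + ∑ n ∈ Finset.range m, binetTerm (z + n)) *
      ∏ n ∈ Finset.range m, (z + n) = Complex.exp (stirlingMain (z + m)) := by
  induction m with
  | zero => simp
  | succ m ih =>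
    rw [Finset.sum_range_succ, Finset.prod_range_succ, ← add_assoc, Complex.exp_add,
      mul_mul_mul_comm, ih]
    have him : 0 < (z + m).im := by simpa using hy
    have hne : z + m ≠ 0 := by intro h; rw [h] at him; simp at him
    have h : stirlingMain (z + (m + 1 : ℕ)) = stirlingMain (z + m) + binetTerm (z + m) +
        Complex.log (z + m) := by
      have := log_eq_log_add_log_div (z := z + m) (w := z + (m + 1 : ℕ)) him (by simpa using hy)
      have h2 : (z + (m + 1 : ℕ)) / (z + m) = 1 + 1 / (z + m) := by
        field_simp
        push_cast; ring
      rw [h2] at this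
      rw [stirlingMain, stirlingMain, binetTerm, this]
      push_cast
      ring
    rw [h, Complex.exp_add, Complex.exp_add, Complex.exp_log hne]
    ring

theorem tendsto_factorial_div_exp_stirlingMain {z : ℂ} (hy : 0 < z.im) :
    Tendsto (fun m : ℕ => (m : ℂ) ^ z * (m.factorial : ℂ) /
      Complex.exp (stirlingMain (z + (m + 1 : ℕ)))) atTop (nhds ((√(2 * π) : ℝ) : ℂ)) := by
  have hlog : Tendsto (fun m : ℕ => (m : ℂ) * Complex.log (1 + (z + 1) / m)) atTop
      (nhds (z + 1)) := by
    apply Complex.tendsto_nat_mul_log_one_add_of_tendsto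
    refine tendsto_const_nhds.congr' ?_
    filter_upwards [eventually_gt_atTop 0] with m hm
    have : (m : ℂ) ≠ 0 := by exact_mod_cast hm.ne'
    field_simp
  have hlog0 : Tendsto (fun m : ℕ => Complex.log (1 + (z + 1) / m)) atTop (nhds 0) := by
    have h1 : Tendsto (fun m : ℕ => ((m : ℂ))⁻¹) atTop (nhds 0) :=
      tendsto_inv_atTop_nhds_zero_nat
    have := h1.mul hlog
    rw [zero_mul] at this
    refine this.congr' ?_
    filter_upwards [eventually_gt_atTop 0] with m hm
    have : (m : ℂ) ≠ 0 := by exact_mod_cast hm.ne'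
    field_simp
  have hst : Tendsto (fun m : ℕ => (((Stirling.stirlingSeq m * √2 : ℝ)) : ℂ)) atTop
      (nhds ((√(2 * π) : ℝ) : ℂ)) := by
    refine (Complex.continuous_ofReal.tendsto _).comp ?_
    have := Stirling.tendsto_stirlingSeq_sqrt_pi.mul_const (√2)
    rwa [← Real.sqrt_mul (by positivity), mul_comm π 2] at this
  have hE : Tendsto (fun m : ℕ => Complex.exp (z + 1 - (m * Complex.log (1 + (z + 1) / m) +
      (z + 1 / 2) * Complex.log (1 + (z + 1) / m)))) atTop (nhds 1) := by
    have := ((hlog.add (hlog0.const_mul (z + 1 / 2))).const_sub (z + 1)).cexp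
    simpa using this
  have := hst.mul hE
  rw [mul_one] at this
  refine this.congr' ?_
  filter_upwards [eventually_gt_atTop 0] with m hm
  have hmR : (0 : ℝ) < m := by exact_mod_cast hm
  have hm0 : (m : ℂ) ≠ 0 := by exact_mod_cast hm.ne'
  have him : 0 < (1 + (z + 1) / m).im := by
    simp only [Complex.add_im, Complex.one_im, Complex.div_natCast_im, add_zero, zero_add]
    positivity
  have hne : (1 + (z + 1) / m) ≠ 0 := by intro h; rw [h] at him; simp at him
  have hl : Complex.log (z + (m + 1 : ℕ)) = ((Real.log m : ℝ) : ℂ) +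
      Complex.log (1 + (z + 1) / m) := by
    rw [← Complex.log_ofReal_mul hmR hne]
    congr 1
    push_cast
    field_simp
    ring
  have hfac : (m.factorial : ℝ) = Stirling.stirlingSeq m * √2 *
      Real.exp ((m + 1 / 2) * Real.log m - m) := by
    rw [Stirling.stirlingSeq]
    have h1 : Real.exp ((m + 1 / 2) * Real.log m - m) = √m * (m / Real.exp 1) ^ m := by
      rw [Real.exp_sub, add_mul, Real.exp_add, div_pow, ← Real.exp_nat_mul, mul_one,
        Real.exp_nat_mul, Real.exp_log hmR, Real.sqrt_eq_rpow, Real.rpow_def_of_pos hmR]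
      rw [mul_comm (Real.log m) (1 / 2)]
      ring
    rw [h1, Real.sqrt_mul (by norm_num)]
    field_simp
  have hfacC : (m.factorial : ℂ) = ((Stirling.stirlingSeq m * √2 : ℝ) : ℂ) *
      Complex.exp ((m + 1 / 2) * ((Real.log m : ℝ) : ℂ) - m) := by
    have := congrArg (fun x : ℝ => (x : ℂ)) hfac
    push_cast at this ⊢
    rw [this]
  rw [hfacC, stirlingMain, hl, Complex.cpow_def_of_ne_zero hm0, mul_comm (Complex.exp _),
    mul_assoc, mul_div_assoc, ← Complex.exp_add, ← Complex.exp_sub]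
  congr 2
  rw [← Complex.natCast_log]
  push_cast
  ring

theorem Gamma_eq_exp_stirlingMain {M : ℝ} (hM : 0 ≤ M) {z : ℂ} (hx : |z.re| ≤ M)
    (hy : 2 ≤ z.im) :
    Complex.Gamma z = (√(2 * π) : ℝ) *
      Complex.exp (stirlingMain z + ∑' n : ℕ, binetTerm (z + n)) := by
  have hy0 : 0 < z.im := by linarith
  have hG := Complex.GammaSeq_tendsto_Gamma z
  have h1 := tendsto_factorial_div_exp_stirlingMain hy0
  have h2 := ((summable_binetTerm hM hx hy).1.hasSum.tendsto_sum_nat.comp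
    (tendsto_add_atTop_nat 1)).const_add (stirlingMain z) |>.cexp
  refine tendsto_nhds_unique hG ((h1.mul h2).congr ?_)
  intro m
  have h3 := exp_stirlingMain_mul hy0 (m + 1)
  simp only [Function.comp]
  have hp : ∏ n ∈ Finset.range (m + 1), (z + n) ≠ 0 := by
    rw [Finset.prod_ne_zero_iff]
    intro n _ h
    have := congrArg Complex.im h
    simp at this
    linarith
  rw [Complex.GammaSeq, ← h3]
  have := Complex.exp_ne_zero (stirlingMain z + ∑ n ∈ Finset.range (m + 1), binetTerm (z + n))
  field_simp

/-- Stirling's formula for the Gamma function on vertical strips, with relative error `O(1/y)`. -/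
theorem exists_Gamma_stirling {M : ℝ} (hM : 0 ≤ M) : ∃ C T : ℝ, 0 < C ∧ 2 ≤ T ∧
    ∀ x y : ℝ, |x| ≤ M → T ≤ y → ∃ E : ℂ, ‖E‖ ≤ C / y ∧
      Complex.Gamma (x + y * Complex.I) =
        Complex.exp ((x + y * Complex.I - 1 / 2) * ((Real.log y : ℝ) + π / 2 * Complex.I)
          - y * Complex.I + (Real.log (2 * π) / 2 : ℝ) + E) := by
  refine ⟨4 * (M + 2) ^ 2 + (M ^ 2 + (M + 1) * (3 / 2 * M)), 2 * (M + 1), by positivity,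
    by linarith, ?_⟩
  intro x y hx hy
  have hy2 : 2 ≤ y := by linarith
  have hy0 : 0 < y := by linarith
  set z : ℂ := x + y * Complex.I with hz
  have hre : z.re = x := by simp [hz]
  have him : z.im = y := by simp [hz]
  have hG := Gamma_eq_exp_stirlingMain hM (z := z) (by rwa [hre]) (by rwa [him])
  have hB := (summable_binetTerm hM (z := z) (by rwa [hre]) (by rwa [him])).2
  rw [him] at hB
  set l := Complex.log (1 + x / (y * Complex.I)) with hl
  have hyC : (y : ℂ) ≠ 0 := by exact_mod_cast hy0.ne'
  have hyI : (y * Complex.I : ℂ) ≠ 0 := by simp [hy0.ne']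
  have hlog : Complex.log z = (Real.log y : ℝ) + π / 2 * Complex.I + l := by
    have h1 := log_eq_log_add_log_div (z := y * Complex.I) (w := z) (by simpa using hy0)
      (by rwa [him])
    have h2 : z / (y * Complex.I) = 1 + x / (y * Complex.I) := by
      rw [hz]
      field_simp
      ring
    rw [h1, h2, Complex.log_ofReal_mul hy0 Complex.I_ne_zero, Complex.log_I]
  have hsmall : ‖(x / (y * Complex.I) : ℂ)‖ ≤ M / y := by
    simp only [norm_div, norm_mul, Complex.norm_I, mul_one, Complex.norm_real, Real.norm_eq_abs,
      abs_of_pos hy0]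
    gcongr
  have hhalf : M / y ≤ 1 / 2 := by
    rw [div_le_div_iff₀ hy0 (by norm_num)]; linarith
  have hl1 : ‖l‖ ≤ 3 / 2 * (M / y) :=
    (Complex.norm_log_one_add_half_le_self (hsmall.trans hhalf)).trans (by gcongr)
  have hl2 : ‖l - x / (y * Complex.I)‖ ≤ (M / y) ^ 2 := by
    refine (Complex.norm_log_one_add_sub_self_le (by linarith)).trans ?_
    have : (1 - ‖(x / (y * Complex.I) : ℂ)‖)⁻¹ ≤ 2 := by
      rw [inv_le_comm₀ (by linarith) (by norm_num)]; linarith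
    have h0 : 0 ≤ (1 - ‖(x / (y * Complex.I) : ℂ)‖)⁻¹ := inv_nonneg.2 (by linarith)
    calc _ ≤ (M / y) ^ 2 * 2 / 2 := by gcongr
      _ = _ := by ring
  refine ⟨y * Complex.I * (l - x / (y * Complex.I)) + (x - 1 / 2) * l +
    ∑' n : ℕ, binetTerm (z + n), ?_, ?_⟩
  · have h1 : ‖y * Complex.I * (l - x / (y * Complex.I))‖ ≤ M ^ 2 / y := by
      rw [norm_mul, norm_mul, Complex.norm_I, mul_one, Complex.norm_real, Real.norm_eq_abs,
        abs_of_pos hy0]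
      calc _ ≤ y * (M / y) ^ 2 := by gcongr
        _ = _ := by field_simp
    have h2 : ‖((x : ℂ) - 1 / 2) * l‖ ≤ (M + 1) * (3 / 2 * M) / y := by
      rw [norm_mul]
      have : ‖(x : ℂ) - 1 / 2‖ ≤ M + 1 := by
        refine (norm_sub_le _ _).trans ?_
        rw [Complex.norm_real, Real.norm_eq_abs]
        have : ‖(1 / 2 : ℂ)‖ = 1 / 2 := by norm_num
        rw [this]; linarith
      calc _ ≤ (M + 1) * (3 / 2 * (M / y)) := by gcongr
        _ = _ := by ring
    calc _ ≤ M ^ 2 / y + (M + 1) * (3 / 2 * M) / y + 4 * (M + 2) ^ 2 / y :=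
          (norm_add₃_le).trans (by gcongr)
      _ = _ := by ring
  · have hs : ((√(2 * π) : ℝ) : ℂ) = Complex.exp ((Real.log (2 * π) / 2 : ℝ)) := by
      rw [← Complex.ofReal_exp, Real.sqrt_eq_rpow, Real.rpow_def_of_pos (by positivity)]
      congr 2
      ring
    rw [hG, hs, ← Complex.exp_add, stirlingMain, hlog]
    congr 1
    have : y * Complex.I * (l - x / (y * Complex.I)) = y * Complex.I * l - x := by
      field_simp
    rw [this, hz]
    ring

/-- The order of magnitude of `|Γ(x + iy)|`. -/
noncomputable def gammaSize (x y : ℝ) : ℝ := |y| ^ (x - 1 / 2) * Real.exp (-(π / 2 * |y|))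

theorem exists_norm_Gamma_bounds {M : ℝ} (hM : 0 ≤ M) : ∃ c C T : ℝ, 0 < c ∧ 0 < C ∧ 2 ≤ T ∧
    ∀ x y : ℝ, |x| ≤ M → T ≤ |y| →
      c * gammaSize x y ≤ ‖Complex.Gamma (x + y * Complex.I)‖ ∧
      ‖Complex.Gamma (x + y * Complex.I)‖ ≤ C * gammaSize x y := by
  obtain ⟨C, T, hC, hT, h⟩ := exists_Gamma_stirling hM
  set K := Real.log (2 * π) / 2
  have hpos : ∀ x y : ℝ, |x| ≤ M → T ≤ y →
      Real.exp (K - C) * gammaSize x y ≤ ‖Complex.Gamma (x + y * Complex.I)‖ ∧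
      ‖Complex.Gamma (x + y * Complex.I)‖ ≤ Real.exp (K + C) * gammaSize x y := by
    intro x y hx hy
    obtain ⟨E, hE, hG⟩ := h x y hx hy
    have hy0 : 0 < y := by linarith
    have hE' : |E.re| ≤ C := by
      refine (Complex.abs_re_le_norm E).trans (hE.trans ?_)
      exact div_le_self hC.le (by linarith)
    have hE2 := abs_le.1 hE'
    have hre : ((x + y * Complex.I - 1 / 2) * ((Real.log y : ℝ) + π / 2 * Complex.I)
          - y * Complex.I + (Real.log (2 * π) / 2 : ℝ) + E).re =
          Real.log y * (x - 1 / 2) + -(π / 2 * y) + (K + E.re) := by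
      have h1 : (π / 2 : ℂ) = ((π / 2 : ℝ) : ℂ) := by push_cast; ring
      have h2 : (1 / 2 : ℂ) = ((1 / 2 : ℝ) : ℂ) := by push_cast; ring
      rw [h1, h2]
      simp only [Complex.add_re, Complex.sub_re, Complex.mul_re, Complex.ofReal_re, Complex.I_re,
        Complex.ofReal_im, Complex.I_im, Complex.add_im, Complex.mul_im, Complex.sub_im]
      ring
    have hgs : gammaSize x y = Real.exp (Real.log y * (x - 1 / 2) + -(π / 2 * y)) := by
      rw [gammaSize, abs_of_pos hy0, Real.rpow_def_of_pos hy0, Real.exp_add]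
    rw [hG, Complex.norm_exp, hre, hgs, ← Real.exp_add, ← Real.exp_add]
    constructor <;> apply Real.exp_le_exp.2 <;> linarith
  refine ⟨Real.exp (K - C), Real.exp (K + C), T, Real.exp_pos _, Real.exp_pos _, hT, ?_⟩
  intro x y hx hy
  rcases le_total 0 y with hy0 | hy0
  · rw [abs_of_nonneg hy0] at hy
    exact hpos x y hx hy
  · rw [abs_of_nonpos hy0] at hy
    have := hpos x (-y) hx hy
    have hc : ‖Complex.Gamma (x + y * Complex.I)‖ =
        ‖Complex.Gamma (x + ((-y : ℝ) : ℂ) * Complex.I)‖ := by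
      rw [← Complex.norm_conj, ← Complex.Gamma_conj]
      simp
    have hs : gammaSize x y = gammaSize x (-y) := by simp [gammaSize]
    rw [hc, hs]
    exact this

/-- A continuous function on the line with polynomial decay of order `p` is bounded by a multiple
of `(1 + |t|) ^ (-p)`. -/
theorem exists_bound_one_add_norm {f : ℝ → ℂ} (hf : Continuous f) {C T p : ℝ} (hT : 1 ≤ T)
    (hp : 0 ≤ p) (hC : 0 ≤ C)
    (hb : ∀ t, T ≤ |t| → ‖f t‖ ≤ C * |t| ^ (-p)) :
    ∃ C', 0 ≤ C' ∧ ∀ t, ‖f t‖ ≤ C' * (1 + ‖t‖) ^ (-p) := by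
  obtain ⟨B, hB⟩ := (isCompact_Icc (a := -T) (b := T)).exists_bound_of_continuousOn hf.continuousOn
  have hB0 : 0 ≤ B := (norm_nonneg _).trans (hB 0 ⟨by linarith, by linarith⟩)
  refine ⟨B * (1 + T) ^ p + C * 2 ^ p, by positivity, fun t => ?_⟩
  rw [Real.norm_eq_abs, Real.rpow_neg (by positivity), ← div_eq_mul_inv,
    le_div_iff₀ (by positivity)]
  rcases le_total T |t| with ht | ht
  · have h1 : (1 + |t|) ^ p ≤ 2 ^ p * |t| ^ p := by
      rw [← Real.mul_rpow (by norm_num) (abs_nonneg _)]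
      exact Real.rpow_le_rpow (by positivity) (by linarith) hp
    have ht0 : 0 < |t| := by linarith
    have hpp : 0 < |t| ^ p := Real.rpow_pos_of_pos ht0 _
    have h2 := hb t ht
    rw [Real.rpow_neg ht0.le] at h2
    calc ‖f t‖ * (1 + |t|) ^ p ≤ C * (|t| ^ p)⁻¹ * (2 ^ p * |t| ^ p) := by gcongr
      _ = C * 2 ^ p := by field_simp
      _ ≤ _ := by
        have : 0 ≤ B * (1 + T) ^ p := by positivity
        linarith
  · have h2 := hB t (abs_le.1 ht)
    calc ‖f t‖ * (1 + |t|) ^ p ≤ B * (1 + T) ^ p := by gcongr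
      _ ≤ _ := by
        have : 0 ≤ C * (2 : ℝ) ^ p := by positivity
        linarith

theorem integrable_of_decay {f : ℝ → ℂ} (hf : Continuous f) {C T p : ℝ} (hT : 1 ≤ T)
    (hp : 1 < p) (hC : 0 ≤ C)
    (hb : ∀ t, T ≤ |t| → ‖f t‖ ≤ C * |t| ^ (-p)) : Integrable f := by
  obtain ⟨C', -, h⟩ := exists_bound_one_add_norm hf hT (by linarith) hC hb
  refine Integrable.mono' ((integrable_one_add_norm (E := ℝ) (μ := volume) (r := p)
    (by simpa using hp)).const_mul C') hf.aestronglyMeasurable (Eventually.of_forall h)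

theorem continuous_vertical {f : ℂ → ℂ} {σ : ℝ} (hd : ∀ s : ℂ, s.re = σ → ContinuousAt f s) :
    Continuous (fun t : ℝ => f (σ + t * Complex.I)) := by
  rw [continuous_iff_continuousAt]
  intro t
  have h1 : ContinuousAt (fun t : ℝ => (σ + t * Complex.I : ℂ)) t := by fun_prop
  exact ContinuousAt.comp (f := fun t : ℝ => (σ + t * Complex.I : ℂ))
    (hd (σ + t * Complex.I) (by simp)) h1

theorem integrable_vertical {f : ℂ → ℂ} {σ : ℝ} (hd : ∀ s : ℂ, s.re = σ → ContinuousAt f s)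
    {C T p : ℝ} (hT : 1 ≤ T) (hp : 1 < p) (hC : 0 ≤ C)
    (hb : ∀ s : ℂ, s.re = σ → T ≤ |s.im| → ‖f s‖ ≤ C * |s.im| ^ (-p)) :
    Integrable (fun t : ℝ => f (σ + t * Complex.I)) := by
  refine integrable_of_decay (continuous_vertical hd) hT hp hC fun t ht => ?_
  simpa using hb (σ + t * Complex.I) (by simp) (by simpa using ht)

/-- Moving a vertical line of integration across a strip in which the integrand is holomorphic. -/
theorem integral_vertical_eq {f : ℂ → ℂ} {a b : ℝ} (hab : a ≤ b)
    (hd : ∀ s : ℂ, a ≤ s.re → s.re ≤ b → DifferentiableAt ℂ f s)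
    {C T p : ℝ} (hT : 1 ≤ T) (hp : 1 < p) (hC : 0 ≤ C)
    (hb : ∀ s : ℂ, a ≤ s.re → s.re ≤ b → T ≤ |s.im| → ‖f s‖ ≤ C * |s.im| ^ (-p)) :
    ∫ t : ℝ, f (a + t * Complex.I) = ∫ t : ℝ, f (b + t * Complex.I) := by
  have hia : Integrable (fun t : ℝ => f (a + t * Complex.I)) :=
    integrable_vertical (fun s hs => (hd s hs.ge (hs.le.trans hab)).continuousAt) hT hp hC
      (fun s hs => hb s hs.ge (hs.le.trans hab))
  have hib : Integrable (fun t : ℝ => f (b + t * Complex.I)) :=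
    integrable_vertical (fun s hs => (hd s (hs ▸ hab) hs.le).continuousAt) hT hp hC
      (fun s hs => hb s (hs ▸ hab) hs.le)
  have hta := intervalIntegral_tendsto_integral hia tendsto_neg_atTop_atBot tendsto_id
  have htb := intervalIntegral_tendsto_integral hib tendsto_neg_atTop_atBot tendsto_id
  have hdecay : Tendsto (fun R : ℝ => C * R ^ (-p) * |b - a|) atTop (nhds 0) := by
    have := ((tendsto_rpow_neg_atTop (y := p) (by linarith)).const_mul C).mul_const |b - a|
    simpa using this
  have hhor : ∀ e : ℝ, |e| = 1 →
      Tendsto (fun R : ℝ => ∫ x : ℝ in a..b, f (x + ((e * R : ℝ) : ℂ) * Complex.I)) atTop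
        (nhds 0) := by
    intro e he
    refine squeeze_zero_norm' ?_ hdecay
    filter_upwards [eventually_ge_atTop T] with R hR
    have hR0 : 0 < R := by linarith
    refine intervalIntegral.norm_integral_le_of_norm_le_const fun x hx => ?_
    rw [Set.uIoc_of_le hab] at hx
    have := hb (x + ((e * R : ℝ) : ℂ) * Complex.I) (by simpa using hx.1.le) (by simpa using hx.2)
      (by simpa [abs_mul, he, abs_of_pos hR0] using hR)
    simpa [abs_mul, he, abs_of_pos hR0] using this
  have hrect : ∀ R : ℝ, (∫ x : ℝ in a..b, f (x + ((-1 * R : ℝ) : ℂ) * Complex.I)) -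
      (∫ x : ℝ in a..b, f (x + ((1 * R : ℝ) : ℂ) * Complex.I)) +
      Complex.I • (∫ y : ℝ in (-R)..R, f (b + y * Complex.I)) -
      Complex.I • (∫ y : ℝ in (-R)..R, f (a + y * Complex.I)) = 0 := by
    intro R
    have := Complex.integral_boundary_rect_eq_zero_of_differentiableOn f
      (a + ((-1 * R : ℝ) : ℂ) * Complex.I) (b + ((1 * R : ℝ) : ℂ) * Complex.I) ?_
    · simpa using this
    · intro s hs
      have h1 := hs.1
      simp only [Set.mem_preimage] at h1
      have h2 : s.re ∈ Set.uIcc a b := by simpa using h1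
      rw [Set.uIcc_of_le hab] at h2
      exact (hd s h2.1 h2.2).differentiableWithinAt
  have hlim := (((hhor (-1) (by simp)).sub (hhor 1 (by simp))).add
    (htb.const_smul Complex.I)).sub (hta.const_smul Complex.I)
  have h0 := tendsto_nhds_unique (hlim.congr fun R => hrect R) tendsto_const_nhds
  rw [sub_zero, zero_add, ← smul_sub, smul_eq_zero] at h0
  rcases h0 with h0 | h0
  · exact absurd h0 Complex.I_ne_zero
  · exact (sub_eq_zero.1 h0).symm

theorem integral_div_sq_add_sq {p : ℝ} (hp : p ≠ 0) :
    Integrable (fun t : ℝ => p / (p ^ 2 + t ^ 2)) ∧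
      ∫ t : ℝ, p / (p ^ 2 + t ^ 2) = SignType.sign p * π := by
  have h : (fun t : ℝ => p / (p ^ 2 + t ^ 2)) = fun t => p⁻¹ * (1 + (p⁻¹ * t) ^ 2)⁻¹ := by
    funext t
    have : p ^ 2 + t ^ 2 ≠ 0 := by positivity
    have : 1 + (p⁻¹ * t) ^ 2 ≠ 0 := by positivity
    field_simp
  rw [h]
  refine ⟨((integrable_inv_one_add_sq).comp_mul_left' (inv_ne_zero hp)).const_mul _, ?_⟩
  rw [integral_const_mul, Measure.integral_comp_mul_left (fun t => (1 + t ^ 2)⁻¹),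
    integral_univ_inv_one_add_sq, inv_inv, smul_eq_mul, ← mul_assoc]
  congr 1
  rcases lt_or_gt_of_ne hp with h | h
  · rw [abs_of_neg h, sign_neg h]; simp; field_simp
  · rw [abs_of_pos h, sign_pos h]; simp; field_simp

theorem integral_inv_sub_inv {p q : ℝ} (hp : p ≠ 0) (hq : q ≠ 0) :
    Integrable (fun t : ℝ => 1 / ((p : ℂ) + t * Complex.I) - 1 / ((q : ℂ) + t * Complex.I)) ∧
    ∫ t : ℝ, (1 / ((p : ℂ) + t * Complex.I) - 1 / ((q : ℂ) + t * Complex.I)) =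
      (SignType.sign p * π - SignType.sign q * π : ℝ) := by
  have hne : ∀ r : ℝ, r ≠ 0 → ∀ t : ℝ, (r : ℂ) + t * Complex.I ≠ 0 := by
    intro r hr t h
    have := congrArg Complex.re h
    simp at this
    exact hr this
  have hInt : Integrable (fun t : ℝ =>
      1 / ((p : ℂ) + t * Complex.I) - 1 / ((q : ℂ) + t * Complex.I)) := by
    refine integrable_of_decay (C := |q - p|) (T := 1) (p := 2) ?_ le_rfl (by norm_num)
      (abs_nonneg _) ?_
    · refine Continuous.sub ?_ ?_ <;> refine Continuous.div (by fun_prop) (by fun_prop) ?_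
      · exact hne p hp
      · exact hne q hq
    · intro t ht
      have ht0 : 0 < |t| := by linarith
      rw [div_sub_div _ _ (hne p hp t) (hne q hq t), norm_div, norm_mul]
      have h1 : ∀ r : ℝ, |t| ≤ ‖(r : ℂ) + t * Complex.I‖ := fun r => by
        simpa using Complex.abs_im_le_norm ((r : ℂ) + t * Complex.I)
      have h2 : (1 * ((q : ℂ) + t * Complex.I) - ((p : ℂ) + t * Complex.I) * 1) =
          ((q - p : ℝ) : ℂ) := by push_cast; ring
      rw [h2, Complex.norm_real, Real.norm_eq_abs, Real.rpow_neg ht0.le, ← div_eq_mul_inv]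
      have h3 : |t| ^ (2 : ℝ) = |t| * |t| := by
        rw [show (2 : ℝ) = ((2 : ℕ) : ℝ) by norm_num, Real.rpow_natCast]; ring
      rw [h3]
      gcongr
      · exact h1 p
      · exact h1 q
  refine ⟨hInt, ?_⟩
  obtain ⟨hip, hp'⟩ := integral_div_sq_add_sq hp
  obtain ⟨hiq, hq'⟩ := integral_div_sq_add_sq hq
  have hform : ∀ t : ℝ, 1 / ((p : ℂ) + t * Complex.I) - 1 / ((q : ℂ) + t * Complex.I) =
      ((p / (p ^ 2 + t ^ 2) - q / (q ^ 2 + t ^ 2) : ℝ) : ℂ) -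
      Complex.I * ((t / (p ^ 2 + t ^ 2) - t / (q ^ 2 + t ^ 2) : ℝ) : ℂ) := by
    have h1 : ∀ r : ℝ, r ≠ 0 → ∀ t : ℝ, 1 / ((r : ℂ) + t * Complex.I) =
        ((r / (r ^ 2 + t ^ 2) : ℝ) : ℂ) - Complex.I * ((t / (r ^ 2 + t ^ 2) : ℝ) : ℂ) := by
      intro r hr t
      have h2 : ((r ^ 2 + t ^ 2 : ℝ) : ℂ) ≠ 0 := by
        have : r ^ 2 + t ^ 2 ≠ 0 := by positivity
        exact_mod_cast this
      have h3 := hne r hr t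
      push_cast at h2 ⊢
      field_simp
      linear_combination ((t : ℂ) ^ 2) * Complex.I_sq
    intro t
    rw [h1 p hp, h1 q hq]
    push_cast
    ring
  have hreal : Integrable (fun t : ℝ => ((p / (p ^ 2 + t ^ 2) - q / (q ^ 2 + t ^ 2) : ℝ) : ℂ)) :=
    (hip.sub hiq).ofReal
  have himag : Integrable (fun t : ℝ =>
      Complex.I * ((t / (p ^ 2 + t ^ 2) - t / (q ^ 2 + t ^ 2) : ℝ) : ℂ)) := by
    have := hreal.sub hInt
    refine this.congr (Eventually.of_forall fun t => ?_)
    simp only [Pi.sub_apply]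
    rw [hform t]; ring
  have hodd : ∫ t : ℝ, Complex.I * ((t / (p ^ 2 + t ^ 2) - t / (q ^ 2 + t ^ 2) : ℝ) : ℂ) = 0 := by
    set F : ℝ → ℂ := fun t => Complex.I * ((t / (p ^ 2 + t ^ 2) - t / (q ^ 2 + t ^ 2) : ℝ) : ℂ)
    have h1 : ∫ t, F (-t) = ∫ t, F t := integral_neg_eq_self F volume
    have h2 : ∀ t, F (-t) = - F t := by
      intro t
      simp only [F, neg_sq]
      push_cast
      ring
    simp_rw [h2] at h1
    rw [integral_neg] at h1
    exact self_eq_neg.1 h1.symm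
  simp_rw [hform]
  rw [integral_sub hreal himag, hodd, sub_zero, integral_complex_ofReal, integral_sub hip hiq, hp',
    hq']

set_option maxHeartbeats 800000 in
/-- Moving a vertical line of integration across a simple pole at `1`. -/
theorem integral_vertical_sub_eq_residue {h : ℂ → ℂ} {a b : ℝ} (ha : a < 1) (hb1 : 1 < b)
    (hd : ∀ s : ℂ, a ≤ s.re → s.re ≤ b → DifferentiableAt ℂ h s)
    {C T p : ℝ} (hT : 1 ≤ T) (hp : 1 < p) (hC : 0 ≤ C)
    (hb : ∀ s : ℂ, a ≤ s.re → s.re ≤ b → T ≤ |s.im| → ‖h s‖ ≤ C * |s.im| ^ (-p)) :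
    (∫ t : ℝ, h (b + t * Complex.I) / (b + t * Complex.I - 1)) -
      ∫ t : ℝ, h (a + t * Complex.I) / (a + t * Complex.I - 1) = 2 * π * h 1 := by
  set d : ℝ := 2 - a with hdd
  have hd0 : (d : ℂ) ≠ 0 := by
    have : d ≠ 0 := by rw [hdd]; linarith
    exact_mod_cast this
  have hden : ∀ s : ℂ, a ≤ s.re → s - 1 + d ≠ 0 := by
    intro s hs h0
    have := congrArg Complex.re h0
    simp at this
    linarith
  set k : ℂ → ℂ := fun s => h s - h 1 * (d / (s - 1 + d)) with hk
  have hk1 : k 1 = 0 := by simp [hk, hd0]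
  have hkd : ∀ s : ℂ, a ≤ s.re → s.re ≤ b → DifferentiableAt ℂ k s := by
    intro s h1 h2
    exact (hd s h1 h2).sub (DifferentiableAt.const_mul (DifferentiableAt.div
      (c := fun _ : ℂ => (d : ℂ)) (d := fun s : ℂ => s - 1 + (d : ℂ)) (differentiableAt_const _)
      (by fun_prop) (hden s h1)) _)
  have hkf : ∀ s : ℂ, s ≠ 1 → dslope k 1 s =
      h s / (s - 1) - h 1 * (d / ((s - 1) * (s - 1 + d))) := by
    intro s hs
    rw [dslope_of_ne _ hs, slope_def_field, hk1, hk]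
    have : s - 1 ≠ 0 := sub_ne_zero.2 hs
    rw [sub_zero, sub_div]
    congr 1
    rw [mul_div_assoc, div_div, mul_comm (s - 1 + d)]
  have hfd : ∀ s : ℂ, a ≤ s.re → s.re ≤ b → DifferentiableAt ℂ (dslope k 1) s := by
    intro s h1 h2
    rcases eq_or_ne s 1 with rfl | hs
    · have hO : IsOpen {s : ℂ | a < s.re ∧ s.re < b} :=
        (isOpen_lt continuous_const Complex.continuous_re).inter
          (isOpen_lt Complex.continuous_re continuous_const)
      have hmem : {s : ℂ | a < s.re ∧ s.re < b} ∈ nhds (1 : ℂ) :=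
        hO.mem_nhds (by simp [ha, hb1])
      have := (Complex.differentiableOn_dslope hmem).2
        (fun s hs => (hkd s hs.1.le hs.2.le).differentiableWithinAt)
      exact this.differentiableAt hmem
    · exact (differentiableAt_dslope_of_ne hs).2 (hkd s h1 h2)
  have hne : ∀ s : ℂ, 1 ≤ |s.im| → s ≠ 1 := by
    rintro s hs rfl
    simp at hs
    linarith
  have hkb : ∀ s : ℂ, a ≤ s.re → s.re ≤ b → T ≤ |s.im| →
      ‖dslope k 1 s‖ ≤ (C + ‖h 1‖ * ‖(d : ℂ)‖) * |s.im| ^ (-(min p 2)) := by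
    intro s h1 h2 h3
    have hs := hne s (hT.trans h3)
    have him0 : 1 ≤ |s.im| := hT.trans h3
    have e1 : |s.im| ≤ ‖s - 1‖ := by simpa using Complex.abs_im_le_norm (s - 1)
    have e2 : |s.im| ≤ ‖s - 1 + d‖ := by simpa using Complex.abs_im_le_norm (s - 1 + d)
    have e3 : ‖h s / (s - 1)‖ ≤ C * |s.im| ^ (-(min p 2)) := by
      rw [norm_div]
      refine (div_le_self (norm_nonneg _) (him0.trans e1)).trans ((hb s h1 h2 h3).trans ?_)
      gcongr
      exact min_le_left _ _
    have e4 : ‖h 1 * (d / ((s - 1) * (s - 1 + d)))‖ ≤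
        ‖h 1‖ * ‖(d : ℂ)‖ * |s.im| ^ (-(min p 2)) := by
      rw [norm_mul, mul_assoc]
      gcongr
      rw [norm_div, norm_mul, div_eq_mul_inv]
      gcongr
      have : (‖s - 1‖ * ‖s - 1 + d‖)⁻¹ ≤ |s.im| ^ (-2 : ℝ) := by
        rw [Real.rpow_neg (abs_nonneg _)]
        have h3 : |s.im| ^ (2 : ℝ) = |s.im| * |s.im| := by
          rw [show (2 : ℝ) = ((2 : ℕ) : ℝ) by norm_num, Real.rpow_natCast]; ring
        rw [h3]
        gcongr
      exact this.trans (Real.rpow_le_rpow_of_exponent_le him0 (neg_le_neg (min_le_right _ _)))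
    rw [hkf s hs, add_mul]
    exact (norm_sub_le _ _).trans (add_le_add e3 e4)
  have hp2 : 1 < min p 2 := lt_min hp (by norm_num)
  have hC2 : 0 ≤ C + ‖h 1‖ * ‖(d : ℂ)‖ := by positivity
  have hmain := integral_vertical_eq (by linarith : a ≤ b) hfd hT hp2 hC2 hkb
  have hline : ∀ c : ℝ, c ≠ 1 → a ≤ c → c ≤ b →
      ∫ t : ℝ, h (c + t * Complex.I) / (c + t * Complex.I - 1) =
        (∫ t : ℝ, dslope k 1 (c + t * Complex.I)) +
          h 1 * (SignType.sign (c - 1) * π - SignType.sign (c - 1 + d) * π : ℝ) := by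
    intro c hc hca hcb
    have hp0 : c - 1 ≠ 0 := sub_ne_zero.2 hc
    have hq0 : c - 1 + d ≠ 0 := by rw [hdd]; linarith
    obtain ⟨hi, hv⟩ := integral_inv_sub_inv hp0 hq0
    have hInt := integrable_vertical (f := dslope k 1) (σ := c)
      (fun s hs => (hfd s (hs ▸ hca) (hs ▸ hcb)).continuousAt) hT hp2 hC2
      (fun s hs => hkb s (hs ▸ hca) (hs ▸ hcb))
    rw [← hv, ← integral_const_mul, ← integral_add hInt (hi.const_mul _)]
    congr 1
    funext t
    have hs : (c + t * Complex.I : ℂ) ≠ 1 := by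
      intro h0
      have := congrArg Complex.re h0
      simp at this
      exact hc this
    have h1 := sub_ne_zero.2 hs
    have h2 := hden (c + t * Complex.I) (by simpa using hca)
    rw [hkf _ hs]
    have e1 : ((c - 1 : ℝ) : ℂ) + t * Complex.I = c + t * Complex.I - 1 := by push_cast; ring
    have e2 : ((c - 1 + d : ℝ) : ℂ) + t * Complex.I = c + t * Complex.I - 1 + d := by
      push_cast; ring
    rw [e1, e2, div_sub_div _ _ h1 h2]
    ring
  rw [hline b hb1.ne' (by linarith) le_rfl, hline a ha.ne le_rfl (by linarith), hmain,
    sign_pos (by linarith : 0 < b - 1), sign_pos (by rw [hdd]; linarith : 0 < b - 1 + d),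
    sign_neg (by linarith : a - 1 < 0), sign_pos (by rw [hdd]; linarith : 0 < a - 1 + d)]
  push_cast
  simp
  ring

theorem norm_cpow_mul_cexp {a r : ℂ} {t : ℝ} (ht : 0 < t) :
    ‖(t : ℂ) ^ (a - 1) * Complex.exp (-(r * t))‖ =
      t ^ (a.re - 1) * Real.exp (-r.re * t ^ (1 : ℝ)) := by
  rw [norm_mul, Complex.norm_cpow_eq_rpow_re_of_pos ht, Complex.norm_exp]
  simp

theorem continuousOn_cpow_mul_cexp (a r : ℂ) :
    ContinuousOn (fun t : ℝ => (t : ℂ) ^ (a - 1) * Complex.exp (-(r * t))) (Set.Ioi 0) := by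
  refine ContinuousOn.mul (fun t ht => ?_) (by fun_prop)
  refine ContinuousAt.continuousWithinAt ?_
  exact ContinuousAt.comp (f := fun t : ℝ => (t : ℂ)) (g := fun z : ℂ => z ^ (a - 1))
    (continuousAt_cpow_const (by simpa using ht)) (by fun_prop)

theorem integrableOn_cpow_mul_cexp {a r : ℂ} (ha : 0 < a.re) (hr : 0 < r.re) :
    IntegrableOn (fun t : ℝ => (t : ℂ) ^ (a - 1) * Complex.exp (-(r * t))) (Set.Ioi 0) := by
  have h := integrableOn_rpow_mul_exp_neg_mul_rpow (p := 1) (s := a.re - 1) (b := r.re)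
    (by linarith) one_pos hr
  refine Integrable.mono' h
    ((continuousOn_cpow_mul_cexp a r).aestronglyMeasurable measurableSet_Ioi) ?_
  filter_upwards [ae_restrict_mem measurableSet_Ioi] with t ht
  exact (norm_cpow_mul_cexp ht).le

theorem integral_cpow_mul_cexp {a r : ℂ} (ha : 0 < a.re) (hr : 0 < r.re) :
    ∫ t : ℝ in Set.Ioi 0, (t : ℂ) ^ (a - 1) * Complex.exp (-(r * t)) =
      (1 / r) ^ a * Complex.Gamma a := by
  have hU : IsOpen {r : ℂ | 0 < r.re} := isOpen_lt continuous_const Complex.continuous_re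
  have hcv : Convex ℝ {r : ℂ | 0 < r.re} := convex_halfSpace_re_gt 0
  have hf : DifferentiableOn ℂ (fun r : ℂ => ∫ t : ℝ in Set.Ioi 0,
      (t : ℂ) ^ (a - 1) * Complex.exp (-(r * t))) {r : ℂ | 0 < r.re} := by
    intro r₀ hr₀
    simp only [Set.mem_ofPred_eq] at hr₀
    have hs : {r : ℂ | r₀.re / 2 < r.re} ∈ nhds r₀ :=
      (isOpen_lt continuous_const Complex.continuous_re).mem_nhds
        (by simp only [Set.mem_ofPred_eq]; linarith)
    have hb := integrableOn_rpow_mul_exp_neg_mul_rpow (p := 1) (s := (a + 1).re - 1)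
      (b := r₀.re / 2) (by simp; linarith) one_pos (by linarith)
    refine (hasDerivAt_integral_of_dominated_loc_of_deriv_le
      (F := fun r (t : ℝ) => (t : ℂ) ^ (a - 1) * Complex.exp (-(r * t)))
      (F' := fun r t => - ((t : ℂ) ^ ((a + 1) - 1) * Complex.exp (-(r * t)))) hs ?_
      (integrableOn_cpow_mul_cexp ha hr₀) ?_ ?_ hb ?_).2.differentiableAt.differentiableWithinAt
    · exact Eventually.of_forall fun r =>
        (continuousOn_cpow_mul_cexp a r).aestronglyMeasurable measurableSet_Ioi
    · exact ((continuousOn_cpow_mul_cexp (a + 1) r₀).aestronglyMeasurable measurableSet_Ioi).neg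
    · filter_upwards [ae_restrict_mem measurableSet_Ioi] with t ht r hr
      rw [norm_neg, norm_cpow_mul_cexp ht]
      have ht' : 0 < t := ht
      gcongr
    · filter_upwards [ae_restrict_mem measurableSet_Ioi] with t ht r hr
      have ht0 : (t : ℂ) ≠ 0 := by exact_mod_cast (ne_of_gt ht)
      have h1 : HasDerivAt (fun r : ℂ => -(r * t)) (-(1 * (t : ℂ))) r :=
        ((hasDerivAt_id r).mul_const (t : ℂ)).neg
      have h2 := (h1.cexp).const_mul ((t : ℂ) ^ (a - 1))
      refine h2.congr_deriv ?_
      rw [show a + 1 - 1 = (a - 1) + 1 by ring, Complex.cpow_add _ _ ht0, Complex.cpow_one]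
      ring
  have hg : DifferentiableOn ℂ (fun r : ℂ => (1 / r) ^ a * Complex.Gamma a)
      {r : ℂ | 0 < r.re} := by
    intro r hr
    have hr' : 0 < r.re := hr
    have hr0 : r ≠ 0 := by rintro rfl; simp at hr'
    refine DifferentiableAt.differentiableWithinAt (DifferentiableAt.mul_const ?_ _)
    refine DifferentiableAt.cpow_const ?_ ?_
    · exact DifferentiableAt.div (differentiableAt_const _) differentiableAt_id hr0
    · left
      rw [one_div, Complex.inv_re]
      have : 0 < Complex.normSq r := Complex.normSq_pos.2 hr0
      positivity
  refine (hf.analyticOnNhd hU).eqOn_of_preconnected_of_frequently_eq (hg.analyticOnNhd hU)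
    hcv.isPreconnected (z₀ := 1) (by simp) ?_ hr
  have hlim : Tendsto (fun n : ℕ => (1 + (1 / ((n : ℝ) + 1) : ℝ) : ℂ)) atTop
      (nhdsWithin 1 {1}ᶜ) := by
    refine tendsto_nhdsWithin_iff.2 ⟨?_, Eventually.of_forall fun n => ?_⟩
    · have h := (Complex.continuous_ofReal.tendsto _).comp
        (tendsto_one_div_add_atTop_nhds_zero_nat (𝕜 := ℝ))
      simpa using h.const_add (1 : ℂ)
    · have : ((1 / ((n : ℝ) + 1) : ℝ) : ℂ) ≠ 0 := by
        have : (1 / ((n : ℝ) + 1) : ℝ) ≠ 0 := by positivity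
        exact_mod_cast this
      simpa using this
  refine hlim.frequently (Eventually.frequently (Eventually.of_forall fun n => ?_))
  have h := Complex.integral_cpow_mul_exp_neg_mul_Ioi (a := a)
    (r := 1 + 1 / ((n : ℝ) + 1)) ha (by positivity)
  simpa using h

/-- `Γ(s) (e^{-iθs} - 1)`, with its removable singularity at `0` filled in. -/
noncomputable def gammaExp (θ : ℝ) (s : ℂ) : ℂ :=
  Complex.Gamma (s + 1) * dslope (fun s : ℂ => Complex.exp (-(Complex.I * θ * s))) 0 s

theorem gammaExp_eq (θ : ℝ) {s : ℂ} (hs : s ≠ 0) :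
    gammaExp θ s = Complex.Gamma s * (Complex.exp (-(Complex.I * θ * s)) - 1) := by
  rw [gammaExp, dslope_of_ne _ hs, slope_def_field, Complex.Gamma_add_one s hs]
  simp
  field_simp

theorem differentiableAt_gammaExp (θ : ℝ) {s : ℂ} (hs : -1 < s.re) :
    DifferentiableAt ℂ (gammaExp θ) s := by
  refine DifferentiableAt.mul ?_ ?_
  · refine DifferentiableAt.comp s (f := fun s : ℂ => s + 1)
      (Complex.differentiableAt_Gamma _ fun m h => ?_) (by fun_prop)
    have := congrArg Complex.re h
    simp at this
    have hm : (0 : ℝ) ≤ m := m.cast_nonneg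
    linarith
  · have h : DifferentiableOn ℂ (fun s : ℂ => Complex.exp (-(Complex.I * θ * s))) Set.univ :=
      Differentiable.differentiableOn (by fun_prop)
    have := (Complex.differentiableOn_dslope (c := 0) univ_mem).2 h
    exact this.differentiableAt univ_mem

theorem norm_exp_neg_I_mul (θ : ℝ) (s : ℂ) :
    ‖Complex.exp (-(Complex.I * θ * s))‖ = Real.exp (θ * s.im) := by
  rw [Complex.norm_exp]
  simp

theorem exists_norm_gammaExp_le : ∃ C T : ℝ, 0 < C ∧ 2 ≤ T ∧ ∀ θ : ℝ, |θ| ≤ π / 2 → ∀ s : ℂ,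
    |s.re| ≤ 1 → T ≤ |s.im| →
    ‖gammaExp θ s‖ ≤ C * |s.im| ^ (s.re - 1 / 2) * Real.exp (-((π / 2 - |θ|) * |s.im|)) := by
  obtain ⟨c, C, T, hc, hC, hT, h⟩ := exists_norm_Gamma_bounds (M := 1) zero_le_one
  refine ⟨2 * C, T, by positivity, hT, fun θ hθ s hs hT' => ?_⟩
  have hs0 : s ≠ 0 := by
    rintro rfl
    simp at hT'; linarith
  have h1 := (h s.re s.im hs hT').2
  rw [Complex.re_add_im] at h1
  rw [gammaExp_eq θ hs0, norm_mul]
  have h2 : ‖Complex.exp (-(Complex.I * θ * s)) - 1‖ ≤ 2 * Real.exp (|θ| * |s.im|) := by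
    refine (norm_sub_le _ _).trans ?_
    rw [norm_exp_neg_I_mul, norm_one, two_mul]
    refine add_le_add (Real.exp_le_exp.2 ?_) (Real.one_le_exp (by positivity))
    rw [← abs_mul]
    exact le_abs_self _
  calc _ ≤ (C * gammaSize s.re s.im) * (2 * Real.exp (|θ| * |s.im|)) := by
        gcongr
        exact (norm_nonneg _).trans h1
    _ = _ := by
      rw [gammaSize, show -((π / 2 - |θ|) * |s.im|) = -(π / 2 * |s.im|) + |θ| * |s.im| by ring,
        Real.exp_add]
      ring


theorem norm_rpow_neg_le {Y a b : ℝ} (hY : 0 < Y) {s : ℂ} (h1 : a ≤ s.re) (h2 : s.re ≤ b) :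
    ‖(Y : ℂ) ^ (-s)‖ ≤ Y ^ (-a) + Y ^ (-b) := by
  rw [Complex.norm_cpow_eq_rpow_re_of_pos hY, Complex.neg_re]
  have ha := Real.rpow_pos_of_pos hY (-a)
  have hb := Real.rpow_pos_of_pos hY (-b)
  rcases le_total 1 Y with h | h
  · have := Real.rpow_le_rpow_of_exponent_le h (neg_le_neg h1)
    linarith
  · have := Real.rpow_le_rpow_of_exponent_ge hY h (neg_le_neg h2)
    linarith

theorem differentiableAt_cpow_neg {Y : ℝ} (hY : 0 < Y) (s : ℂ) :
    DifferentiableAt ℂ (fun s : ℂ => (Y : ℂ) ^ (-s)) s :=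
  DifferentiableAt.const_cpow (by fun_prop) (Or.inl (by exact_mod_cast hY.ne'))

theorem exp_neg_mul_le_rpow {δ t : ℝ} (hδ : 0 < δ) (ht : 0 < t) :
    Real.exp (-(δ * t)) ≤ (2 / δ ^ 2) * t ^ (-2 : ℝ) := by
  have := Real.quadratic_le_exp_of_nonneg (x := δ * t) (by positivity)
  rw [Real.exp_neg, Real.rpow_neg (by positivity),
    show t ^ (2 : ℝ) = t ^ 2 from by exact_mod_cast Real.rpow_natCast _ 2,
    ← div_eq_mul_inv, div_div, ← mul_pow, inv_le_comm₀ (Real.exp_pos _) (by positivity),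
    inv_div]
  have : 0 ≤ δ * t := by positivity
  linarith

theorem rpow_mul_exp_le_decay {δ σ t : ℝ} (hδ : 0 < δ) (ht : 1 ≤ t) (hσ : σ ≤ 1) :
    t ^ (σ - 1 / 2) * Real.exp (-(δ * t)) ≤ (2 / δ ^ 2) * t ^ (-(3 / 2) : ℝ) := by
  have ht0 : 0 < t := by linarith
  calc _ ≤ t ^ (1 / 2 : ℝ) * ((2 / δ ^ 2) * t ^ (-2 : ℝ)) := by
        gcongr
        · linarith
        · exact exp_neg_mul_le_rpow hδ ht0
    _ = _ := by
        rw [mul_left_comm, ← Real.rpow_add ht0]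
        norm_num

/-- The inverse Mellin transform of `Γ(s) r^{-s}` for `r = e^{iθ}` in the right half plane. -/
theorem integral_Gamma_mul_exp {θ Y : ℝ} (hθ : |θ| < π / 2) (hY : 0 < Y) :
    Integrable (fun t : ℝ => (Y : ℂ) ^ (-(((1 / 4 : ℝ) : ℂ) + t * Complex.I)) *
      (Complex.Gamma (((1 / 4 : ℝ) : ℂ) + t * Complex.I) *
        Complex.exp (-(Complex.I * θ * (((1 / 4 : ℝ) : ℂ) + t * Complex.I))))) ∧
    ∫ t : ℝ, (Y : ℂ) ^ (-(((1 / 4 : ℝ) : ℂ) + t * Complex.I)) *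
      (Complex.Gamma (((1 / 4 : ℝ) : ℂ) + t * Complex.I) *
        Complex.exp (-(Complex.I * θ * (((1 / 4 : ℝ) : ℂ) + t * Complex.I)))) =
      2 * π * Complex.exp (-(Complex.exp (Complex.I * θ) * Y)) := by
  set r := Complex.exp (Complex.I * θ) with hr
  have hθ' := abs_lt.1 hθ
  have hr0 : 0 < r.re := by
    rw [hr, mul_comm, Complex.exp_ofReal_mul_I_re]
    exact Real.cos_pos_of_mem_Ioo ⟨hθ'.1, hθ'.2⟩
  have hrlog : ∀ s : ℂ, (1 / r) ^ s = Complex.exp (-(Complex.I * θ * s)) := by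
    intro s
    rw [Complex.cpow_def_of_ne_zero (by rw [hr]; simp [Complex.exp_ne_zero]), one_div, hr,
      ← Complex.exp_neg, Complex.log_exp]
    · congr 1; ring
    · simp; linarith [Real.pi_pos]
    · simp; linarith [Real.pi_pos]
  have hmr : ∀ t : ℝ, mellin (fun t : ℝ => Complex.exp (-(r * t)))
      (((1 / 4 : ℝ) : ℂ) + t * Complex.I) =
      Complex.Gamma (((1 / 4 : ℝ) : ℂ) + t * Complex.I) *
        Complex.exp (-(Complex.I * θ * (((1 / 4 : ℝ) : ℂ) + t * Complex.I))) := by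
    intro t
    rw [mellin, ← hrlog, mul_comm (Complex.Gamma _)]
    exact integral_cpow_mul_cexp (by simp) hr0
  obtain ⟨c, C, T, hc, hC, hT, h⟩ := exists_norm_Gamma_bounds (M := 1) zero_le_one
  have hδ : 0 < π / 2 - |θ| := by linarith
  have hcont : ∀ s : ℂ, s.re = 1 / 4 → ContinuousAt (fun s : ℂ => Complex.Gamma s *
      Complex.exp (-(Complex.I * θ * s))) s := by
    intro s hs
    refine ContinuousAt.mul ?_ (by fun_prop)
    refine (Complex.differentiableAt_Gamma _ fun m hm => ?_).continuousAt
    have := congrArg Complex.re hm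
    simp [hs] at this
    have hm : (0 : ℝ) ≤ m := m.cast_nonneg
    linarith
  have hdec : ∀ s : ℂ, s.re = 1 / 4 → T ≤ |s.im| → ‖Complex.Gamma s *
      Complex.exp (-(Complex.I * θ * s))‖ ≤
      C * (2 / (π / 2 - |θ|) ^ 2) * |s.im| ^ (-(3 / 2) : ℝ) := by
    intro s hs hs'
    have hp : 0 < |s.im| := by linarith
    have h1 := (h s.re s.im (by rw [hs]; norm_num [abs_of_pos]) hs').2
    rw [Complex.re_add_im] at h1
    rw [norm_mul, norm_exp_neg_I_mul]
    have h2 : Real.exp (θ * s.im) ≤ Real.exp (|θ| * |s.im|) :=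
      Real.exp_le_exp.2 (by rw [← abs_mul]; exact le_abs_self _)
    calc _ ≤ (C * gammaSize s.re s.im) * Real.exp (|θ| * |s.im|) := by
          gcongr
          exact (norm_nonneg _).trans h1
      _ = C * (|s.im| ^ (s.re - 1 / 2) * Real.exp (-((π / 2 - |θ|) * |s.im|))) := by
          rw [gammaSize, show -((π / 2 - |θ|) * |s.im|) = -(π / 2 * |s.im|) + |θ| * |s.im| by ring,
            Real.exp_add]
          ring
      _ ≤ C * ((2 / (π / 2 - |θ|) ^ 2) * |s.im| ^ (-(3 / 2) : ℝ)) := by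
          exact mul_le_mul_of_nonneg_left
            (rpow_mul_exp_le_decay hδ (by linarith) (by rw [hs]; norm_num)) hC.le
      _ = _ := by ring
  have hvert : Complex.VerticalIntegrable (mellin (fun t : ℝ => Complex.exp (-(r * t))))
      (1 / 4 : ℝ) := by
    rw [Complex.VerticalIntegrable]
    simp_rw [hmr]
    exact integrable_vertical (f := fun s : ℂ => Complex.Gamma s *
      Complex.exp (-(Complex.I * θ * s))) hcont (by linarith) (by norm_num) (by positivity) hdec
  constructor
  · refine integrable_vertical (f := fun s : ℂ => (Y : ℂ) ^ (-s) * (Complex.Gamma s *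
      Complex.exp (-(Complex.I * θ * s)))) (σ := 1 / 4) (T := T) (p := 3 / 2)
      (C := (Y ^ (-(1 / 4) : ℝ) + Y ^ (-(1 / 4) : ℝ)) * (C * (2 / (π / 2 - |θ|) ^ 2)))
      (fun s hs => (differentiableAt_cpow_neg hY s).continuousAt.mul (hcont s hs)) (by linarith)
      (by norm_num) (by positivity) (fun s hs hs' => ?_)
    rw [norm_mul, mul_assoc (_ + _)]
    refine mul_le_mul ?_ ?_ (norm_nonneg _) (by positivity)
    · exact norm_rpow_neg_le hY hs.ge hs.le
    · exact hdec s hs hs'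
  have hinv := mellinInv_mellin_eq (1 / 4 : ℝ) (fun t : ℝ => Complex.exp (-(r * t))) hY
    (by
      rw [MellinConvergent]
      exact integrableOn_cpow_mul_cexp (by simp) hr0) hvert (by fun_prop)
  rw [mellinInv] at hinv
  simp_rw [hmr, smul_eq_mul] at hinv
  rw [← hinv, Complex.real_smul, ← mul_assoc]
  have : (π : ℂ) ≠ 0 := by exact_mod_cast Real.pi_ne_zero
  have h1 : (2 * π * ((1 / (2 * π) : ℝ) : ℂ)) = 1 := by
    push_cast
    field_simp
  rw [h1, one_mul]

theorem norm_integral_gammaExp_le_of_lt {θ Y : ℝ} (hθ : |θ| < π / 2) (hY : 0 < Y) :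
    ‖∫ t : ℝ, gammaExp θ (((-3 / 4 : ℝ) : ℂ) + t * Complex.I) *
      (Y : ℂ) ^ (-(((-3 / 4 : ℝ) : ℂ) + t * Complex.I))‖ ≤ 4 * π := by
  obtain ⟨C, T, hC, hT, h⟩ := exists_norm_gammaExp_le
  have hδ : 0 < π / 2 - |θ| := by linarith
  have hshift := integral_vertical_eq (a := -3 / 4) (b := 1 / 4) (T := T) (p := 3 / 2)
    (f := fun s => gammaExp θ s * (Y : ℂ) ^ (-s))
    (C := (C * (2 / (π / 2 - |θ|) ^ 2)) * (Y ^ (-(-3 / 4) : ℝ) + Y ^ (-(1 / 4) : ℝ)))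
    (by norm_num)
    (fun s h1 h2 => (differentiableAt_gammaExp θ (by linarith)).mul
      (differentiableAt_cpow_neg hY s))
    (by linarith) (by norm_num) (by positivity) (fun s h1 h2 h3 => by
      rw [norm_mul, mul_right_comm]
      have h4 := h θ hθ.le s (abs_le.2 ⟨by linarith, by linarith⟩) h3
      refine mul_le_mul ?_ ?_ (norm_nonneg _) (by positivity)
      · rw [mul_assoc C] at h4 ⊢
        exact h4.trans (mul_le_mul_of_nonneg_left
          (rpow_mul_exp_le_decay hδ (by linarith) (by linarith)) hC.le)
      · exact norm_rpow_neg_le hY h1 h2)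
  rw [hshift]
  have h1 := integral_Gamma_mul_exp hθ hY
  have h2 := integral_Gamma_mul_exp (θ := 0) (by simp; positivity) hY
  have h3 : ∀ t : ℝ, gammaExp θ (((1 / 4 : ℝ) : ℂ) + t * Complex.I) *
      (Y : ℂ) ^ (-(((1 / 4 : ℝ) : ℂ) + t * Complex.I)) =
      (Y : ℂ) ^ (-(((1 / 4 : ℝ) : ℂ) + t * Complex.I)) *
      (Complex.Gamma (((1 / 4 : ℝ) : ℂ) + t * Complex.I) *
        Complex.exp (-(Complex.I * θ * (((1 / 4 : ℝ) : ℂ) + t * Complex.I)))) -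
      (Y : ℂ) ^ (-(((1 / 4 : ℝ) : ℂ) + t * Complex.I)) *
      (Complex.Gamma (((1 / 4 : ℝ) : ℂ) + t * Complex.I) *
        Complex.exp (-(Complex.I * (0 : ℝ) * (((1 / 4 : ℝ) : ℂ) + t * Complex.I)))) := by
    intro t
    rw [gammaExp_eq]
    · simp
      ring
    · intro h0
      have := congrArg Complex.re h0
      simp at this
  simp_rw [h3]
  rw [integral_sub h1.1 h2.1, h1.2, h2.2]
  have h4 : ∀ φ : ℝ, |φ| < π / 2 → ‖Complex.exp (-(Complex.exp (Complex.I * φ) * Y))‖ ≤ 1 := by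
    intro φ hφ
    have hφ' := abs_lt.1 hφ
    rw [Complex.norm_exp, Real.exp_le_one_iff, Complex.neg_re, Complex.re_mul_ofReal,
      mul_comm _ (φ : ℂ), Complex.exp_ofReal_mul_I_re, neg_nonpos]
    have := Real.cos_pos_of_mem_Ioo ⟨hφ'.1, hφ'.2⟩
    positivity
  have h5 := h4 θ hθ
  have h6 := h4 0 (by simp; positivity)
  rw [← mul_sub, norm_mul]
  have h7 : ‖(2 * π : ℂ)‖ = 2 * π := by
    simp [abs_of_pos Real.pi_pos]
  rw [h7]
  have h8 := (norm_sub_le _ _).trans (add_le_add h5 h6)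
  nlinarith [Real.pi_pos]

theorem norm_integral_gammaExp_le {θ Y : ℝ} (hθ : |θ| ≤ π / 2) (hY : 0 < Y) :
    ‖∫ t : ℝ, gammaExp θ (((-3 / 4 : ℝ) : ℂ) + t * Complex.I) *
      (Y : ℂ) ^ (-(((-3 / 4 : ℝ) : ℂ) + t * Complex.I))‖ ≤ 4 * π := by
  obtain ⟨C, T, hC, hT, h⟩ := exists_norm_gammaExp_le
  have hne : ∀ t : ℝ, (((-3 / 4 : ℝ) : ℂ) + t * Complex.I) ≠ 0 := by
    intro t h0
    have := congrArg Complex.re h0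
    simp at this
  have hGc : Continuous (fun t : ℝ => Complex.Gamma (((-3 / 4 : ℝ) : ℂ) + t * Complex.I)) :=
    continuous_vertical fun s hs => (Complex.differentiableAt_Gamma _ fun m hm => by
      have := congrArg Complex.re hm
      simp [hs] at this
      rcases m with _ | m
      · norm_num at this
      · push_cast at this
        have hm : (0 : ℝ) ≤ m := m.cast_nonneg
        linarith).continuousAt
  have hYc : Continuous (fun t : ℝ => (Y : ℂ) ^ (-(((-3 / 4 : ℝ) : ℂ) + t * Complex.I))) :=
    continuous_vertical (f := fun s => (Y : ℂ) ^ (-s))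
      fun s hs => (differentiableAt_cpow_neg hY s).continuousAt
  set bound : ℝ → ℂ := fun t => Complex.Gamma (((-3 / 4 : ℝ) : ℂ) + t * Complex.I) *
    ((Real.exp (π / 2 * |t|) + 1 : ℝ) : ℂ) *
      (Y : ℂ) ^ (-(((-3 / 4 : ℝ) : ℂ) + t * Complex.I)) with hbd
  have hbint : Integrable bound := by
    obtain ⟨c, C, T, hc, hC, hT, h⟩ := exists_norm_Gamma_bounds (M := 1) zero_le_one
    refine integrable_of_decay (T := T) (p := 5 / 4)
      (C := C * 2 * (Y ^ (-(-3 / 4) : ℝ) + Y ^ (-(-3 / 4) : ℝ))) ((hGc.mul (by fun_prop)).mul hYc)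
      (by linarith) (by norm_num) (by positivity) fun t ht => ?_
    have h1 := (h (-3 / 4) t (by norm_num [abs_div]) ht).2
    have h2 := norm_rpow_neg_le (s := (((-3 / 4 : ℝ) : ℂ) + t * Complex.I)) hY
      (a := -3 / 4) (b := -3 / 4) (by simp) (by simp)
    rw [hbd, norm_mul, norm_mul, Complex.norm_real, Real.norm_of_nonneg (by positivity)]
    have h3 : Real.exp (π / 2 * |t|) + 1 ≤ 2 * Real.exp (π / 2 * |t|) := by
      have := Real.one_le_exp (x := π / 2 * |t|) (by positivity)
      linarith
    have hg : 0 ≤ C * gammaSize (-3 / 4) t := (norm_nonneg _).trans h1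
    calc _ ≤ (C * gammaSize (-3 / 4) t) * (2 * Real.exp (π / 2 * |t|)) *
          (Y ^ (-(-3 / 4) : ℝ) + Y ^ (-(-3 / 4) : ℝ)) := by gcongr
      _ = _ := by
        rw [gammaSize, Real.exp_neg]
        have := (Real.exp_pos (π / 2 * |t|)).ne'
        field_simp
        norm_num
  have hcont : ContinuousWithinAt (fun θ : ℝ => ∫ t : ℝ,
      gammaExp θ (((-3 / 4 : ℝ) : ℂ) + t * Complex.I) *
      (Y : ℂ) ^ (-(((-3 / 4 : ℝ) : ℂ) + t * Complex.I))) (Set.Ioo (-(π / 2)) (π / 2)) θ := by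
    refine continuousWithinAt_of_dominated (bound := fun t => ‖bound t‖) ?_ ?_ hbint.norm ?_
    · refine Eventually.of_forall fun φ => Continuous.aestronglyMeasurable ?_
      exact (continuous_vertical fun s hs =>
        (differentiableAt_gammaExp φ (by rw [hs]; norm_num)).continuousAt).mul hYc
    · filter_upwards [self_mem_nhdsWithin] with φ hφ
      refine Eventually.of_forall fun t => ?_
      rw [hbd, norm_mul, norm_mul, norm_mul, gammaExp_eq φ (hne t), norm_mul, Complex.norm_real,
        Real.norm_of_nonneg (by positivity)]
      gcongr
      refine (norm_sub_le _ _).trans ?_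
      rw [norm_exp_neg_I_mul, norm_one]
      have h1 : |φ| ≤ π / 2 := (abs_lt.2 hφ).le
      have h2 : φ * (((-3 / 4 : ℝ) : ℂ) + t * Complex.I).im ≤ π / 2 * |t| := by
        refine (le_abs_self _).trans ?_
        rw [abs_mul]
        simp only [Complex.add_im, Complex.ofReal_im, Complex.mul_I_im,
          Complex.ofReal_re, zero_add]
        gcongr
      gcongr
    · refine Eventually.of_forall fun t => Continuous.continuousWithinAt ?_
      simp_rw [gammaExp_eq _ (hne t)]
      fun_prop
  have hmem : θ ∈ closure (Set.Ioo (-(π / 2)) (π / 2)) := by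
    rw [closure_Ioo (by linarith [Real.pi_pos])]
    exact abs_le.1 hθ
  have := mem_closure_iff_nhdsWithin_neBot.1 hmem
  refine le_of_tendsto hcont.norm ?_
  filter_upwards [self_mem_nhdsWithin] with φ hφ
  exact norm_integral_gammaExp_le_of_lt (abs_lt.2 hφ) hY

/-- The quotient of Gamma factors in the Mellin transform of the kernel of the summation formula. -/
noncomputable def rieszKer (ρ : ℝ) (w : ℂ) : ℂ :=
  Complex.Gamma (w / 2) ^ 3 * (Complex.Gamma ((1 - w) / 2))⁻¹ ^ 2 *
    (Complex.Gamma (ρ + 3 / 2 - w / 2))⁻¹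

theorem differentiable_inv_Gamma : Differentiable ℂ (fun s : ℂ => (Complex.Gamma s)⁻¹) := by
  simpa using Complex.differentiable_one_div_Gamma

theorem differentiableAt_Gamma_of_pos {s : ℂ} (hs : 0 < s.re) :
    DifferentiableAt ℂ Complex.Gamma s := by
  refine Complex.differentiableAt_Gamma s fun m h => ?_
  have := congrArg Complex.re h
  simp at this
  have hm : (0 : ℝ) ≤ m := m.cast_nonneg
  linarith

theorem differentiableAt_rieszKer (ρ : ℝ) {w : ℂ} (hw : 0 < w.re) :
    DifferentiableAt ℂ (rieszKer ρ) w := by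
  refine DifferentiableAt.mul (DifferentiableAt.mul (DifferentiableAt.pow ?_ 3)
    (DifferentiableAt.pow ?_ 2)) ?_
  · exact DifferentiableAt.comp w (f := fun w : ℂ => w / 2)
      (differentiableAt_Gamma_of_pos (by simpa using hw)) (by fun_prop)
  · exact DifferentiableAt.comp w (f := fun w : ℂ => (1 - w) / 2)
      (differentiable_inv_Gamma _) (by fun_prop)
  · exact DifferentiableAt.comp w (f := fun w : ℂ => ρ + 3 / 2 - w / 2)
      (differentiable_inv_Gamma _) (by fun_prop)

theorem rieszKer_conj (ρ : ℝ) (w : ℂ) :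
    rieszKer ρ ((starRingEnd ℂ) w) = (starRingEnd ℂ) (rieszKer ρ w) := by
  simp only [rieszKer, map_mul, map_pow, map_inv₀, ← Complex.Gamma_conj, map_sub, map_div₀,
    map_add, map_one, Complex.conj_ofReal, map_ofNat]

theorem exists_norm_rieszKer_le (ρ : ℝ) {M : ℝ} (hM : 0 ≤ M) : ∃ C T : ℝ, 0 < C ∧ 2 ≤ T ∧
    ∀ w : ℂ, |w.re| ≤ M → T ≤ |w.im| →
      ‖rieszKer ρ w‖ ≤ C * |w.im| ^ (3 * w.re - 5 / 2 - ρ) := by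
  obtain ⟨c, C, T, hc, hC, hT, h⟩ := exists_norm_Gamma_bounds (M := M + |ρ| + 2) (by positivity)
  refine ⟨C ^ 3 * c⁻¹ ^ 2 * c⁻¹ * 2 ^ (M * 3 + 5 / 2 + |ρ|), 2 * T, by positivity, by linarith,
    fun w hw ht => ?_⟩
  have hw' := abs_le.1 hw
  have hρ := abs_le.1 (le_refl |ρ|)
  have hρ0 := abs_nonneg ρ
  set y := |w.im| / 2 with hy
  have hyT : T ≤ y := by rw [hy]; linarith
  have hy0 : 0 < y := by linarith
  have e1 := (h (w.re / 2) (w.im / 2) (by rw [abs_le]; constructor <;> linarith)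
    (by rw [abs_div, abs_two]; exact hyT)).2
  have e2 := (h ((1 - w.re) / 2) (-w.im / 2) (by rw [abs_le]; constructor <;> linarith)
    (by rw [abs_div, abs_neg, abs_two]; exact hyT)).1
  have e3 := (h (ρ + 3 / 2 - w.re / 2) (-w.im / 2) (by rw [abs_le]; constructor <;> linarith)
    (by rw [abs_div, abs_neg, abs_two]; exact hyT)).1
  have f1 : (((w.re / 2 : ℝ) : ℂ) + ((w.im / 2 : ℝ) : ℂ) * Complex.I) = w / 2 := by
    apply Complex.ext <;> simp
  have f2 : ((((1 - w.re) / 2 : ℝ) : ℂ) + ((-w.im / 2 : ℝ) : ℂ) * Complex.I) = (1 - w) / 2 := by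
    apply Complex.ext <;> simp
  have f3 : (((ρ + 3 / 2 - w.re / 2 : ℝ) : ℂ) + ((-w.im / 2 : ℝ) : ℂ) * Complex.I) =
      ρ + 3 / 2 - w / 2 := by
    apply Complex.ext <;> simp [neg_div]
  rw [f1] at e1
  rw [f2] at e2
  rw [f3] at e3
  simp only [gammaSize, abs_div, abs_neg, abs_two] at e1 e2 e3
  rw [← hy] at e1 e2 e3
  have hE := Real.exp_pos (-(π / 2 * y))
  set E := Real.exp (-(π / 2 * y))
  rw [rieszKer, norm_mul, norm_mul, norm_pow, norm_pow, norm_inv, norm_inv]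
  calc _ ≤ (C * (y ^ (w.re / 2 - 1 / 2) * E)) ^ 3 *
        (c * (y ^ ((1 - w.re) / 2 - 1 / 2) * E))⁻¹ ^ 2 *
        (c * (y ^ (ρ + 3 / 2 - w.re / 2 - 1 / 2) * E))⁻¹ := by
        gcongr
    _ = C ^ 3 * c⁻¹ ^ 2 * c⁻¹ * ((y ^ (w.re / 2 - 1 / 2)) ^ 3 *
        ((y ^ ((1 - w.re) / 2 - 1 / 2))⁻¹ ^ 2 * (y ^ (ρ + 3 / 2 - w.re / 2 - 1 / 2))⁻¹)) := by
        field_simp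
    _ = C ^ 3 * c⁻¹ ^ 2 * c⁻¹ * y ^ (3 * w.re - 5 / 2 - ρ) := by
        congr 1
        rw [← Real.rpow_neg hy0.le, ← Real.rpow_neg hy0.le, ← Real.rpow_natCast,
          ← Real.rpow_natCast, ← Real.rpow_mul hy0.le, ← Real.rpow_mul hy0.le,
          ← Real.rpow_add hy0, ← Real.rpow_add hy0]
        congr 1
        push_cast
        ring
    _ = C ^ 3 * c⁻¹ ^ 2 * c⁻¹ * (|w.im| ^ (3 * w.re - 5 / 2 - ρ) *
        2 ^ (-(3 * w.re - 5 / 2 - ρ))) := by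
        rw [hy, Real.div_rpow (abs_nonneg _) zero_le_two, Real.rpow_neg zero_le_two,
          div_eq_mul_inv]
    _ ≤ C ^ 3 * c⁻¹ ^ 2 * c⁻¹ * (|w.im| ^ (3 * w.re - 5 / 2 - ρ) *
        2 ^ (M * 3 + 5 / 2 + |ρ|)) := by
        gcongr
        · norm_num
        · linarith
    _ = _ := by ring

theorem inv_Gamma_one_sub {z : ℂ} (hz : 0 < z.im) :
    (Complex.Gamma (1 - z))⁻¹ = Complex.Gamma z * (Complex.I / (2 * π)) *
      Complex.exp (-(Complex.I * π * z)) * (1 - Complex.exp (2 * Complex.I * π * z)) := by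
  have h := Complex.Gamma_mul_Gamma_one_sub z
  have hpi : (π : ℂ) ≠ 0 := by exact_mod_cast Real.pi_ne_zero
  have hsin : Complex.sin (π * z) = Complex.I / 2 * Complex.exp (-(Complex.I * π * z)) *
      (1 - Complex.exp (2 * Complex.I * π * z)) := by
    rw [Complex.sin, mul_sub, mul_one, mul_assoc (Complex.I / 2), ← Complex.exp_add,
      show -(Complex.I * π * z) + 2 * Complex.I * π * z = π * z * Complex.I by ring,
      show -(Complex.I * π * z) = -(π * z) * Complex.I by ring]
    ring
  have hsin0 : Complex.sin (π * z) ≠ 0 := by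
    rw [hsin]
    refine mul_ne_zero (mul_ne_zero (by simp) (Complex.exp_ne_zero _)) fun h0 => ?_
    have h1 := congrArg norm (sub_eq_zero.1 h0)
    rw [norm_one, Complex.norm_exp] at h1
    have h2 := (Real.exp_eq_one_iff _).1 h1.symm
    have h3 : z.im = 0 := by simpa [Real.pi_ne_zero, eq_comm] using h2
    exact hz.ne' h3
  have hG0 : Complex.Gamma (1 - z) ≠ 0 := by
    intro h0
    rw [h0, mul_zero] at h
    exact (div_ne_zero hpi hsin0) h.symm
  refine inv_eq_of_mul_eq_one_left ?_
  have h3 : Complex.Gamma z * Complex.sin (π * z) * Complex.Gamma (1 - z) = π := by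
    rw [mul_right_comm, h]
    field_simp
  rw [hsin] at h3
  calc _ = (Complex.Gamma z * (Complex.I / 2 * Complex.exp (-(Complex.I * π * z)) *
      (1 - Complex.exp (2 * Complex.I * π * z))) * Complex.Gamma (1 - z)) / π := by
        field_simp
    _ = 1 := by rw [h3, div_self hpi]

theorem rieszKer_eq_of_im_pos (ρ : ℝ) {z : ℂ} (hz : 0 < z.im) :
    rieszKer ρ (2 * z) = (Complex.Gamma z ^ 3 * Complex.Gamma (z + 1 / 2) ^ 2 *
        Complex.Gamma (z - (ρ + 1 / 2 : ℝ))) *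
      ((Complex.I / (2 * π)) ^ 3 *
        Complex.exp (-(Complex.I * π * (3 * z + 1 - (ρ + 1 / 2 : ℝ))))) *
      ((1 - Complex.exp (2 * Complex.I * π * (z + 1 / 2))) ^ 2 *
        (1 - Complex.exp (2 * Complex.I * π * (z - (ρ + 1 / 2 : ℝ))))) := by
  have h1 := inv_Gamma_one_sub (z := z + 1 / 2) (by simpa using hz)
  have h2 := inv_Gamma_one_sub (z := z - (ρ + 1 / 2 : ℝ)) (by
    rw [Complex.sub_im, Complex.ofReal_im, sub_zero]; exact hz)
  have e1 : (1 - 2 * z) / 2 = 1 - (z + 1 / 2) := by ring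
  have e2 : (ρ : ℂ) + 3 / 2 - 2 * z / 2 = 1 - (z - (ρ + 1 / 2 : ℝ)) := by push_cast; ring
  rw [rieszKer, e1, e2, h1, h2, show -(Complex.I * π * (3 * z + 1 - (ρ + 1 / 2 : ℝ))) =
    -(Complex.I * π * (z + 1 / 2)) + -(Complex.I * π * (z + 1 / 2)) +
      -(Complex.I * π * (z - (ρ + 1 / 2 : ℝ))) by ring, Complex.exp_add, Complex.exp_add,
    mul_div_cancel_left₀ z two_ne_zero]
  ring

theorem norm_mul_sub_one_le {x y : ℂ} {a b : ℝ} (hx : ‖x - 1‖ ≤ a) (hy : ‖y - 1‖ ≤ b) :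
    ‖x * y - 1‖ ≤ a * b + a + b := by
  have ha : 0 ≤ a := (norm_nonneg _).trans hx
  calc ‖x * y - 1‖ = ‖(x - 1) * (y - 1) + (x - 1) + (y - 1)‖ := by ring_nf
    _ ≤ ‖(x - 1) * (y - 1)‖ + ‖x - 1‖ + ‖y - 1‖ := norm_add₃_le
    _ ≤ _ := by rw [norm_mul]; gcongr

set_option maxHeartbeats 1000000 in
theorem exists_rieszKer_asymp_aux (ρ : ℝ) (hρ : 0 < ρ) : ∃ (α : ℂ) (C T : ℝ), 0 < C ∧ 2 ≤ T ∧
    ∀ s : ℂ, |s.re| ≤ 1 → T ≤ s.im → ∃ R : ℂ, ‖R - 1‖ ≤ C / s.im ∧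
      rieszKer ρ ((s + ρ + 2) / 3) =
        α * ((6 : ℝ) : ℂ) ^ (-s) * (Complex.Gamma s *
          Complex.exp (-(Complex.I * (π / 2 : ℝ) * s))) * R := by
  obtain ⟨C, T, hC, hT, h⟩ := exists_Gamma_stirling (M := ρ + 3) (by positivity)
  set κ : ℂ := ((Real.log (2 * π) / 2 : ℝ) : ℂ)
  refine ⟨(Complex.I / (2 * π)) ^ 3 *
      Complex.exp (-(Complex.I * π * ((ρ + 2) / 2 + 1 - (ρ + 1 / 2 : ℝ)))) *
      Complex.exp (5 * κ + (Real.log 6 : ℝ) / 2), 6 * (15 * (14 * C + 1)), 6 * (T + 7 * C + 1),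
    by positivity, by linarith, fun s hs ht => ?_⟩
  have hs' := abs_le.1 hs
  set y : ℝ := s.im / 6 with hy
  set x : ℝ := (s.re + ρ + 2) / 6 with hx
  have hyT : T + 7 * C + 1 ≤ y := by rw [hy]; linarith
  have hy0 : 0 < y := by linarith
  set z : ℂ := (s + ρ + 2) / 6 with hz
  have hzxy : z = x + y * Complex.I := by
    apply Complex.ext <;> simp [hz, hx, hy]
  have hzim : z.im = y := by rw [hzxy]; simp
  obtain ⟨E1, hE1, G1⟩ := h x y (by rw [abs_le]; constructor <;> linarith) (by linarith)
  obtain ⟨E2, hE2, G2⟩ := h (x + 1 / 2) y (by rw [abs_le]; constructor <;> linarith) (by linarith)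
  obtain ⟨E3, hE3, G3⟩ := h (x - (ρ + 1 / 2)) y (by rw [abs_le]; constructor <;> linarith)
    (by linarith)
  obtain ⟨E4, hE4, G4⟩ := h s.re s.im (by rw [abs_le]; constructor <;> linarith) (by linarith)
  rw [Complex.re_add_im] at G4
  have hlog : Real.log s.im = Real.log 6 + Real.log y := by
    rw [← Real.log_mul (by norm_num) hy0.ne', hy]
    congr 1; ring
  have him : s.im * Complex.I = 6 * (y * Complex.I) := by rw [hy]; push_cast; ring
  have hE4' : ‖E4‖ ≤ C / y := by
    refine hE4.trans ?_
    gcongr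
    rw [hy]; linarith
  set P := 3 * E1 + 2 * E2 + E3 - E4 with hP
  have hPn : ‖P‖ ≤ 7 * C / y := by
    calc ‖P‖ ≤ ‖3 * E1 + 2 * E2 + E3‖ + ‖E4‖ := norm_sub_le _ _
      _ ≤ (‖3 * E1‖ + ‖2 * E2‖ + ‖E3‖) + ‖E4‖ := by gcongr; exact norm_add₃_le
      _ ≤ (3 * (C / y) + 2 * (C / y) + C / y) + C / y := by
        rw [norm_mul, norm_mul]
        simp only [RCLike.norm_ofNat]
        gcongr
      _ = _ := by ring
  have hprod : Complex.Gamma z ^ 3 * Complex.Gamma (z + 1 / 2) ^ 2 *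
        Complex.Gamma (z - (ρ + 1 / 2 : ℝ)) =
      Complex.exp (5 * κ + (Real.log 6 : ℝ) / 2) * ((6 : ℝ) : ℂ) ^ (-s) * Complex.Gamma s *
        Complex.exp P := by
    have a2 : z + 1 / 2 = ((x + 1 / 2 : ℝ) : ℂ) + y * Complex.I := by rw [hzxy]; push_cast; ring
    have a3 : z - (ρ + 1 / 2 : ℝ) = ((x - (ρ + 1 / 2) : ℝ) : ℂ) + y * Complex.I := by
      rw [hzxy]; push_cast; ring
    rw [a2, a3, hzxy, G1, G2, G3, G4, Complex.cpow_def_of_ne_zero (by norm_num),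
      ← Complex.ofReal_log (by norm_num), ← Complex.exp_nat_mul, ← Complex.exp_nat_mul,
      ← Complex.exp_add, ← Complex.exp_add, ← Complex.exp_add, ← Complex.exp_add,
      ← Complex.exp_add]
    congr 1
    rw [hlog, him, hP, show s = 6 * z - ρ - 2 by rw [hz]; ring, hzxy]
    push_cast
    ring
  refine ⟨Complex.exp P * ((1 - Complex.exp (2 * Complex.I * π * (z + 1 / 2))) ^ 2 *
        (1 - Complex.exp (2 * Complex.I * π * (z - (ρ + 1 / 2 : ℝ))))), ?_, ?_⟩
  · have hε0 : 0 < (14 * C + 1) / y := by positivity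
    have hexpy : Real.exp (-(2 * π * y)) ≤ 1 / y := by
      rw [Real.exp_neg, ← one_div]
      gcongr
      have := Real.add_one_le_exp (2 * π * y)
      nlinarith [Real.pi_gt_three]
    have b1 : ‖Complex.exp P - 1‖ ≤ 14 * C / y := by
      have h1 : ‖P‖ ≤ 1 := hPn.trans (by rw [div_le_one hy0]; linarith)
      refine (Complex.norm_exp_sub_one_le h1).trans ?_
      calc 2 * ‖P‖ ≤ 2 * (7 * C / y) := by gcongr
        _ = _ := by ring
    have b2 : ∀ u : ℂ, u.im = y →
        ‖(1 - Complex.exp (2 * Complex.I * π * u)) - 1‖ ≤ 1 / y := by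
      intro u hu
      rw [sub_sub_cancel_left, norm_neg, Complex.norm_exp]
      refine le_trans (le_of_eq ?_) hexpy
      congr 1
      simp [hu]
    have hy1 : 1 / y ≤ 1 := by rw [div_le_one hy0]; linarith
    have c2 := b2 (z + 1 / 2) (by simp [hzim])
    have c3 := b2 (z - (ρ + 1 / 2 : ℝ)) (by rw [Complex.sub_im, Complex.ofReal_im, sub_zero, hzim])
    have d2 := norm_mul_sub_one_le (norm_mul_sub_one_le c2 c2) c3
    have d3 := norm_mul_sub_one_le b1 d2
    rw [pow_two]
    refine d3.trans ?_
    set e := 1 / y with he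
    have he0 : 0 < e := by positivity
    have hK : 14 * C / y = 14 * C * e := by rw [he]; ring
    have hK2 : 6 * (15 * (14 * C + 1)) / s.im = (15 * (14 * C + 1)) * e := by
      rw [he, hy]; field_simp
    rw [hK, hK2]
    have hb : (e * e + e + e) * e + (e * e + e + e) + e ≤ 7 * e := by nlinarith
    have hb1 : (e * e + e + e) * e + (e * e + e + e) + e ≤ 7 := by linarith
    have hCe : 0 ≤ 14 * C * e := by positivity
    have := mul_le_mul_of_nonneg_left hb1 hCe
    generalize (e * e + e + e) * e + (e * e + e + e) + e = X at *
    linarith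
  · have e0 : (s + ρ + 2) / 3 = 2 * z := by rw [hz]; ring
    rw [e0, rieszKer_eq_of_im_pos ρ (by rw [hzim]; exact hy0), hprod,
      show -(Complex.I * π * (3 * z + 1 - (ρ + 1 / 2 : ℝ))) =
        -(Complex.I * π * ((ρ + 2) / 2 + 1 - (ρ + 1 / 2 : ℝ))) +
        -(Complex.I * (π / 2 : ℝ) * s) by rw [hz]; push_cast; ring]
    rw [Complex.exp_add (-(Complex.I * π * ((ρ + 2) / 2 + 1 - (ρ + 1 / 2 : ℝ))))]
    generalize Complex.exp (5 * κ + (Real.log 6 : ℝ) / 2) = a1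
    generalize (1 - Complex.exp (2 * Complex.I * π * (z + 1 / 2))) ^ 2 *
        (1 - Complex.exp (2 * Complex.I * π * (z - (ρ + 1 / 2 : ℝ)))) = a2
    generalize Complex.exp (-(Complex.I * π * ((ρ + 2) / 2 + 1 - (ρ + 1 / 2 : ℝ)))) = a3
    generalize Complex.exp (-(Complex.I * (π / 2 : ℝ) * s)) = a4
    generalize (Complex.I / (2 * π)) ^ 3 = a5
    ring


theorem gammaExp_conj {θ : ℝ} {s : ℂ} (hs : s ≠ 0) :
    gammaExp θ ((starRingEnd ℂ) s) = (starRingEnd ℂ) (gammaExp (-θ) s) := by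
  rw [gammaExp_eq _ hs, gammaExp_eq _ (by simpa using hs), Complex.Gamma_conj, map_mul, map_sub,
    ← Complex.exp_conj]
  simp

theorem exists_rieszKer_asymp (ρ : ℝ) (hρ : 0 < ρ) : ∃ (α : ℂ) (C T : ℝ), 0 < C ∧ 2 ≤ T ∧
    ∀ s : ℂ, |s.re| ≤ 1 → T ≤ |s.im| →
      ‖rieszKer ρ ((s + ρ + 2) / 3) - ((6 : ℝ) : ℂ) ^ (-s) *
        (α * gammaExp (π / 2) s + (starRingEnd ℂ) α * gammaExp (-(π / 2)) s)‖ ≤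
        C * |s.im| ^ (s.re - 3 / 2) := by
  obtain ⟨α, C₁, T₁, hC₁, hT₁, h₁⟩ := exists_rieszKer_asymp_aux ρ hρ
  obtain ⟨C₂, T₂, hC₂, hT₂, h₂⟩ := exists_norm_gammaExp_le
  obtain ⟨c, C₃, T₃, hc, hC₃, hT₃, h₃⟩ := exists_norm_Gamma_bounds (M := 1) zero_le_one
  set A := ‖α‖
  have hA : 0 ≤ A := norm_nonneg α
  set K : ℝ := 6 * (A * C₂ * C₁ + A * C₃ * (1 + C₁) + A * (2 * C₃)) + 1 with hK
  have hpos : ∀ s : ℂ, |s.re| ≤ 1 → max T₁ (max T₂ T₃) ≤ s.im →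
      ‖rieszKer ρ ((s + ρ + 2) / 3) - ((6 : ℝ) : ℂ) ^ (-s) *
        (α * gammaExp (π / 2) s + (starRingEnd ℂ) α * gammaExp (-(π / 2)) s)‖ ≤
        K * s.im ^ (s.re - 3 / 2) := by
    intro s hs hT
    have t1 : T₁ ≤ s.im := (le_max_left _ _).trans hT
    have t2 : T₂ ≤ s.im := ((le_max_left _ _).trans (le_max_right _ _)).trans hT
    have t3 : T₃ ≤ s.im := ((le_max_right _ _).trans (le_max_right _ _)).trans hT
    have ht0 : 0 < s.im := by linarith
    have habs : |s.im| = s.im := abs_of_pos ht0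
    obtain ⟨R, hR, hker⟩ := h₁ s hs t1
    have hs0 : s ≠ 0 := by
      rintro rfl
      simp at ht0
    have hpow : s.im ^ (s.re - 3 / 2) = s.im ^ (s.re - 1 / 2) * (1 / s.im) := by
      rw [one_div s.im, ← Real.rpow_neg_one s.im, ← Real.rpow_add ht0]
      congr 1; ring
    have hG : ‖Complex.Gamma s‖ ≤ C₃ * s.im ^ (s.re - 3 / 2) := by
      have := (h₃ s.re s.im hs (by rwa [habs])).2
      rw [Complex.re_add_im, gammaSize, habs] at this
      refine this.trans ?_
      rw [hpow]
      gcongr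
      rw [Real.exp_neg, ← one_div]
      gcongr
      have := Real.add_one_le_exp (π / 2 * s.im)
      nlinarith [Real.pi_gt_three]
    have hg1 : ‖gammaExp (π / 2) s‖ ≤ C₂ * s.im ^ (s.re - 1 / 2) := by
      have h0 : |π / 2| = π / 2 := abs_of_pos (by positivity)
      have := h₂ (π / 2) h0.le s hs (by rwa [habs])
      simpa [h0, habs] using this
    have hg2 : ‖gammaExp (-(π / 2)) s‖ ≤ 2 * (C₃ * s.im ^ (s.re - 3 / 2)) := by
      rw [gammaExp_eq _ hs0, norm_mul, mul_comm]
      refine mul_le_mul ?_ hG (norm_nonneg _) two_pos.le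
      refine (norm_sub_le _ _).trans ?_
      rw [norm_exp_neg_I_mul, norm_one]
      have : Real.exp (-(π / 2) * s.im) ≤ 1 := Real.exp_le_one_iff.2 (by
        have := Real.pi_pos
        nlinarith)
      linarith
    have hRn : ‖R‖ ≤ 1 + C₁ := by
      have h4 : C₁ / s.im ≤ C₁ := div_le_self hC₁.le (by linarith)
      calc ‖R‖ = ‖1 + (R - 1)‖ := by rw [add_sub_cancel]
        _ ≤ ‖(1 : ℂ)‖ + ‖R - 1‖ := norm_add_le _ _
        _ ≤ _ := by rw [norm_one]; linarith
    have h6 : ‖((6 : ℝ) : ℂ) ^ (-s)‖ ≤ 6 := by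
      rw [Complex.norm_cpow_eq_rpow_re_of_pos (by norm_num)]
      calc (6 : ℝ) ^ (-s).re ≤ 6 ^ (1 : ℝ) := by
            gcongr
            · norm_num
            · rw [Complex.neg_re]; linarith [(abs_le.1 hs).1]
        _ = 6 := Real.rpow_one _
    have hGe : Complex.Gamma s * Complex.exp (-(Complex.I * (π / 2 : ℝ) * s)) =
        gammaExp (π / 2) s + Complex.Gamma s := by
      rw [gammaExp_eq _ hs0]; ring
    have hdec : rieszKer ρ ((s + ρ + 2) / 3) - ((6 : ℝ) : ℂ) ^ (-s) *
        (α * gammaExp (π / 2) s + (starRingEnd ℂ) α * gammaExp (-(π / 2)) s) =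
        ((6 : ℝ) : ℂ) ^ (-s) * (α * gammaExp (π / 2) s * (R - 1) + α * Complex.Gamma s * R +
          -((starRingEnd ℂ) α * gammaExp (-(π / 2)) s)) := by
      rw [hker, hGe]; ring
    set p := s.im ^ (s.re - 3 / 2) with hp
    have hp0 : 0 ≤ p := by positivity
    have n1 : ‖α * gammaExp (π / 2) s * (R - 1)‖ ≤ A * C₂ * C₁ * p := by
      rw [norm_mul, norm_mul]
      calc A * ‖gammaExp (π / 2) s‖ * ‖R - 1‖
          ≤ A * (C₂ * s.im ^ (s.re - 1 / 2)) * (C₁ / s.im) :=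
            mul_le_mul (mul_le_mul_of_nonneg_left hg1 hA) hR (norm_nonneg _) (by positivity)
        _ = _ := by rw [hpow]; ring
    have n2 : ‖α * Complex.Gamma s * R‖ ≤ A * C₃ * (1 + C₁) * p := by
      rw [norm_mul, norm_mul]
      calc A * ‖Complex.Gamma s‖ * ‖R‖
          ≤ A * (C₃ * p) * (1 + C₁) :=
            mul_le_mul (mul_le_mul_of_nonneg_left hG hA) hRn (norm_nonneg _) (by positivity)
        _ = _ := by ring
    have n3 : ‖-((starRingEnd ℂ) α * gammaExp (-(π / 2)) s)‖ ≤ A * (2 * C₃) * p := by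
      rw [norm_neg, norm_mul, RCLike.norm_conj, mul_assoc, mul_assoc]
      exact mul_le_mul_of_nonneg_left hg2 hA
    rw [hdec, norm_mul]
    calc _ ≤ 6 * (A * C₂ * C₁ * p + A * C₃ * (1 + C₁) * p + A * (2 * C₃) * p) :=
          mul_le_mul h6 (norm_add₃_le.trans (by linarith)) (norm_nonneg _) (by norm_num)
      _ ≤ K * p := by rw [hK]; linarith
  refine ⟨α, K, max T₁ (max T₂ T₃), by positivity, hT₁.trans (le_max_left _ _), fun s hs hT => ?_⟩
  have hT2 : 2 ≤ max T₁ (max T₂ T₃) := hT₁.trans (le_max_left _ _)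
  rcases le_total 0 s.im with h0 | h0
  · rw [abs_of_nonneg h0] at hT ⊢
    exact hpos s hs hT
  · rw [abs_of_nonpos h0] at hT ⊢
    have hs0 : s ≠ 0 := by
      rintro rfl
      simp only [Complex.zero_im, neg_zero] at hT
      linarith
    have h5 := hpos ((starRingEnd ℂ) s) (by simpa using hs) (by simpa using hT)
    rw [Complex.conj_im, Complex.conj_re] at h5
    refine le_trans (le_of_eq ?_) h5
    rw [← RCLike.norm_conj]
    congr 1
    rw [gammaExp_conj hs0, gammaExp_conj hs0, neg_neg,
      show ((starRingEnd ℂ) s + ρ + 2) / 3 = (starRingEnd ℂ) ((s + ρ + 2) / 3) by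
        simp only [map_div₀, map_add, Complex.conj_ofReal, map_ofNat],
      rieszKer_conj, ← map_neg, ← Complex.conj_ofReal 6, Complex.cpow_conj]
    · simp only [map_sub, map_mul, map_add, Complex.conj_conj, Complex.conj_ofReal]
      ring
    · rw [Complex.conj_ofReal, Complex.arg_ofReal_of_nonneg (by norm_num)]
      exact Real.pi_pos.ne

theorem norm_cpow_neg_le_of_strip {v : ℝ} (hv : 0 < v) {s : ℂ} {a b : ℝ} (h1 : a ≤ s.re)
    (h2 : s.re ≤ b) {F : ℂ} {B : ℝ} (hF : ‖F‖ ≤ B) :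
    ‖F * (v : ℂ) ^ (-s)‖ ≤ B * (v ^ (-a) + v ^ (-b)) := by
  rw [norm_mul]
  exact mul_le_mul hF (norm_rpow_neg_le hv h1 h2) (norm_nonneg _) ((norm_nonneg _).trans hF)

theorem integral_add_mul_add_mul {f g h : ℝ → ℂ} (hf : Integrable f) (hg : Integrable g)
    (hh : Integrable h) (a b : ℂ) :
    ∫ t, (f t + a * g t + b * h t) = (∫ t, f t) + a * (∫ t, g t) + b * ∫ t, h t := by
  have h1 : Integrable fun t => f t + a * g t := hf.add (hg.const_mul a)
  rw [integral_add h1 (hh.const_mul b), integral_add hf (hg.const_mul a), integral_const_mul,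
    integral_const_mul]

theorem exists_norm_integral_rieszKer_aux (ρ : ℝ) (hρ : 0 < ρ) : ∃ C : ℝ, 0 < C ∧
    ∀ v : ℝ, 0 < v → ‖∫ t : ℝ, rieszKer ρ (((((-3 / 4 : ℝ) : ℂ) + t * Complex.I) + ρ + 2) / 3) *
      (v : ℂ) ^ (-(((-3 / 4 : ℝ) : ℂ) + t * Complex.I))‖ ≤ C := by
  obtain ⟨α, C₁, T₁, hC₁, hT₁, h₁⟩ := exists_rieszKer_asymp ρ hρ
  obtain ⟨C₂, T₂, hC₂, hT₂, h₂⟩ := exists_norm_gammaExp_le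
  set D : ℂ → ℂ := fun s => rieszKer ρ ((s + ρ + 2) / 3) - ((6 : ℝ) : ℂ) ^ (-s) *
        (α * gammaExp (π / 2) s + (starRingEnd ℂ) α * gammaExp (-(π / 2)) s) with hD
  have hDd : ∀ s : ℂ, -(3 / 4) ≤ s.re → DifferentiableAt ℂ D s := by
    intro s hs
    have hw : 0 < ((s + ρ + 2) / 3).re := by
      simp
      linarith
    refine DifferentiableAt.sub ?_ (DifferentiableAt.mul ?_ (DifferentiableAt.add ?_ ?_))
    · exact DifferentiableAt.comp s (f := fun s : ℂ => (s + ρ + 2) / 3)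
        (differentiableAt_rieszKer ρ hw) (by fun_prop)
    · exact differentiableAt_cpow_neg (by norm_num) s
    · exact (differentiableAt_gammaExp _ (by linarith)).const_mul _
    · exact (differentiableAt_gammaExp _ (by linarith)).const_mul _
  have hDb : ∀ s : ℂ, -(3 / 4) ≤ s.re → s.re ≤ 0 → T₁ ≤ |s.im| →
      ‖D s‖ ≤ C₁ * |s.im| ^ (-(3 / 2) : ℝ) := by
    intro s hs hs' hT
    refine (h₁ s (by rw [abs_le]; constructor <;> linarith) hT).trans ?_
    refine mul_le_mul_of_nonneg_left ?_ hC₁.le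
    exact Real.rpow_le_rpow_of_exponent_le (by linarith) (by linarith)
  set CD : ℝ := ∫ t : ℝ, ‖D (((0 : ℝ) : ℂ) + t * Complex.I)‖ with hCD
  have hCD0 : 0 ≤ CD := integral_nonneg fun _ => norm_nonneg _
  refine ⟨CD + ‖α‖ * (4 * π) + ‖α‖ * (4 * π) + 1, by positivity, fun v hv => ?_⟩
  have hg : ∀ θ : ℝ, |θ| = π / 2 → Integrable fun t : ℝ =>
      gammaExp θ (((-3 / 4 : ℝ) : ℂ) + t * Complex.I) *
        ((6 * v : ℝ) : ℂ) ^ (-(((-3 / 4 : ℝ) : ℂ) + t * Complex.I)) := by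
    intro θ hθ
    refine integrable_vertical (f := fun s => gammaExp θ s * ((6 * v : ℝ) : ℂ) ^ (-s))
      (σ := -3 / 4) (fun s hs => ?_) (T := T₂) (by linarith) (p := 5 / 4) (by norm_num)
      (C := C₂ * ((6 * v) ^ (-(-3 / 4) : ℝ) + (6 * v) ^ (-(-3 / 4) : ℝ))) (by positivity)
      (fun s hs hT => ?_)
    · exact (DifferentiableAt.mul (differentiableAt_gammaExp _ (by rw [hs]; norm_num))
        (differentiableAt_cpow_neg (by positivity) s)).continuousAt
    · have h3 : ‖gammaExp θ s‖ ≤ C₂ * |s.im| ^ (-(5 / 4) : ℝ) := by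
        refine (h₂ θ hθ.le s (by rw [hs, abs_le]; constructor <;> norm_num) hT).trans (le_of_eq ?_)
        rw [hθ, hs, sub_self, zero_mul, neg_zero, Real.exp_zero, mul_one]
        norm_num
      refine (norm_cpow_neg_le_of_strip (by positivity) hs.ge hs.le h3).trans (le_of_eq ?_)
      ring
  have hDv : ∀ s : ℂ, -3 / 4 ≤ s.re → s.re ≤ 0 → T₁ ≤ |s.im| →
      ‖D s * (v : ℂ) ^ (-s)‖ ≤
        C₁ * (v ^ (-(-3 / 4) : ℝ) + v ^ (-0 : ℝ)) * |s.im| ^ (-(3 / 2) : ℝ) := by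
    intro s hs hs' hT
    refine (norm_cpow_neg_le_of_strip hv hs hs' (hDb s (by linarith) hs' hT)).trans
      (le_of_eq ?_)
    ring
  have hDvd : ∀ s : ℂ, -3 / 4 ≤ s.re → DifferentiableAt ℂ (fun s => D s * (v : ℂ) ^ (-s)) s :=
    fun s hs => (hDd s (by linarith)).mul (differentiableAt_cpow_neg hv s)
  have hshift := integral_vertical_eq (a := -3 / 4) (b := 0) (T := T₁) (p := 3 / 2)
    (f := fun s => D s * (v : ℂ) ^ (-s)) (C := C₁ * (v ^ (-(-3 / 4) : ℝ) + v ^ (-0 : ℝ)))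
    (by norm_num) (fun s hs _ => hDvd s hs) (by linarith) (by norm_num) (by positivity) hDv
  have hDi : Integrable fun t : ℝ => D (((-3 / 4 : ℝ) : ℂ) + t * Complex.I) *
        (v : ℂ) ^ (-(((-3 / 4 : ℝ) : ℂ) + t * Complex.I)) :=
    integrable_vertical (f := fun s => D s * (v : ℂ) ^ (-s)) (σ := -3 / 4)
      (fun s hs => (hDvd s hs.ge).continuousAt) (T := T₁) (by linarith) (p := 3 / 2)
      (by norm_num) (C := C₁ * (v ^ (-(-3 / 4) : ℝ) + v ^ (-0 : ℝ))) (by positivity)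
      (fun s hs hT => hDv s hs.ge (by rw [hs]; norm_num) hT)
  have hdec : ∀ t : ℝ, rieszKer ρ (((((-3 / 4 : ℝ) : ℂ) + t * Complex.I) + ρ + 2) / 3) *
      (v : ℂ) ^ (-(((-3 / 4 : ℝ) : ℂ) + t * Complex.I)) =
      D (((-3 / 4 : ℝ) : ℂ) + t * Complex.I) * (v : ℂ) ^ (-(((-3 / 4 : ℝ) : ℂ) + t * Complex.I)) +
      α * (gammaExp (π / 2) (((-3 / 4 : ℝ) : ℂ) + t * Complex.I) *
        ((6 * v : ℝ) : ℂ) ^ (-(((-3 / 4 : ℝ) : ℂ) + t * Complex.I))) +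
      (starRingEnd ℂ) α * (gammaExp (-(π / 2)) (((-3 / 4 : ℝ) : ℂ) + t * Complex.I) *
        ((6 * v : ℝ) : ℂ) ^ (-(((-3 / 4 : ℝ) : ℂ) + t * Complex.I))) := by
    intro t
    rw [Complex.ofReal_mul, Complex.mul_cpow_ofReal_nonneg (by norm_num) hv.le, hD]
    ring
  have hπ : |π / 2| = π / 2 := abs_of_pos (by positivity)
  have hπ' : |-(π / 2)| = π / 2 := by rw [abs_neg, hπ]
  simp only [hdec]
  rw [integral_add_mul_add_mul hDi (hg _ hπ) (hg _ hπ'), hshift]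
  refine norm_add₃_le.trans ?_
  rw [norm_mul, norm_mul, RCLike.norm_conj]
  have k1 := norm_integral_gammaExp_le hπ.le (show 0 < 6 * v by positivity)
  have k2 := norm_integral_gammaExp_le hπ'.le (show 0 < 6 * v by positivity)
  have k3 : ‖∫ t : ℝ, D (((0 : ℝ) : ℂ) + t * Complex.I) *
      (v : ℂ) ^ (-(((0 : ℝ) : ℂ) + t * Complex.I))‖ ≤ CD := by
    refine (norm_integral_le_integral_norm _).trans (le_of_eq ?_)
    congr 1
    ext t
    rw [norm_mul, Complex.norm_cpow_eq_rpow_re_of_pos hv]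
    simp
  have m1 := mul_le_mul_of_nonneg_left k1 (norm_nonneg α)
  have m2 := mul_le_mul_of_nonneg_left k2 (norm_nonneg α)
  linarith

theorem exists_norm_integral_rieszKer_le (ρ : ℝ) (hρ : 0 < ρ) : ∃ C : ℝ, 0 < C ∧
    ∀ y : ℝ, 0 < y → ‖∫ t : ℝ, rieszKer ρ (((ρ + 5 / 4) / 3 : ℝ) + t * Complex.I) *
      (y : ℂ) ^ (-((((ρ + 5 / 4) / 3 : ℝ) : ℂ) + t * Complex.I))‖ ≤ C * y ^ (-((ρ + 2) / 3)) := by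
  obtain ⟨C, hC, h⟩ := exists_norm_integral_rieszKer_aux ρ hρ
  refine ⟨C, hC, fun y hy => ?_⟩
  have hv : 0 < y ^ (1 / 3 : ℝ) := by positivity
  have h1 := h _ hv
  set f : ℝ → ℂ := fun t => rieszKer ρ (((ρ + 5 / 4) / 3 : ℝ) + t * Complex.I) *
      (y : ℂ) ^ (-((((ρ + 5 / 4) / 3 : ℝ) : ℂ) + t * Complex.I)) with hf
  have hcov : ∫ t : ℝ, f (t / 3) = (3 : ℝ) * ∫ t : ℝ, f t := by
    rw [Measure.integral_comp_div f 3, abs_of_pos (by norm_num)]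
    rfl
  have hfe : ∀ t : ℝ, f (t / 3) = ((y ^ (-((ρ + 2) / 3)) : ℝ) : ℂ) *
      (rieszKer ρ (((((-3 / 4 : ℝ) : ℂ) + t * Complex.I) + ρ + 2) / 3) *
      ((y ^ (1 / 3 : ℝ) : ℝ) : ℂ) ^ (-(((-3 / 4 : ℝ) : ℂ) + t * Complex.I))) := by
    intro t
    have e1 : (((ρ + 5 / 4) / 3 : ℝ) : ℂ) + ((t / 3 : ℝ) : ℂ) * Complex.I =
        ((((-3 / 4 : ℝ) : ℂ) + t * Complex.I) + ρ + 2) / 3 := by push_cast; ring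
    have hyc : (y : ℂ) ≠ 0 := by exact_mod_cast hy.ne'
    have hvc : ((y ^ (1 / 3 : ℝ) : ℝ) : ℂ) ≠ 0 := by exact_mod_cast hv.ne'
    simp only [hf]
    rw [e1, Complex.cpow_def_of_ne_zero hyc, Complex.cpow_def_of_ne_zero hvc,
      ← Complex.ofReal_log hy.le, ← Complex.ofReal_log hv.le, Real.log_rpow hy,
      Real.rpow_def_of_pos hy, Complex.ofReal_exp, mul_left_comm, ← Complex.exp_add]
    congr 2
    push_cast
    ring
  have h2 : (3 : ℝ) * ∫ t : ℝ, f t = ((y ^ (-((ρ + 2) / 3)) : ℝ) : ℂ) *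
      ∫ t : ℝ, (rieszKer ρ (((((-3 / 4 : ℝ) : ℂ) + t * Complex.I) + ρ + 2) / 3) *
      ((y ^ (1 / 3 : ℝ) : ℝ) : ℂ) ^ (-(((-3 / 4 : ℝ) : ℂ) + t * Complex.I))) := by
    rw [← hcov, ← integral_const_mul]
    exact integral_congr_ae (Eventually.of_forall hfe)
  have h3 := congrArg norm h2
  rw [norm_mul, norm_mul, Complex.norm_real, Complex.norm_real,
    Real.norm_of_nonneg (by positivity : (0 : ℝ) ≤ y ^ (-((ρ + 2) / 3)))] at h3
  have h4 : ‖(3 : ℝ)‖ = 3 := by norm_num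
  rw [h4] at h3
  have h5 := mul_le_mul_of_nonneg_left h1 (by positivity : (0 : ℝ) ≤ y ^ (-((ρ + 2) / 3)))
  have h6 := norm_nonneg (∫ t : ℝ, f t)
  linarith

theorem sum_range_add_eq_zero {M : ℕ} [NeZero M] {χ : DirichletCharacter ℂ M} (hχ : χ ≠ 1)
    (n : ℕ) : ∑ k ∈ Finset.range M, χ ((n + k : ℕ) : ZMod M) = 0 := by
  rw [← χ.sum_eq_zero_of_ne_one hχ, ← Equiv.sum_comp (Equiv.addLeft (n : ZMod M)) (fun a => χ a)]
  refine Finset.sum_bij' (fun k _ => (k : ZMod M)) (fun a _ => a.val) (fun _ _ => Finset.mem_univ _)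
    (fun a _ => Finset.mem_range.2 (ZMod.val_lt a))
    (fun k hk => ZMod.val_cast_of_lt (Finset.mem_range.1 hk)) (fun a _ => ZMod.natCast_zmod_val a)
    (fun k _ => by simp)

theorem exists_norm_sum_character_le {M : ℕ} [NeZero M] {χ : DirichletCharacter ℂ M}
    (hχ : χ ≠ 1) : ∃ B : ℝ, ∀ n : ℕ, ‖∑ k ∈ Finset.Icc 1 n, χ (k : ZMod M)‖ ≤ B := by
  set E : ℕ → ℂ := fun n => ∑ k ∈ Finset.range n, χ (k : ZMod M) with hE
  have hper : Function.Periodic E M := by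
    intro n
    simp only [hE]
    rw [Finset.sum_range_add, sum_range_add_eq_zero hχ, add_zero]
  refine ⟨(∑ j ∈ Finset.range M, ‖E j‖) + ‖χ 0‖, fun n => ?_⟩
  have h1 : ∑ k ∈ Finset.Icc 1 n, χ (k : ZMod M) = E (n + 1) - χ 0 := by
    simp only [hE]
    rw [Finset.sum_range_succ', Nat.cast_zero, add_sub_cancel_right, Finset.range_eq_Ico,
      Finset.sum_Ico_add' (fun k : ℕ => χ (k : ZMod M)) 0 n 1]
    rfl
  rw [h1]
  refine (norm_sub_le _ _).trans ?_
  gcongr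
  rw [← hper.map_mod_nat]
  exact Finset.single_le_sum (f := fun j => ‖E j‖) (fun _ _ => norm_nonneg _)
    (Finset.mem_range.2 (Nat.mod_lt _ (NeZero.pos M)))

/-- The partial sums of a primitive character are linear up to a bounded error. -/
theorem exists_norm_sum_character_sub_le {M : ℕ} [NeZero M] {χ : DirichletCharacter ℂ M}
    (hχ : χ.IsPrimitive) : ∃ κ : ℂ, ∃ B : ℝ, 0 ≤ B ∧ ∀ t : ℝ, 0 ≤ t →
      ‖∑ k ∈ Finset.Icc 1 ⌊t⌋₊, χ (k : ZMod M) - κ * t‖ ≤ B := by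
  by_cases h : χ = 1
  · have hM : M = 1 := by
      rw [DirichletCharacter.IsPrimitive, h, DirichletCharacter.conductor_one] at hχ
      · exact hχ.symm
    subst hM
    refine ⟨1, 1, zero_le_one, fun t ht => ?_⟩
    have h1 : ∑ k ∈ Finset.Icc 1 ⌊t⌋₊, χ (k : ZMod 1) = ((⌊t⌋₊ : ℝ) : ℂ) := by
      have : ∀ a : ZMod 1, χ a = 1 := fun a => by
        rw [Subsingleton.elim a 1, map_one]
      simp [this]
    rw [h1, one_mul, ← Complex.ofReal_sub, Complex.norm_real, Real.norm_eq_abs, abs_le]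
    constructor <;> linarith [Nat.floor_le ht, Nat.lt_floor_add_one t]
  · obtain ⟨B, hB⟩ := exists_norm_sum_character_le h
    refine ⟨0, B, (norm_nonneg _).trans (hB 0), fun t _ => ?_⟩
    rw [zero_mul, sub_zero]
    exact hB _

/-- `(s - 1) L(s, χ)` extends to an entire function. -/
theorem exists_entire_sub_one_mul_LFunction {M : ℕ} [NeZero M] (χ : DirichletCharacter ℂ M) :
    ∃ H : ℂ → ℂ, Differentiable ℂ H ∧
      ∀ s, s ≠ 1 → H s = (s - 1) * DirichletCharacter.LFunction χ s := by
  by_cases h : χ = 1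
  · subst h
    exact ⟨_, DirichletCharacter.differentiable_LFunctionTrivChar₁ M,
      fun s hs => Function.update_of_ne hs _ _⟩
  · exact ⟨_, (differentiable_id.sub_const 1).mul (DirichletCharacter.differentiable_LFunction h),
      fun s _ => rfl⟩

section Abel

variable {E : ℝ → ℂ} {B : ℝ}

theorem integrableOn_mul_cpow_of_bounded (hE : Measurable E) (hB : ∀ t, 0 ≤ t → ‖E t‖ ≤ B) {s : ℂ}
    (hs : 0 < s.re) :
    IntegrableOn (fun t : ℝ => E t * (t : ℂ) ^ (-(s + 1))) (Set.Ioi 1) := by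
  have h1 : IntegrableOn (fun t : ℝ => (t : ℂ) ^ (-(s + 1))) (Set.Ioi 1) := by
    refine integrableOn_Ioi_cpow_of_lt ?_ one_pos
    simp
    linarith
  refine h1.bdd_mul hE.aestronglyMeasurable ?_ (c := B)
  refine (ae_restrict_mem measurableSet_Ioi).mono fun t ht => hB t (zero_le_one.trans (le_of_lt ht))

theorem differentiableAt_integral_mul_cpow (hE : Measurable E) (hB : ∀ t, 0 ≤ t → ‖E t‖ ≤ B) {s : ℂ}
    (hs : 0 < s.re) :
    DifferentiableAt ℂ (fun s : ℂ => ∫ t in Set.Ioi (1 : ℝ), E t * (t : ℂ) ^ (-(s + 1))) s := by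
  set f : ℝ → ℂ := (Set.Ioi (1 : ℝ)).indicator E with hf
  have hfm : Measurable f := hE.indicator measurableSet_Ioi
  have hB0 : 0 ≤ B := (norm_nonneg _).trans (hB 0 le_rfl)
  have hfB : ∀ t, ‖f t‖ ≤ B := by
    intro t
    by_cases ht : t ∈ Set.Ioi (1 : ℝ)
    · rw [hf, Set.indicator_of_mem ht]
      exact hB t (zero_le_one.trans (le_of_lt ht))
    · rw [hf, Set.indicator_of_notMem ht, norm_zero]
      exact hB0
  have hmel : ∀ z : ℂ, mellin f (-z) = ∫ t in Set.Ioi (1 : ℝ), E t * (t : ℂ) ^ (-(z + 1)) := by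
    intro z
    have h1 : ∀ t : ℝ, (t : ℂ) ^ (-z - 1) • f t =
        (Set.Ioi (1 : ℝ)).indicator (fun t : ℝ => E t * (t : ℂ) ^ (-(z + 1))) t := by
      intro t
      by_cases ht : t ∈ Set.Ioi (1 : ℝ)
      · rw [hf, Set.indicator_of_mem ht, Set.indicator_of_mem ht, smul_eq_mul, mul_comm, neg_add']
      · rw [hf, Set.indicator_of_notMem ht, Set.indicator_of_notMem ht, smul_zero]
    rw [mellin]
    simp only [h1]
    rw [setIntegral_indicator measurableSet_Ioi]
    congr 2
    ext t
    simp only [Set.mem_inter_iff, Set.mem_Ioi]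
    constructor
    · exact fun h => h.2
    · exact fun h => ⟨by linarith, h⟩
  have hd : DifferentiableAt ℂ (mellin f) (-s) := by
    refine mellin_differentiableAt_of_isBigO_rpow (a := 0) (b := -s.re - 1) ?_ ?_ ?_ ?_ ?_
    · refine LocallyIntegrable.locallyIntegrableOn ?_ _
      exact (locallyIntegrable_const B).mono hfm.aestronglyMeasurable
        (Eventually.of_forall fun t => by
          rw [Real.norm_of_nonneg hB0]
          exact hfB t)
    · refine IsBigO.of_bound B (Eventually.of_forall fun t => ?_)
      simpa using hfB t
    · simpa using hs
    · refine IsBigO.of_bound 0 ?_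
      filter_upwards [mem_nhdsWithin_of_mem_nhds (Iio_mem_nhds (show (0 : ℝ) < 1 by norm_num))]
        with t ht
      rw [hf, Set.indicator_of_notMem (by simpa using le_of_lt ht)]
      simp
    · simp
  have h2 := hd.comp s (f := fun z : ℂ => -z) differentiableAt_id.neg
  refine h2.congr_of_eventuallyEq (Eventually.of_forall fun z => ?_)
  exact (hmel z).symm

theorem norm_integral_mul_cpow_le (hB : ∀ t, 0 ≤ t → ‖E t‖ ≤ B) {s : ℂ}
    (hs : 1 / 2 ≤ s.re) :
    ‖∫ t in Set.Ioi (1 : ℝ), E t * (t : ℂ) ^ (-(s + 1))‖ ≤ 2 * B := by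
  have hB0 : 0 ≤ B := (norm_nonneg _).trans (hB 0 le_rfl)
  have hInt : IntegrableOn (fun t : ℝ => B * t ^ (-(3 / 2) : ℝ)) (Set.Ioi 1) :=
    (integrableOn_Ioi_rpow_of_lt (by norm_num) one_pos).const_mul B
  refine (norm_integral_le_of_norm_le hInt ?_).trans (le_of_eq ?_)
  · refine (ae_restrict_mem measurableSet_Ioi).mono fun t ht => ?_
    have ht1 : (1 : ℝ) < t := ht
    rw [norm_mul, Complex.norm_cpow_eq_rpow_re_of_pos (by linarith)]
    refine mul_le_mul (hB t (by linarith)) ?_ (by positivity) hB0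
    refine Real.rpow_le_rpow_of_exponent_le ht1.le ?_
    simp
    linarith
  · rw [integral_const_mul, integral_Ioi_rpow_of_lt (by norm_num) one_pos]
    norm_num
    ring

end Abel

theorem sub_one_mul_LFunction_eq {M : ℕ} [NeZero M] {χ : DirichletCharacter ℂ M} {κ : ℂ} {B : ℝ}
    (hB : ∀ t : ℝ, 0 ≤ t → ‖∑ k ∈ Finset.Icc 1 ⌊t⌋₊, χ (k : ZMod M) - κ * t‖ ≤ B) {s : ℂ}
    (hs : 0 < s.re) (hs1 : s ≠ 1) :
    (s - 1) * DirichletCharacter.LFunction χ s = κ * s + s * (s - 1) *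
      ∫ t in Set.Ioi (1 : ℝ), (∑ k ∈ Finset.Icc 1 ⌊t⌋₊, χ (k : ZMod M) - κ * t) *
        (t : ℂ) ^ (-(s + 1)) := by
  obtain ⟨H, hH, hHL⟩ := exists_entire_sub_one_mul_LFunction χ
  set E : ℝ → ℂ := fun t => ∑ k ∈ Finset.Icc 1 ⌊t⌋₊, χ (k : ZMod M) - κ * t with hE
  have hEm : Measurable E := by
    refine Measurable.sub ?_ (measurable_const.mul Complex.measurable_ofReal)
    exact (measurable_from_nat (f := fun n : ℕ => ∑ k ∈ Finset.Icc 1 n, χ (k : ZMod M))).comp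
      Nat.measurable_floor
  set G : ℂ → ℂ := fun s => κ * s + s * (s - 1) *
      ∫ t in Set.Ioi (1 : ℝ), E t * (t : ℂ) ^ (-(s + 1)) with hG
  have hU : IsOpen {z : ℂ | 0 < z.re} := isOpen_lt continuous_const Complex.continuous_re
  have hGa : AnalyticOnNhd ℂ G {z : ℂ | 0 < z.re} := by
    refine DifferentiableOn.analyticOnNhd (fun z hz => ?_) hU
    refine DifferentiableAt.differentiableWithinAt ?_
    refine DifferentiableAt.add (by fun_prop) (DifferentiableAt.mul (by fun_prop) ?_)
    exact differentiableAt_integral_mul_cpow hEm hB hz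
  have hHa : AnalyticOnNhd ℂ H {z : ℂ | 0 < z.re} :=
    hH.differentiableOn.analyticOnNhd hU
  have heq : ∀ z : ℂ, 1 < z.re → H z = G z := by
    intro z hz
    have hz1 : z ≠ 1 := by
      rintro rfl
      simp at hz
    have hz0 : z - 1 ≠ 0 := sub_ne_zero.2 hz1
    rw [hHL z hz1, DirichletCharacter.LFunction_eq_LSeries χ hz,
      LSeries_eq_mul_integral (r := 1) _ zero_le_one hz
        (DirichletCharacter.LSeriesSummable_of_one_lt_re χ hz)]
    · have hsplit : ∀ t : ℝ, t ∈ Set.Ioi (1 : ℝ) →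
          (∑ k ∈ Finset.Icc 1 ⌊t⌋₊, χ (k : ZMod M)) * (t : ℂ) ^ (-(z + 1)) =
          E t * (t : ℂ) ^ (-(z + 1)) + κ * (t : ℂ) ^ (-z) := by
        intro t ht
        have ht0 : (t : ℂ) ≠ 0 := by
          have : (1 : ℝ) < t := ht
          exact_mod_cast (by linarith : t ≠ 0)
        have : (t : ℂ) ^ (-z) = t * (t : ℂ) ^ (-(z + 1)) := by
          rw [show -z = 1 + -(z + 1) by ring, Complex.cpow_add _ _ ht0, Complex.cpow_one]
        rw [this, hE]
        ring
      rw [setIntegral_congr_fun measurableSet_Ioi hsplit, integral_add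
        (integrableOn_mul_cpow_of_bounded hEm hB (by linarith))
        ((integrableOn_Ioi_cpow_of_lt (by simpa using hz) one_pos).const_mul _),
        integral_const_mul, integral_Ioi_cpow_of_lt (by simpa using hz) one_pos, hG]
      have hz2 : -z + 1 ≠ 0 := by
        rw [show -z + 1 = -(z - 1) by ring]
        exact neg_ne_zero.2 hz0
      simp only [Complex.ofReal_one, Complex.one_cpow]
      field_simp
      ring
    · have h2 : (fun n : ℕ => ∑ k ∈ Finset.Icc 1 n, χ (k : ZMod M)) =O[atTop]
          fun n : ℕ => (n : ℝ) := by
        refine IsBigO.of_bound 1 (Eventually.of_forall fun n => ?_)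
        refine (norm_sum_le _ _).trans ?_
        refine (Finset.sum_le_sum (g := fun _ => (1 : ℝ)) fun k _ => χ.norm_le_one _).trans ?_
        simp
      simpa using h2
  have hall := hHa.eqOn_of_preconnected_of_eventuallyEq hGa
    (convex_halfSpace_re_gt 0).isPreconnected (z₀ := 2) (by simp)
    (by
      filter_upwards [(isOpen_lt continuous_const Complex.continuous_re).mem_nhds
        (show (2 : ℂ) ∈ {z : ℂ | (1 : ℝ) < z.re} by simp)] with z hz
      exact heq z hz)
  rw [← hHL s hs1]
  exact hall hs

theorem exists_norm_LFunction_le_right {M : ℕ} [NeZero M] {χ : DirichletCharacter ℂ M}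
    (hχ : χ.IsPrimitive) : ∃ C : ℝ, 0 < C ∧ ∀ s : ℂ, 1 / 2 ≤ s.re → s.re ≤ 2 → 2 ≤ |s.im| →
      ‖DirichletCharacter.LFunction χ s‖ ≤ C * |s.im| := by
  obtain ⟨κ, B, hB0, hB⟩ := exists_norm_sum_character_sub_le hχ
  refine ⟨(‖κ‖ + 2 * B) * 2 + 1, by positivity, fun s h1 h2 ht => ?_⟩
  have him : |s.im| ≤ ‖s - 1‖ := by
    have := Complex.abs_im_le_norm (s - 1)
    simpa using this
  have hs1 : s ≠ 1 := by
    rintro rfl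
    simp at ht
    linarith
  have hpos : 1 ≤ ‖s - 1‖ := by linarith
  have hsn : ‖s‖ ≤ 2 * |s.im| := by
    refine (Complex.norm_le_abs_re_add_abs_im s).trans ?_
    have : |s.re| ≤ 2 := by rw [abs_le]; constructor <;> linarith
    linarith
  have h3 := congrArg norm (sub_one_mul_LFunction_eq hB (by linarith : 0 < s.re) hs1)
  have h4 := norm_integral_mul_cpow_le hB h1
  rw [norm_mul] at h3
  have h5 : ‖s - 1‖ * ‖DirichletCharacter.LFunction χ s‖ ≤
      ‖s - 1‖ * (((‖κ‖ + 2 * B) * 2) * |s.im|) := by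
    rw [h3]
    refine (norm_add_le _ _).trans ?_
    rw [norm_mul, norm_mul, norm_mul]
    calc ‖κ‖ * ‖s‖ + ‖s‖ * ‖s - 1‖ * _ ≤ ‖s - 1‖ * (‖κ‖ * ‖s‖) + ‖s‖ * ‖s - 1‖ * (2 * B) := by
          refine add_le_add ?_ (mul_le_mul_of_nonneg_left h4 (by positivity))
          exact le_mul_of_one_le_left (by positivity) hpos
      _ = ‖s - 1‖ * ((‖κ‖ + 2 * B) * ‖s‖) := by ring
      _ ≤ ‖s - 1‖ * ((‖κ‖ + 2 * B) * (2 * |s.im|)) := by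
          refine mul_le_mul_of_nonneg_left ?_ (by linarith)
          exact mul_le_mul_of_nonneg_left hsn (by positivity)
      _ = _ := by ring
  have h6 := le_of_mul_le_mul_left h5 (by linarith)
  refine h6.trans ?_
  have := abs_nonneg s.im
  linarith

theorem even_inv {M : ℕ} {χ : DirichletCharacter ℂ M} (h : χ.Even) : χ⁻¹.Even := by
  have h1 : χ (-1) = 1 := h
  have h2 : (χ * χ⁻¹) (-1) = 1 := by
    rw [mul_inv_cancel, MulChar.one_apply isUnit_one.neg]
  rw [MulChar.mul_apply, h1, one_mul] at h2
  exact h2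

/-- The asymmetric form of the functional equation of an even primitive character. -/
theorem exists_LFunction_one_sub_eq {M : ℕ} [NeZero M] {χ : DirichletCharacter ℂ M}
    (hχ : χ.IsPrimitive) (heven : χ.Even) : ∃ ε : ℂ, ∀ w : ℂ, 0 < w.re → w ≠ 1 →
      DirichletCharacter.LFunction χ (1 - w) = ε * ((M / π : ℝ) : ℂ) ^ w *
        (Complex.Gamma (w / 2) * (Complex.Gamma ((1 - w) / 2))⁻¹) *
        DirichletCharacter.LFunction χ⁻¹ w := by
  have hM : 0 < (M : ℝ) := by exact_mod_cast NeZero.pos M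
  have hMc : (M : ℂ) ≠ 0 := by exact_mod_cast NeZero.ne M
  have hpi : (π : ℂ) ≠ 0 := by exact_mod_cast Real.pi_ne_zero
  refine ⟨χ.rootNumber * (M : ℂ) ^ (-(1 / 2) : ℂ) * (π : ℂ) ^ (1 / 2 : ℂ), fun w hw hw1 => ?_⟩
  have hw0 : w ≠ 0 := by
    rintro rfl
    simp at hw
  rw [DirichletCharacter.LFunction_eq_completed_div_gammaFactor χ (1 - w)
      (Or.inl (sub_ne_zero.2 hw1.symm)),
    DirichletCharacter.LFunction_eq_completed_div_gammaFactor χ⁻¹ w (Or.inl hw0),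
    hχ.completedLFunction_one_sub, heven.gammaFactor_def, (even_inv heven).gammaFactor_def]
  have hG : Complex.Gamma (w / 2) ≠ 0 := by
    refine Complex.Gamma_ne_zero_of_re_pos ?_
    simpa using hw
  have hπw : (π : ℂ) ^ (-w / 2) ≠ 0 := by
    rw [Complex.cpow_def_of_ne_zero hpi]
    exact Complex.exp_ne_zero _
  have hMπ : ((M / π : ℝ) : ℂ) ^ w = (M : ℂ) ^ w * (π : ℂ) ^ (-w) := by
    rw [div_eq_mul_inv, Complex.ofReal_mul, Complex.mul_cpow_ofReal_nonneg hM.le (by positivity),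
      Complex.ofReal_inv, Complex.inv_cpow _ _ (by
        rw [Complex.arg_ofReal_of_nonneg Real.pi_pos.le]
        exact Real.pi_pos.ne), Complex.cpow_neg, Complex.ofReal_natCast]
  have hMw : (M : ℂ) ^ (w - 1 / 2) = (M : ℂ) ^ w * (M : ℂ) ^ (-(1 / 2) : ℂ) := by
    rw [← Complex.cpow_add _ _ hMc, sub_eq_add_neg]
  have hπ2 : (π : ℂ) ^ (-w) = (π : ℂ) ^ (-w / 2) * (π : ℂ) ^ (-w / 2) := by
    rw [← Complex.cpow_add _ _ hpi]
    congr 1; ring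
  have hπ3 : ((π : ℂ) ^ (-(1 - w) / 2))⁻¹ = (π : ℂ) ^ (1 / 2 : ℂ) * (π : ℂ) ^ (-w / 2) := by
    rw [← Complex.cpow_neg, ← Complex.cpow_add _ _ hpi]
    congr 1; ring
  rw [Complex.Gammaℝ_def, Complex.Gammaℝ_def, hMπ, hMw, hπ2, div_eq_mul_inv, mul_inv, hπ3]
  field_simp

theorem exists_norm_Gamma_quotient_le : ∃ C T : ℝ, 0 < C ∧ 2 ≤ T ∧ ∀ w : ℂ, 1 / 2 ≤ w.re →
    w.re ≤ 2 → T ≤ |w.im| →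
      ‖Complex.Gamma (w / 2) * (Complex.Gamma ((1 - w) / 2))⁻¹‖ ≤ C * |w.im| ^ (2 : ℝ) := by
  obtain ⟨c, C, T, hc, hC, hT, h⟩ := exists_norm_Gamma_bounds (M := 1) zero_le_one
  refine ⟨C * c⁻¹, 2 * T, by positivity, by linarith, fun w h1 h2 ht => ?_⟩
  have e1 : w / 2 = ((w.re / 2 : ℝ) : ℂ) + ((w.im / 2 : ℝ) : ℂ) * Complex.I := by
    apply Complex.ext <;> simp
  have e2 : (1 - w) / 2 = (((1 - w.re) / 2 : ℝ) : ℂ) + ((-w.im / 2 : ℝ) : ℂ) * Complex.I := by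
    apply Complex.ext <;> simp
  have ht2 : |w.im / 2| = |w.im| / 2 := by rw [abs_div, abs_two]
  have ht3 : |-w.im / 2| = |w.im| / 2 := by rw [abs_div, abs_two, abs_neg]
  have b1 := (h (w.re / 2) (w.im / 2) (by rw [abs_le]; constructor <;> linarith)
    (by rw [ht2]; linarith)).2
  have b2 := (h ((1 - w.re) / 2) (-w.im / 2) (by rw [abs_le]; constructor <;> linarith)
    (by rw [ht3]; linarith)).1
  rw [← e1] at b1
  rw [← e2] at b2
  set y := |w.im| / 2 with hy
  have hy0 : 0 < y := by linarith
  rw [gammaSize, ht2] at b1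
  rw [gammaSize, ht3] at b2
  have hEpos : 0 < y ^ ((1 - w.re) / 2 - 1 / 2) * Real.exp (-(π / 2 * y)) := by positivity
  rw [norm_mul, norm_inv]
  calc ‖Complex.Gamma (w / 2)‖ * ‖Complex.Gamma ((1 - w) / 2)‖⁻¹
      ≤ (C * (y ^ (w.re / 2 - 1 / 2) * Real.exp (-(π / 2 * y)))) *
        (c * (y ^ ((1 - w.re) / 2 - 1 / 2) * Real.exp (-(π / 2 * y))))⁻¹ := by
        refine mul_le_mul b1 (inv_anti₀ (by positivity) b2) (by positivity) (by positivity)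
    _ = C * c⁻¹ * (y ^ (w.re / 2 - 1 / 2) * (y ^ ((1 - w.re) / 2 - 1 / 2))⁻¹) := by
        have := Real.exp_ne_zero (-(π / 2 * y))
        rw [mul_inv, mul_inv]
        field_simp
    _ = C * c⁻¹ * y ^ (w.re - 1 / 2) := by
        rw [← Real.rpow_neg hy0.le, ← Real.rpow_add hy0]
        congr 2; ring
    _ ≤ C * c⁻¹ * |w.im| ^ (2 : ℝ) := by
        refine mul_le_mul_of_nonneg_left ?_ (by positivity)
        calc y ^ (w.re - 1 / 2) ≤ |w.im| ^ (w.re - 1 / 2) :=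
              Real.rpow_le_rpow hy0.le (by linarith) (by linarith)
          _ ≤ _ := Real.rpow_le_rpow_of_exponent_le (by linarith) (by linarith)

theorem isPrimitive_inv {M : ℕ} {χ : DirichletCharacter ℂ M} (h : χ.IsPrimitive) :
    χ⁻¹.IsPrimitive := by
  rwa [DirichletCharacter.IsPrimitive, DirichletCharacter.conductor_inv]

theorem exists_norm_LFunction_le {M : ℕ} [NeZero M] {χ : DirichletCharacter ℂ M}
    (hχ : χ.IsPrimitive) (heven : χ.Even) : ∃ C T : ℝ, 0 < C ∧ 2 ≤ T ∧
      ∀ s : ℂ, -1 ≤ s.re → s.re ≤ 2 → T ≤ |s.im| →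
        ‖DirichletCharacter.LFunction χ s‖ ≤ C * |s.im| ^ (3 : ℝ) := by
  obtain ⟨C₁, hC₁, h₁⟩ := exists_norm_LFunction_le_right hχ
  obtain ⟨C₂, hC₂, h₂⟩ := exists_norm_LFunction_le_right (isPrimitive_inv hχ)
  obtain ⟨C₃, T, hC₃, hT, h₃⟩ := exists_norm_Gamma_quotient_le
  obtain ⟨ε, hε⟩ := exists_LFunction_one_sub_eq hχ heven
  have hM : 0 < (M / π : ℝ) := by
    have : 0 < (M : ℝ) := by exact_mod_cast NeZero.pos M
    positivity
  set K : ℝ := (M / π : ℝ) ^ (-(-2) : ℝ) + (M / π : ℝ) ^ (-(-(1 / 2)) : ℝ)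
  refine ⟨C₁ + ‖ε‖ * K * C₃ * C₂, T, by positivity, hT, fun s h1 h2 ht => ?_⟩
  have ht0 : 0 < |s.im| := by linarith
  have hp0 : 0 ≤ |s.im| ^ (3 : ℝ) := by positivity
  rcases le_total (1 / 2) s.re with h | h
  · refine (h₁ s h h2 (by linarith)).trans ?_
    have h5 : |s.im| ≤ |s.im| ^ (3 : ℝ) :=
      Real.self_le_rpow_of_one_le (by linarith) (by norm_num)
    calc C₁ * |s.im| ≤ C₁ * |s.im| ^ (3 : ℝ) := by gcongr
      _ ≤ _ := by
        gcongr
        have : 0 ≤ ‖ε‖ * K * C₃ * C₂ := by positivity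
        linarith
  · set w : ℂ := 1 - s with hw
    have hwre : w.re = 1 - s.re := by simp [hw]
    have hwim : |w.im| = |s.im| := by simp [hw]
    have hw1 : w ≠ 1 := by
      intro h0
      rw [h0] at hwim
      simp at hwim
      rw [← hwim] at ht0
      simp at ht0
    have hs : s = 1 - w := by rw [hw]; ring
    have k1 : ‖((M / π : ℝ) : ℂ) ^ w‖ ≤ K := by
      have := norm_rpow_neg_le hM (s := -w) (a := -2) (b := -(1 / 2))
        (by rw [Complex.neg_re]; linarith) (by rw [Complex.neg_re]; linarith)
      rwa [neg_neg] at this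
    have k2 := h₃ w (by linarith) (by linarith) (by rwa [hwim])
    have k3 := h₂ w (by linarith) (by linarith) (by rw [hwim]; linarith)
    rw [hwim] at k2 k3
    rw [← hs] at k2
    rw [hs, hε w (by linarith) hw1, ← hs, norm_mul, norm_mul, norm_mul ε]
    have e3 : |s.im| ^ (3 : ℝ) = |s.im| ^ (2 : ℝ) * |s.im| := by
      rw [← Real.rpow_add_one ht0.ne']
      norm_num
    calc _ ≤ ‖ε‖ * K * (C₃ * |s.im| ^ (2 : ℝ)) * (C₂ * |s.im|) := by
          refine mul_le_mul (mul_le_mul (mul_le_mul_of_nonneg_left k1 (norm_nonneg _)) k2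
            (norm_nonneg _) (by positivity)) k3 (norm_nonneg _) (by positivity)
      _ = ‖ε‖ * K * C₃ * C₂ * |s.im| ^ (3 : ℝ) := by rw [e3]; ring
      _ ≤ _ := by
        gcongr
        linarith

theorem divisorSumChar_eq_convolution {N : ℕ} (χ : DirichletCharacter ℂ N) :
    divisorSumChar χ = LSeries.convolution (fun n : ℕ => χ (n : ZMod N)) (1 : ℕ → ℂ) := by
  ext n
  rw [LSeries.convolution_def]
  beta_reduce
  rw [Nat.sum_divisorsAntidiagonal (f := fun i j => χ (i : ZMod N) * (1 : ℕ → ℂ) j)]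
  simp [divisorSumChar]

theorem scrDchi_eq_convolution {N q : ℕ} (χ₁ : DirichletCharacter ℂ N)
    (χ : DirichletCharacter ℂ q) :
    scrDchi χ₁ χ =
      LSeries.convolution (divisorSumChar χ₁) (fun n : ℕ => χ (n : ZMod q)) := by
  ext n
  rw [LSeries.convolution_def]
  beta_reduce
  rw [Nat.sum_divisorsAntidiagonal (f := fun i j => divisorSumChar χ₁ i * χ (j : ZMod q))]
  rfl

section

variable {N q : ℕ} [NeZero N] [NeZero q] (χ₁ : DirichletCharacter ℂ N) (χ : DirichletCharacter ℂ q)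

theorem LSeriesHasSum_scrDchi {s : ℂ} (hs : 1 < s.re) :
    LSeriesHasSum (scrDchi χ₁ χ) s (DirichletCharacter.LFunction χ₁ s * riemannZeta s *
      DirichletCharacter.LFunction χ s) := by
  have h : ∀ {M : ℕ} [NeZero M] (ψ : DirichletCharacter ℂ M),
      LSeriesHasSum (fun n : ℕ => ψ (n : ZMod M)) s (DirichletCharacter.LFunction ψ s) := by
    intro M _ ψ
    rw [DirichletCharacter.LFunction_eq_LSeries ψ hs]
    exact (DirichletCharacter.LSeriesSummable_of_one_lt_re ψ hs).LSeriesHasSum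
  rw [scrDchi_eq_convolution, divisorSumChar_eq_convolution]
  exact ((h χ₁).convolution (LSeriesHasSum_one hs)).convolution (h χ)

end

section Interchange

variable {c : ℕ → ℂ} {σ : ℝ} {G : ℝ → ℂ}

theorem continuous_term (c : ℕ → ℂ) (σ : ℝ) (n : ℕ) :
    Continuous fun t : ℝ => LSeries.term c (σ + t * Complex.I) n := by
  rcases eq_or_ne n 0 with rfl | hn
  · simpa using continuous_const
  · simp only [LSeries.term_of_ne_zero hn]
    have hn' : (n : ℂ) ≠ 0 := by exact_mod_cast hn
    refine continuous_const.div (Continuous.const_cpow (by fun_prop) (Or.inl hn')) fun t => ?_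
    rw [Complex.cpow_def_of_ne_zero hn']
    exact Complex.exp_ne_zero _

theorem norm_term_vertical (c : ℕ → ℂ) (σ : ℝ) (n : ℕ) (t : ℝ) :
    ‖LSeries.term c (σ + t * Complex.I) n‖ = ‖LSeries.term c σ n‖ := by
  rw [LSeries.norm_term_eq, LSeries.norm_term_eq]
  simp

/-- A Dirichlet series may be integrated term by term along a vertical line on which it converges
absolutely. -/
theorem hasSum_integral_term_mul (hc : LSeriesSummable c σ) (hG : Integrable G) :
    HasSum (fun n => ∫ t : ℝ, LSeries.term c (σ + t * Complex.I) n * G t)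
      (∫ t : ℝ, LSeries c (σ + t * Complex.I) * G t) := by
  have h := hasSum_integral_of_summable_integral_norm
    (F := fun n (t : ℝ) => LSeries.term c (σ + t * Complex.I) n * G t) (μ := volume)
    (fun n => hG.bdd_mul (continuous_term c σ n).aestronglyMeasurable
      (c := ‖LSeries.term c σ n‖) (Eventually.of_forall fun t => (norm_term_vertical c σ n t).le))
    (by
      simp only [norm_mul, norm_term_vertical, integral_const_mul]
      exact hc.norm.mul_right _)
  simpa only [LSeries, tsum_mul_right] using h

end Interchange

/-- The Mellin transform of `(1 - u)_+ ^ ρ / Γ(ρ + 1)`. -/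
noncomputable def gammaQuot (ρ : ℝ) (z : ℂ) : ℂ :=
  Complex.Gamma z * (Complex.Gamma (z + ρ + 1))⁻¹

theorem exists_norm_gammaQuot_le (ρ : ℝ) {M : ℝ} (hM : 0 ≤ M) : ∃ C T : ℝ, 0 < C ∧ 2 ≤ T ∧
    ∀ z : ℂ, |z.re| ≤ M → T ≤ |z.im| → ‖gammaQuot ρ z‖ ≤ C * |z.im| ^ (-(ρ + 1)) := by
  obtain ⟨c, C, T, hc, hC, hT, h⟩ := exists_norm_Gamma_bounds (M := M + |ρ| + 1) (by positivity)
  refine ⟨C * c⁻¹, T, by positivity, hT, fun z hz ht => ?_⟩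
  have hz' := abs_le.1 hz
  have hρ := abs_le.1 (le_refl |ρ|)
  have hρ0 := abs_nonneg ρ
  have e2 : z + ρ + 1 = ((z.re + ρ + 1 : ℝ) : ℂ) + z.im * Complex.I := by
    apply Complex.ext <;> simp
  have b1 := (h z.re z.im (by rw [abs_le]; constructor <;> linarith) ht).2
  have b2 := (h (z.re + ρ + 1) z.im (by rw [abs_le]; constructor <;> linarith) ht).1
  rw [Complex.re_add_im] at b1
  rw [← e2] at b2
  have hy0 : 0 < |z.im| := by linarith
  rw [gammaSize] at b1 b2
  have hEpos : 0 < |z.im| ^ (z.re + ρ + 1 - 1 / 2) * Real.exp (-(π / 2 * |z.im|)) := by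
    positivity
  rw [gammaQuot, norm_mul, norm_inv]
  calc _ ≤ (C * (|z.im| ^ (z.re - 1 / 2) * Real.exp (-(π / 2 * |z.im|)))) *
        (c * (|z.im| ^ (z.re + ρ + 1 - 1 / 2) * Real.exp (-(π / 2 * |z.im|))))⁻¹ :=
        mul_le_mul b1 (inv_anti₀ (by positivity) b2) (by positivity) (by positivity)
    _ = C * c⁻¹ * (|z.im| ^ (z.re - 1 / 2) * (|z.im| ^ (z.re + ρ + 1 - 1 / 2))⁻¹) := by
        have := Real.exp_ne_zero (-(π / 2 * |z.im|))
        rw [mul_inv, mul_inv]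
        field_simp
    _ = _ := by
        rw [← Real.rpow_neg hy0.le, ← Real.rpow_add hy0]
        congr 2; ring

theorem differentiableAt_gammaQuot (ρ : ℝ) {z : ℂ} (hz : 0 < z.re) :
    DifferentiableAt ℂ (gammaQuot ρ) z :=
  (differentiableAt_Gamma_of_pos hz).mul
    (DifferentiableAt.comp z (f := fun z : ℂ => z + ρ + 1) (differentiable_inv_Gamma _)
      (by fun_prop))

theorem hasMellin_max_one_sub_rpow {ρ : ℝ} (hρ : 0 < ρ) {z : ℂ} (hz : 0 < z.re) :
    HasMellin (fun u : ℝ => ((max (1 - u) 0 ^ ρ : ℝ) : ℂ)) z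
      (Complex.Gamma (ρ + 1) * gammaQuot ρ z) := by
  have hf : ∀ u : ℝ, u ∈ Set.Ioi (0 : ℝ) → (u : ℂ) ^ (z - 1) • ((max (1 - u) 0 ^ ρ : ℝ) : ℂ) =
      (Set.Ioc (0 : ℝ) 1).indicator
        (fun u : ℝ => (u : ℂ) ^ (z - 1) * (1 - (u : ℂ)) ^ ((ρ + 1 : ℂ) - 1)) u := by
    intro u hu
    have hu0 : (0 : ℝ) < u := hu
    by_cases h : u ≤ 1
    · rw [Set.indicator_of_mem (show u ∈ Set.Ioc (0 : ℝ) 1 from ⟨hu, h⟩), max_eq_left (by linarith),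
        Complex.ofReal_cpow (by linarith), smul_eq_mul, add_sub_cancel_right]
      push_cast
      rfl
    · rw [Set.indicator_of_notMem (show u ∉ Set.Ioc (0 : ℝ) 1 from fun h' => h h'.2),
        max_eq_right (by linarith), Real.zero_rpow hρ.ne']
      simp
  have hconv : IntegrableOn
      (fun u : ℝ => (u : ℂ) ^ (z - 1) * (1 - (u : ℂ)) ^ ((ρ + 1 : ℂ) - 1)) (Set.Ioc 0 1) := by
    have := Complex.betaIntegral_convergent hz (v := (ρ + 1 : ℂ)) (by simp; linarith)
    rwa [intervalIntegrable_iff_integrableOn_Ioc_of_le zero_le_one] at this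
  constructor
  · rw [MellinConvergent, integrableOn_congr_fun hf measurableSet_Ioi]
    exact ((integrable_indicator_iff measurableSet_Ioc).2 hconv).integrableOn
  · rw [mellin, setIntegral_congr_fun measurableSet_Ioi hf, setIntegral_indicator measurableSet_Ioc,
      Set.inter_eq_right.2 (fun u hu => hu.1), ← intervalIntegral.integral_of_le zero_le_one]
    have h2 := Complex.Gamma_mul_Gamma_eq_betaIntegral hz (t := (ρ + 1 : ℂ)) (by simp; linarith)
    rw [Complex.betaIntegral] at h2
    have h3 : Complex.Gamma (z + (ρ + 1)) ≠ 0 := by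
      refine Complex.Gamma_ne_zero_of_re_pos ?_
      simp
      linarith
    rw [gammaQuot, add_assoc]
    field_simp
    rw [mul_comm (Complex.Gamma (ρ + 1)), h2]
    ring

theorem integrable_gammaQuot_vertical {ρ σ : ℝ} (hρ : 0 < ρ) (hσ : 0 < σ) :
    Integrable fun t : ℝ => gammaQuot ρ (σ + t * Complex.I) := by
  obtain ⟨C, T, hC, hT, h⟩ := exists_norm_gammaQuot_le ρ hσ.le
  exact integrable_vertical (f := gammaQuot ρ) (σ := σ)
    (fun s hs => (differentiableAt_gammaQuot ρ (by rw [hs]; exact hσ)).continuousAt) (T := T)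
    (by linarith) (p := ρ + 1) (by linarith) hC.le
    (fun s hs => h s (by rw [hs, abs_of_pos hσ]))

theorem max_one_sub_rpow_eq_integral {ρ : ℝ} (hρ : 0 < ρ) {u : ℝ} (hu : 0 < u) :
    ((max (1 - u) 0 ^ ρ : ℝ) : ℂ) = Complex.Gamma (ρ + 1) / (2 * π) *
      ∫ t : ℝ, (u : ℂ) ^ (-((1 : ℝ) + t * Complex.I)) * gammaQuot ρ ((1 : ℝ) + t * Complex.I) := by
  have hm : ∀ t : ℝ, mellin (fun u : ℝ => ((max (1 - u) 0 ^ ρ : ℝ) : ℂ))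
      ((1 : ℝ) + t * Complex.I) = Complex.Gamma (ρ + 1) * gammaQuot ρ ((1 : ℝ) + t * Complex.I) :=
    fun t => (hasMellin_max_one_sub_rpow hρ (by simp)).2
  have h := mellinInv_mellin_eq 1 (fun u : ℝ => ((max (1 - u) 0 ^ ρ : ℝ) : ℂ)) hu
    (hasMellin_max_one_sub_rpow hρ (by simp)).1 (by
      rw [Complex.VerticalIntegrable]
      simp only [hm]
      exact (integrable_gammaQuot_vertical hρ one_pos).const_mul _) (by
      refine Continuous.continuousAt (Complex.continuous_ofReal.comp ?_)
      exact Continuous.rpow_const (by fun_prop) (fun _ => Or.inr hρ.le))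
  rw [mellinInv] at h
  simp only [hm] at h
  rw [← h, div_mul_eq_mul_div, ← integral_const_mul, Complex.real_smul]
  simp only [smul_eq_mul, mul_left_comm]
  push_cast
  ring

/-- The Riesz mean of order `ρ` of the sequence `a` along the squares. -/
noncomputable def rieszMean (a : ℕ → ℂ) (ρ X : ℝ) : ℂ :=
  ∑' n : ℕ, ((max (X - (n : ℝ) ^ 2) 0 ^ ρ : ℝ) : ℂ) / Complex.Gamma (ρ + 1) * a n

theorem rieszTerm_eq_integral {a : ℕ → ℂ} (ha : a 0 = 0) {ρ X : ℝ} (hρ : 0 < ρ) (hX : 0 < X)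
    (n : ℕ) :
    ((max (X - (n : ℝ) ^ 2) 0 ^ ρ : ℝ) : ℂ) / Complex.Gamma (ρ + 1) * a n =
      (4 * π : ℂ)⁻¹ * ∫ t : ℝ, LSeries.term a ((2 : ℝ) + t * Complex.I) n *
        (gammaQuot ρ (((2 : ℝ) + t * Complex.I) / 2) *
          (X : ℂ) ^ (((2 : ℝ) + t * Complex.I) / 2 + ρ)) := by
  rcases eq_or_ne n 0 with rfl | hn
  · simp [ha]
  have hn0 : (0 : ℝ) < n := by positivity
  have hX' : (X : ℂ) ≠ 0 := by exact_mod_cast hX.ne'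
  have hn' : (n : ℂ) ≠ 0 := by exact_mod_cast hn
  have hΓ : Complex.Gamma (ρ + 1) ≠ 0 := by
    refine Complex.Gamma_ne_zero_of_re_pos ?_
    simp
    linarith
  have hu : 0 < (n : ℝ) ^ 2 / X := by positivity
  have e1 : max (X - (n : ℝ) ^ 2) 0 ^ ρ = X ^ ρ * max (1 - (n : ℝ) ^ 2 / X) 0 ^ ρ := by
    rw [← Real.mul_rpow hX.le (le_max_right _ _), mul_max_of_nonneg _ _ hX.le]
    congr 2
    · field_simp
    · simp
  have e2 := max_one_sub_rpow_eq_integral hρ hu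
  have e3 := Measure.integral_comp_mul_left (fun t : ℝ =>
      LSeries.term a ((2 : ℝ) + t * Complex.I) n *
        (gammaQuot ρ (((2 : ℝ) + t * Complex.I) / 2) *
          (X : ℂ) ^ (((2 : ℝ) + t * Complex.I) / 2 + ρ))) 2
  have e4 : ∀ t : ℝ, LSeries.term a ((2 : ℝ) + (2 * t : ℝ) * Complex.I) n *
        (gammaQuot ρ (((2 : ℝ) + (2 * t : ℝ) * Complex.I) / 2) *
          (X : ℂ) ^ (((2 : ℝ) + (2 * t : ℝ) * Complex.I) / 2 + ρ)) =
      ((X ^ ρ : ℝ) : ℂ) * a n * ((((n : ℝ) ^ 2 / X : ℝ) : ℂ) ^ (-((1 : ℝ) + t * Complex.I)) *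
        gammaQuot ρ ((1 : ℝ) + t * Complex.I)) := by
    intro t
    have h1 : ((2 : ℝ) + (2 * t : ℝ) * Complex.I) / 2 = (1 : ℝ) + t * Complex.I := by
      push_cast
      ring
    have h2 : ((2 : ℝ) + (2 * t : ℝ) * Complex.I) =
        ((1 : ℝ) + t * Complex.I) + ((1 : ℝ) + t * Complex.I) := by
      push_cast
      ring
    rw [h1, LSeries.term_of_ne_zero hn, h2, Complex.cpow_add _ _ hn', Complex.cpow_add _ _ hX',
      Complex.ofReal_cpow hX.le]
    have h3 : ((((n : ℝ) ^ 2 / X : ℝ) : ℂ)) ^ (-((1 : ℝ) + t * Complex.I)) =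
        (X : ℂ) ^ ((1 : ℝ) + t * Complex.I) /
          ((n : ℂ) ^ ((1 : ℝ) + t * Complex.I) * (n : ℂ) ^ ((1 : ℝ) + t * Complex.I)) := by
      rw [div_eq_mul_inv, sq, Complex.cpow_neg, Complex.ofReal_mul,
        Complex.mul_cpow_ofReal_nonneg (by positivity) (by positivity), Complex.ofReal_mul,
        Complex.mul_cpow_ofReal_nonneg (by positivity) (by positivity), Complex.ofReal_inv,
        Complex.inv_cpow _ _ (by
          rw [Complex.arg_ofReal_of_nonneg hX.le]; exact Real.pi_pos.ne), mul_inv, inv_inv,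
        mul_comm, div_eq_mul_inv]
      rfl
    rw [h3]
    ring
  simp only [e4] at e3
  rw [integral_const_mul] at e3
  rw [e1, Complex.ofReal_mul, e2]
  have e5 : ∀ {A B : ℂ}, A = |(2 : ℝ)⁻¹| • B → B = 2 * A := by
    intro A B h
    rw [h, abs_of_pos (by norm_num), Complex.real_smul]
    push_cast
    ring
  rw [e5 e3]
  generalize (∫ t : ℝ, ((((n : ℝ) ^ 2 / X : ℝ) : ℂ)) ^ (-((1 : ℝ) + t * Complex.I)) *
    gammaQuot ρ ((1 : ℝ) + t * Complex.I)) = J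
  field_simp
  ring

theorem integrable_gammaQuot_mul_cpow {ρ X : ℝ} (hρ : 0 < ρ) (hX : 0 < X) :
    Integrable fun t : ℝ => gammaQuot ρ (((2 : ℝ) + t * Complex.I) / 2) *
      (X : ℂ) ^ (((2 : ℝ) + t * Complex.I) / 2 + ρ) := by
  have h := (integrable_gammaQuot_vertical hρ one_pos).comp_div (two_ne_zero' ℝ)
  have e : ∀ t : ℝ, ((2 : ℝ) + t * Complex.I) / 2 = (1 : ℝ) + (t / 2 : ℝ) * Complex.I := by
    intro t
    push_cast
    ring
  simp only [e]
  have hX' : (X : ℂ) ≠ 0 := by exact_mod_cast hX.ne'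
  refine h.mul_bdd (c := X ^ (1 + ρ)) ?_ (Eventually.of_forall fun t => le_of_eq ?_)
  · exact (Continuous.const_cpow (by fun_prop) (Or.inl hX')).aestronglyMeasurable
  · rw [Complex.norm_cpow_eq_rpow_re_of_pos hX]
    simp

theorem rieszMean_eq_integral {a : ℕ → ℂ} (ha : a 0 = 0) (hs : LSeriesSummable a (2 : ℝ))
    {ρ X : ℝ} (hρ : 0 < ρ) (hX : 0 < X) :
    rieszMean a ρ X = (4 * π : ℂ)⁻¹ * ∫ t : ℝ, LSeries a ((2 : ℝ) + t * Complex.I) *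
        (gammaQuot ρ (((2 : ℝ) + t * Complex.I) / 2) *
          (X : ℂ) ^ (((2 : ℝ) + t * Complex.I) / 2 + ρ)) := by
  simp only [rieszMean, rieszTerm_eq_integral ha hρ hX]
  exact ((hasSum_integral_term_mul hs (integrable_gammaQuot_mul_cpow hρ hX)).mul_left _).tsum_eq

section Shift

variable {N q : ℕ} [NeZero N] [NeZero q] {χ₁ : DirichletCharacter ℂ N} {χ : DirichletCharacter ℂ q}

theorem completedLFunction_mul_cpow (heven₁ : χ₁.Even) (hN : N ≠ 1) {s : ℂ}
    (hs : ∀ n : ℕ, s ≠ -(2 * n)) :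
    DirichletCharacter.completedLFunction χ₁ s * (π : ℂ) ^ (s / 2) =
      DirichletCharacter.LFunction χ₁ s * Complex.Gamma (s / 2) := by
  have hπ : (π : ℂ) ≠ 0 := by exact_mod_cast Real.pi_ne_zero
  have hG : Complex.Gammaℝ s ≠ 0 := by
    rw [Ne, Complex.Gammaℝ_eq_zero_iff]
    push Not
    exact hs
  rw [DirichletCharacter.LFunction_eq_completed_div_gammaFactor χ₁ s (Or.inr hN),
    heven₁.gammaFactor_def]
  rw [div_mul_eq_mul_div, eq_div_iff hG, Complex.Gammaℝ_def, mul_assoc]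
  congr 1
  rw [← mul_assoc, ← Complex.cpow_add _ _ hπ, neg_div, add_neg_cancel, Complex.cpow_zero, one_mul]

/-- The integrand of the Mellin inversion formula for the Riesz means. -/
noncomputable def rieszIntegrand (χ₁ : DirichletCharacter ℂ N) (χ : DirichletCharacter ℂ q)
    (ρ X : ℝ) (s : ℂ) : ℂ :=
  DirichletCharacter.LFunction χ₁ s * riemannZeta s * DirichletCharacter.LFunction χ s *
    (gammaQuot ρ (s / 2) * (X : ℂ) ^ (s / 2 + ρ))

theorem exists_norm_rieszIntegrand_le (heven₁ : χ₁.Even) (hprim₁ : χ₁.IsPrimitive)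
    (heven : χ.Even) (hprim : χ.IsPrimitive) (ρ : ℝ) {X : ℝ} (hX : 0 < X) :
    ∃ C T : ℝ, 0 < C ∧ 2 ≤ T ∧ ∀ s : ℂ, -1 ≤ s.re → s.re ≤ 2 → T ≤ |s.im| →
      ‖rieszIntegrand χ₁ χ ρ X s‖ ≤ C * |s.im| ^ (-(ρ - 8)) := by
  obtain ⟨C₁, T₁, hC₁, hT₁, h₁⟩ := exists_norm_LFunction_le hprim₁ heven₁
  obtain ⟨C₂, T₂, hC₂, hT₂, h₂⟩ := exists_norm_LFunction_le
    (χ := (1 : DirichletCharacter ℂ 1)) DirichletCharacter.isPrimitive_one_level_one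
    (MulChar.one_apply isUnit_one.neg)
  obtain ⟨C₃, T₃, hC₃, hT₃, h₃⟩ := exists_norm_LFunction_le hprim heven
  obtain ⟨C₄, T₄, hC₄, hT₄, h₄⟩ := exists_norm_gammaQuot_le ρ (M := 1) zero_le_one
  rw [DirichletCharacter.LFunction_modOne_eq] at h₂
  set B : ℝ := X ^ (-(1 / 2) + ρ) + X ^ (1 + ρ) with hB
  refine ⟨C₁ * C₂ * C₃ * (C₄ * 2 ^ (ρ + 1) * B), max (max T₁ T₂) (max T₃ (2 * T₄)), by positivity,
    le_trans hT₁ ((le_max_left _ _).trans (le_max_left _ _)), fun s hs1 hs2 ht => ?_⟩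
  simp only [max_le_iff] at ht
  obtain ⟨⟨t1, t2⟩, t3, t4⟩ := ht
  have hy : 0 < |s.im| := by linarith
  have im2 : (s / 2).im = s.im / 2 := by simp
  have re2 : (s / 2).re = s.re / 2 := by simp
  have b4 := h₄ (s / 2) (by rw [re2, abs_le]; constructor <;> linarith)
    (by rw [im2, abs_div, abs_two]; linarith)
  rw [im2, abs_div, abs_two, Real.div_rpow hy.le zero_le_two, Real.rpow_neg zero_le_two,
    div_inv_eq_mul] at b4
  have b5 : ‖(X : ℂ) ^ (s / 2 + ρ)‖ ≤ B := by
    have := norm_rpow_neg_le (a := -(1 + ρ)) (b := 1 / 2 - ρ) hX (s := -(s / 2 + ρ))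
      (by simp; linarith) (by simp; linarith)
    rw [neg_neg] at this
    refine this.trans (le_of_eq ?_)
    rw [hB, add_comm]
    congr 2 <;> ring
  have e : |s.im| ^ (-(ρ - 8)) = |s.im| ^ (3 : ℝ) * |s.im| ^ (3 : ℝ) * |s.im| ^ (3 : ℝ) *
      |s.im| ^ (-(ρ + 1)) := by
    rw [← Real.rpow_add hy, ← Real.rpow_add hy, ← Real.rpow_add hy]
    congr 1; ring
  rw [rieszIntegrand, norm_mul, norm_mul, norm_mul, norm_mul, e]
  calc _ ≤ (C₁ * |s.im| ^ (3 : ℝ)) * (C₂ * |s.im| ^ (3 : ℝ)) * (C₃ * |s.im| ^ (3 : ℝ)) *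
        (C₄ * (|s.im| ^ (-(ρ + 1)) * 2 ^ (ρ + 1)) * B) := by
        have a1 := h₁ s hs1 hs2 t1
        have a2 := h₂ s hs1 hs2 t2
        have a3 := h₃ s hs1 hs2 t3
        exact mul_le_mul (mul_le_mul (mul_le_mul a1 a2 (norm_nonneg _) (by positivity)) a3
          (norm_nonneg _) (by positivity)) (mul_le_mul b4 b5 (norm_nonneg _) (by positivity))
          (by positivity) (by positivity)
    _ = _ := by ring

/-- Moving the line of integration past the pole at `1`. -/
theorem integral_rieszIntegrand_sub (hN : N ≠ 1) (hnp₁ : χ₁ ≠ 1) (heven₁ : χ₁.Even)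
    (hprim₁ : χ₁.IsPrimitive) (hnp : χ ≠ 1) (heven : χ.Even) (hprim : χ.IsPrimitive)
    {ρ X : ℝ} (hρ : 10 < ρ) (hX : 0 < X) :
    (∫ t : ℝ, rieszIntegrand χ₁ χ ρ X ((2 : ℝ) + t * Complex.I)) -
      ∫ t : ℝ, rieszIntegrand χ₁ χ ρ X (((-1 : ℝ) : ℂ) + t * Complex.I) =
    2 * π * (DirichletCharacter.LFunction χ₁ 1 * DirichletCharacter.LFunction χ 1 *
      (gammaQuot ρ (1 / 2) * (X : ℂ) ^ (1 / 2 + ρ : ℂ))) := by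
  obtain ⟨H, hH, hHz⟩ := exists_entire_sub_one_mul_LFunction (1 : DirichletCharacter ℂ 1)
  rw [DirichletCharacter.LFunction_modOne_eq] at hHz
  have hH1 : H 1 = 1 := by
    have h1 : Tendsto H (nhdsWithin 1 {1}ᶜ) (nhds (H 1)) :=
      hH.continuous.continuousAt.tendsto.mono_left nhdsWithin_le_nhds
    refine tendsto_nhds_unique h1 (riemannZeta_residue_one.congr' ?_)
    filter_upwards [self_mem_nhdsWithin] with s hs
    exact (hHz s hs).symm
  have hπ : (π : ℂ) ≠ 0 := by exact_mod_cast Real.pi_ne_zero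
  have hX' : (X : ℂ) ≠ 0 := by exact_mod_cast hX.ne'
  set h : ℂ → ℂ := fun s => H s * (DirichletCharacter.completedLFunction χ₁ s *
    (π : ℂ) ^ (s / 2)) * DirichletCharacter.LFunction χ s * ((Complex.Gamma (s / 2 + ρ + 1))⁻¹ *
      (X : ℂ) ^ (s / 2 + ρ)) with hh
  have key : ∀ s : ℂ, (∀ n : ℕ, s ≠ -(2 * n)) → h s = H s * (DirichletCharacter.LFunction χ₁ s *
      DirichletCharacter.LFunction χ s * (gammaQuot ρ (s / 2) * (X : ℂ) ^ (s / 2 + ρ))) := by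
    intro s hs
    simp only [hh]
    rw [completedLFunction_mul_cpow heven₁ hN hs, gammaQuot]
    ring
  have key2 : ∀ s : ℂ, (∀ n : ℕ, s ≠ -(2 * n)) → s ≠ 1 →
      h s / (s - 1) = rieszIntegrand χ₁ χ ρ X s := by
    intro s hs hs1
    have := sub_ne_zero.2 hs1
    rw [key s hs, hHz s hs1, rieszIntegrand]
    field_simp
  have re_ne : ∀ s : ℂ, (∀ n : ℕ, s.re ≠ -(2 * n)) → ∀ n : ℕ, s ≠ -(2 * n) := by
    intro s hs n h'
    apply hs n
    rw [h']
    simp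
  have im_ne : ∀ s : ℂ, s.im ≠ 0 → ∀ n : ℕ, s ≠ -(2 * n) := by
    intro s hs n h'
    apply hs
    rw [h']
    simp
  obtain ⟨C, T, hC, hT, hb⟩ := exists_norm_rieszIntegrand_le heven₁ hprim₁ heven hprim ρ hX
  have hd : Differentiable ℂ h := by
    have d1 := DirichletCharacter.differentiable_completedLFunction hnp₁
    have d2 := DirichletCharacter.differentiable_LFunction hnp
    have d3 : Differentiable ℂ fun s : ℂ => (π : ℂ) ^ (s / 2) := fun s =>
      DifferentiableAt.const_cpow (by fun_prop) (Or.inl hπ)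
    have d4 : Differentiable ℂ fun s : ℂ => (X : ℂ) ^ (s / 2 + ρ) := fun s =>
      DifferentiableAt.const_cpow (by fun_prop) (Or.inl hX')
    have d5 : Differentiable ℂ fun s : ℂ => (Complex.Gamma (s / 2 + ρ + 1))⁻¹ :=
      differentiable_inv_Gamma.comp (by fun_prop : Differentiable ℂ fun s : ℂ => s / 2 + ρ + 1)
    exact ((hH.mul (d1.mul d3)).mul d2).mul (d5.mul d4)
  have main := integral_vertical_sub_eq_residue (h := h) (a := -1) (b := 2) (by norm_num)
    (by norm_num) (fun s _ _ => hd s) (C := 3 * C) (T := T) (p := ρ - 9) (by linarith)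
    (by linarith) (by positivity) (by
      intro s h1 h2 ht
      have hy : 0 < |s.im| := by linarith
      have hs1 : s ≠ 1 := by
        rintro rfl
        simp at hy
      have hs1' := sub_ne_zero.2 hs1
      have e1 : h s = rieszIntegrand χ₁ χ ρ X s * (s - 1) := by
        rw [← key2 s (im_ne s (abs_pos.1 hy)) hs1]
        field_simp
      have e2 : ‖s - 1‖ ≤ 3 * |s.im| := by
        have := Complex.norm_le_abs_re_add_abs_im (s - 1)
        simp only [Complex.sub_re, Complex.one_re, Complex.sub_im, Complex.one_im, sub_zero] at this
        have h3 : |s.re - 1| ≤ 2 := by rw [abs_le]; constructor <;> linarith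
        linarith
      rw [e1, norm_mul]
      calc _ ≤ (C * |s.im| ^ (-(ρ - 8))) * (3 * |s.im|) :=
            mul_le_mul (hb s h1 h2 ht) e2 (norm_nonneg _) (by positivity)
        _ = 3 * C * (|s.im| ^ (-(ρ - 8)) * |s.im| ^ (1 : ℝ)) := by rw [Real.rpow_one]; ring
        _ = _ := by rw [← Real.rpow_add hy]; congr 2; ring)
  have i2 : ∀ t : ℝ, h ((2 : ℝ) + t * Complex.I) / ((2 : ℝ) + t * Complex.I - 1) =
      rieszIntegrand χ₁ χ ρ X ((2 : ℝ) + t * Complex.I) := by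
    intro t
    refine key2 _ (re_ne _ fun n h' => ?_) fun h' => ?_
    · simp at h'
      have : (0 : ℝ) ≤ n := n.cast_nonneg
      linarith
    · have := congrArg Complex.re h'
      simp at this
  have i1 : ∀ t : ℝ, h (((-1 : ℝ) : ℂ) + t * Complex.I) / (((-1 : ℝ) : ℂ) + t * Complex.I - 1) =
      rieszIntegrand χ₁ χ ρ X (((-1 : ℝ) : ℂ) + t * Complex.I) := by
    intro t
    refine key2 _ (re_ne _ fun n h' => ?_) fun h' => ?_
    · simp at h'
      have : (1 : ℤ) = 2 * n := by exact_mod_cast h'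
      omega
    · have := congrArg Complex.re h'
      norm_num at this
  simp only [i1, i2] at main
  rw [main, key 1 (re_ne 1 fun n h' => by
    simp at h'
    have : (0 : ℝ) ≤ n := n.cast_nonneg
    linarith), hH1, one_mul]

theorem mul_cube_eq {g k : ℂ} (h : g * k = 1) (G r L₁ L₂ L₃ A₁ A₂ A₃ Z : ℂ) :
    A₁ * (G * k) * L₁ * (A₂ * (G * k) * L₂) * (A₃ * (G * k) * L₃) * (g * r * Z) =
      L₁ * L₂ * L₃ * (G ^ 3 * k ^ 2 * r * (A₁ * A₂ * A₃ * Z)) := by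
  linear_combination (L₁ * L₂ * L₃ * G ^ 3 * k ^ 2 * r * A₁ * A₂ * A₃ * Z) * h

theorem exists_rieszIntegrand_one_sub_eq (heven₁ : χ₁.Even)
    (hprim₁ : χ₁.IsPrimitive) (heven : χ.Even) (hprim : χ.IsPrimitive) :
    ∃ κ : ℂ, ∀ (ρ X : ℝ), 0 < X → ∀ w : ℂ, w.re = 2 → rieszIntegrand χ₁ χ ρ X (1 - w) =
      κ * (X : ℂ) ^ (ρ + 1 / 2 : ℂ) * (LSeries (scrDchi χ₁⁻¹ χ⁻¹) w *
        (rieszKer ρ w * ((π ^ 3 / (N * q) * √X : ℝ) : ℂ) ^ (-w))) := by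
  obtain ⟨ε₁, h₁⟩ := exists_LFunction_one_sub_eq hprim₁ heven₁
  obtain ⟨ε₂, h₂⟩ := exists_LFunction_one_sub_eq
    (χ := (1 : DirichletCharacter ℂ 1)) DirichletCharacter.isPrimitive_one_level_one
    (MulChar.one_apply isUnit_one.neg)
  obtain ⟨ε₃, h₃⟩ := exists_LFunction_one_sub_eq hprim heven
  rw [inv_one, DirichletCharacter.LFunction_modOne_eq] at h₂
  refine ⟨ε₁ * ε₂ * ε₃, fun ρ X hX w hw => ?_⟩
  have hw0 : 0 < w.re := by rw [hw]; norm_num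
  have hw1 : w ≠ 1 := by
    rintro rfl
    norm_num at hw
  have hN : 0 < (N : ℝ) := by exact_mod_cast NeZero.pos N
  have hq : 0 < (q : ℝ) := by exact_mod_cast NeZero.pos q
  have hX' : (X : ℂ) ≠ 0 := by exact_mod_cast hX.ne'
  have hG : Complex.Gamma ((1 - w) / 2) ≠ 0 := by
    refine Complex.Gamma_ne_zero fun m h => ?_
    have h' := congrArg Complex.re h
    simp [hw] at h'
    have h3 : (1 : ℝ) = 2 * m := by linarith
    have : (1 : ℤ) = 2 * m := by exact_mod_cast h3
    omega
  have hL : LSeries (scrDchi χ₁⁻¹ χ⁻¹) w = DirichletCharacter.LFunction χ₁⁻¹ w * riemannZeta w *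
      DirichletCharacter.LFunction χ⁻¹ w :=
    (LSeriesHasSum_scrDchi χ₁⁻¹ χ⁻¹ (s := w) (by rw [hw]; norm_num)).LSeries_eq
  have e1 : (X : ℂ) ^ ((1 - w) / 2 + ρ) = (X : ℂ) ^ (ρ + 1 / 2 : ℂ) * ((√X : ℝ) : ℂ) ^ (-w) := by
    rw [Real.sqrt_eq_rpow, ← Complex.cpow_mul_ofReal_nonneg hX.le,
      ← Complex.cpow_add _ _ hX']
    congr 1
    push_cast
    ring
  have e2 : ((π ^ 3 / (N * q) * √X : ℝ) : ℂ) ^ (-w) = ((N / π : ℝ) : ℂ) ^ w *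
      (((1 : ℕ) / π : ℝ) : ℂ) ^ w * ((q / π : ℝ) : ℂ) ^ w * ((√X : ℝ) : ℂ) ^ (-w) := by
    have : π ^ 3 / (N * q) = (N / π * ((1 : ℕ) / π) * (q / π))⁻¹ := by
      field_simp
      simp
    rw [Complex.ofReal_mul, Complex.mul_cpow_ofReal_nonneg (by positivity) (by positivity), this,
      Complex.ofReal_inv, Complex.inv_cpow _ _ (by
        rw [Complex.arg_ofReal_of_nonneg (by positivity)]; exact Real.pi_pos.ne),
      Complex.cpow_neg, inv_inv, Complex.ofReal_mul,
      Complex.mul_cpow_ofReal_nonneg (by positivity) (by positivity), Complex.ofReal_mul,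
      Complex.mul_cpow_ofReal_nonneg (by positivity) (by positivity)]
  have e3 : (1 - w) / 2 + ρ + 1 = ρ + 3 / 2 - w / 2 := by ring
  rw [rieszIntegrand, h₁ w hw0 hw1, h₂ w hw0 hw1, h₃ w hw0 hw1, hL, e1, e2, gammaQuot, e3,
    rieszKer]
  linear_combination (ε₁ * ε₂ * ε₃ * (X : ℂ) ^ (ρ + 1 / 2 : ℂ)) * mul_cube_eq (mul_inv_cancel₀ hG)
    (Complex.Gamma (w / 2)) (Complex.Gamma (ρ + 3 / 2 - w / 2))⁻¹
    (DirichletCharacter.LFunction χ₁⁻¹ w) (riemannZeta w) (DirichletCharacter.LFunction χ⁻¹ w)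
    (((N / π : ℝ) : ℂ) ^ w) ((((1 : ℕ) / π : ℝ) : ℂ) ^ w) (((q / π : ℝ) : ℂ) ^ w)
    (((√X : ℝ) : ℂ) ^ (-w))

end Shift

section Bessel

/-- The Bessel-type function occurring in the Voronoi formula for Riesz means, as a
Mellin–Barnes integral. -/
noncomputable def rieszBessel (ρ y : ℝ) : ℂ :=
  ∫ t : ℝ, rieszKer ρ (((ρ + 5 / 4) / 3 : ℝ) + t * Complex.I) *
    (y : ℂ) ^ (-((((ρ + 5 / 4) / 3 : ℝ) : ℂ) + t * Complex.I))

variable {ρ a b y : ℝ}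

theorem differentiableAt_rieszKer_mul_cpow (ρ : ℝ) (hy : 0 < y) {s : ℂ} (hs : 0 < s.re) :
    DifferentiableAt ℂ (fun s => rieszKer ρ s * (y : ℂ) ^ (-s)) s :=
  (differentiableAt_rieszKer ρ hs).mul (differentiableAt_cpow_neg hy s)

theorem exists_norm_rieszKer_mul_cpow_le (ha : 0 < a) (hb : b ≤ (ρ + 5 / 4) / 3) (hab : a ≤ b)
    (hy : 0 < y) : ∃ C T : ℝ, 0 ≤ C ∧ 1 ≤ T ∧ ∀ s : ℂ, a ≤ s.re → s.re ≤ b → T ≤ |s.im| →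
      ‖rieszKer ρ s * (y : ℂ) ^ (-s)‖ ≤ C * |s.im| ^ (-(5 / 4 : ℝ)) := by
  obtain ⟨C, T, hC, hT, h⟩ := exists_norm_rieszKer_le ρ (M := b) (by linarith)
  refine ⟨C * (y ^ (-a) + y ^ (-b)), T, by positivity, by linarith, fun s h1 h2 ht => ?_⟩
  have h3 := h s (by rw [abs_le]; constructor <;> linarith) ht
  have h4 : |s.im| ^ (3 * s.re - 5 / 2 - ρ) ≤ |s.im| ^ (-(5 / 4 : ℝ)) :=
    Real.rpow_le_rpow_of_exponent_le (by linarith) (by linarith)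
  have := norm_cpow_neg_le_of_strip (a := a) (b := b) hy h1 h2
    (h3.trans (mul_le_mul_of_nonneg_left h4 hC.le))
  linarith

theorem integrable_rieszKer_mul_cpow (ha : 0 < a) (hb : a ≤ (ρ + 5 / 4) / 3) (hy : 0 < y) :
    Integrable fun t : ℝ => rieszKer ρ (a + t * Complex.I) * (y : ℂ) ^ (-(a + t * Complex.I)) := by
  obtain ⟨C, T, hC, hT, h⟩ := exists_norm_rieszKer_mul_cpow_le ha hb le_rfl hy
  exact integrable_vertical (f := fun s => rieszKer ρ s * (y : ℂ) ^ (-s))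
    (fun s hs => (differentiableAt_rieszKer_mul_cpow ρ hy (by linarith)).continuousAt) hT
    (by norm_num) hC (fun s hs => h s hs.ge hs.le)

theorem integral_rieszKer_mul_cpow_eq (ha : 0 < a) (hb : a ≤ (ρ + 5 / 4) / 3) (hy : 0 < y) :
    ∫ t : ℝ, rieszKer ρ (a + t * Complex.I) * (y : ℂ) ^ (-(a + t * Complex.I)) =
      rieszBessel ρ y := by
  obtain ⟨C, T, hC, hT, h⟩ := exists_norm_rieszKer_mul_cpow_le ha le_rfl hb hy
  exact integral_vertical_eq (f := fun s => rieszKer ρ s * (y : ℂ) ^ (-s)) hb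
    (fun s h1 h2 => differentiableAt_rieszKer_mul_cpow ρ hy (by linarith)) hT
    (by norm_num) hC h

end Bessel

theorem scrDchi_zero {N q : ℕ} (χ₁ : DirichletCharacter ℂ N)
    (χ : DirichletCharacter ℂ q) : scrDchi χ₁ χ 0 = 0 := by
  simp [scrDchi]

section Voronoi

variable {N q : ℕ} [NeZero N] [NeZero q] {χ₁ : DirichletCharacter ℂ N} {χ : DirichletCharacter ℂ q}

theorem integral_LSeries_mul_rieszKer {c : ℕ → ℂ} (hc0 : c 0 = 0) (hc : LSeriesSummable c (2 : ℝ))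
    {ρ y : ℝ} (hρ : 5 ≤ ρ) (hy : 0 < y) :
    ∫ t : ℝ, LSeries c ((2 : ℝ) + t * Complex.I) * (rieszKer ρ ((2 : ℝ) + t * Complex.I) *
      (y : ℂ) ^ (-(((2 : ℝ) : ℂ) + t * Complex.I))) = ∑' n : ℕ, c n * rieszBessel ρ (y * n) := by
  have h2 : (2 : ℝ) ≤ (ρ + 5 / 4) / 3 := by linarith
  rw [← (hasSum_integral_term_mul hc (integrable_rieszKer_mul_cpow two_pos h2 hy)).tsum_eq]
  congr 1
  ext n
  rcases eq_or_ne n 0 with rfl | hn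
  · simp [hc0]
  have hn' : (n : ℂ) ≠ 0 := by exact_mod_cast hn
  have hn0 : (0 : ℝ) < n := by positivity
  rw [← integral_rieszKer_mul_cpow_eq two_pos h2 (mul_pos hy hn0), ← integral_const_mul]
  congr 1
  ext t
  rw [LSeries.term_of_ne_zero hn, Complex.ofReal_mul,
    Complex.mul_cpow_ofReal_nonneg hy.le hn0.le, div_eq_mul_inv, ← Complex.cpow_neg]
  push_cast
  ring

theorem exists_voronoi_of_large (hN : N ≠ 1) (hnp₁ : χ₁ ≠ 1) (heven₁ : χ₁.Even)
    (hprim₁ : χ₁.IsPrimitive) (hnp : χ ≠ 1) (heven : χ.Even) (hprim : χ.IsPrimitive) :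
    ∃ κ : ℂ, ∀ ρ X : ℝ, 10 < ρ → 0 < X → rieszMean (scrDchi χ₁ χ) ρ X =
      √π / 2 * DirichletCharacter.LFunction χ₁ 1 * DirichletCharacter.LFunction χ 1 *
        (X ^ (ρ + 1 / 2) : ℝ) / Complex.Gamma (ρ + 3 / 2) + κ * (X ^ (ρ + 1 / 2) : ℝ) *
        ∑' n : ℕ, scrDchi χ₁⁻¹ χ⁻¹ n * rieszBessel ρ (π ^ 3 / (N * q) * √X * n) := by
  obtain ⟨κ, hκ⟩ := exists_rieszIntegrand_one_sub_eq heven₁ hprim₁ heven hprim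
  refine ⟨(4 * π : ℂ)⁻¹ * κ, fun ρ X hρ hX => ?_⟩
  have hN0 : 0 < (N : ℝ) := by exact_mod_cast NeZero.pos N
  have hq0 : 0 < (q : ℝ) := by exact_mod_cast NeZero.pos q
  have hy : 0 < π ^ 3 / (N * q) * √X := by positivity
  have hsum : ∀ {s : ℂ}, 1 < s.re → ∀ (ψ₁ : DirichletCharacter ℂ N) (ψ : DirichletCharacter ℂ q),
      LSeriesSummable (scrDchi ψ₁ ψ) s :=
    fun hs ψ₁ ψ => (LSeriesHasSum_scrDchi ψ₁ ψ hs).LSeriesSummable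
  have h1 := rieszMean_eq_integral (scrDchi_zero χ₁ χ) (hsum (s := (2 : ℝ)) (by simp) χ₁ χ)
    (ρ := ρ) (X := X) (by linarith) hX
  have e1 : ∀ t : ℝ, LSeries (scrDchi χ₁ χ) ((2 : ℝ) + t * Complex.I) *
        (gammaQuot ρ (((2 : ℝ) + t * Complex.I) / 2) *
          (X : ℂ) ^ (((2 : ℝ) + t * Complex.I) / 2 + ρ)) =
      rieszIntegrand χ₁ χ ρ X ((2 : ℝ) + t * Complex.I) := by
    intro t
    rw [(LSeriesHasSum_scrDchi χ₁ χ (s := (2 : ℝ) + t * Complex.I) (by simp)).LSeries_eq,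
      rieszIntegrand]
  simp only [e1] at h1
  have h2 := integral_rieszIntegrand_sub hN hnp₁ heven₁ hprim₁ hnp heven hprim hρ hX
  have h3 : ∫ t : ℝ, rieszIntegrand χ₁ χ ρ X (((-1 : ℝ) : ℂ) + t * Complex.I) =
      κ * (X : ℂ) ^ (ρ + 1 / 2 : ℂ) *
        ∑' n : ℕ, scrDchi χ₁⁻¹ χ⁻¹ n * rieszBessel ρ (π ^ 3 / (N * q) * √X * n) := by
    rw [← integral_LSeries_mul_rieszKer (scrDchi_zero χ₁⁻¹ χ⁻¹)
      (hsum (s := (2 : ℝ)) (by simp) χ₁⁻¹ χ⁻¹) (by linarith) hy, ← integral_const_mul,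
      ← integral_neg_eq_self]
    congr 1
    ext t
    rw [← hκ ρ X hX ((2 : ℝ) + t * Complex.I) (by simp)]
    congr 1
    push_cast
    ring
  have e2 : (X : ℂ) ^ (ρ + 1 / 2 : ℂ) = ((X ^ (ρ + 1 / 2) : ℝ) : ℂ) := by
    rw [Complex.ofReal_cpow hX.le]
    push_cast
    rfl
  have e3 : Complex.Gamma (1 / 2) = (√π : ℂ) := by
    rw [Complex.Gamma_one_half_eq, Real.sqrt_eq_rpow, Complex.ofReal_cpow Real.pi_pos.le]
    push_cast
    rfl
  have e4 : (1 / 2 + ρ + 1 : ℂ) = ρ + 3 / 2 := by ring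
  have hπ : (π : ℂ) ≠ 0 := by exact_mod_cast Real.pi_ne_zero
  rw [h1, eq_add_of_sub_eq h2, h3, gammaQuot, e3, add_comm (1 / 2 : ℂ) ρ, e2, add_comm (ρ : ℂ), e4]
  generalize ∑' n : ℕ, scrDchi χ₁⁻¹ χ⁻¹ n * rieszBessel ρ (π ^ 3 / (N * q) * √X * n) = S
  field_simp
  ring

end Voronoi

section Descent

theorem rieszKer_add_one (ρ : ℝ) (w : ℂ) :
    rieszKer (ρ + 1) w * (ρ + 3 / 2 - w / 2) = rieszKer ρ w := by
  have h := Complex.one_div_Gamma_eq_self_mul_one_div_Gamma_add_one (ρ + 3 / 2 - w / 2)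
  have e : ((ρ + 1 : ℝ) : ℂ) + 3 / 2 - w / 2 = ρ + 3 / 2 - w / 2 + 1 := by
    push_cast
    ring
  rw [rieszKer, rieszKer, e, h]
  ring

theorem rpow_le_rpow_add_rpow {x a b e : ℝ} (ha : 0 < a) (h1 : a ≤ x) (h2 : x ≤ b) :
    x ^ e ≤ a ^ e + b ^ e := by
  have hb : 0 < b := by linarith
  rcases le_total 0 e with he | he
  · have := Real.rpow_le_rpow (by linarith) h2 he
    have := Real.rpow_nonneg ha.le e
    linarith
  · have := Real.rpow_le_rpow_of_nonpos ha h1 he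
    have := Real.rpow_nonneg hb.le e
    linarith

theorem cpow_mul_sqrt_eq {m X : ℝ} (hm : 0 ≤ m) (hX : 0 < X) (s r : ℂ) :
    (X : ℂ) ^ r * ((m * √X : ℝ) : ℂ) ^ (-s) = (m : ℂ) ^ (-s) * (X : ℂ) ^ (r - s / 2) := by
  have hX' : (X : ℂ) ≠ 0 := by exact_mod_cast hX.ne'
  rw [Complex.ofReal_mul, Complex.mul_cpow_ofReal_nonneg hm (Real.sqrt_nonneg X),
    Real.sqrt_eq_rpow, ← Complex.cpow_mul_ofReal_nonneg hX.le, sub_eq_add_neg,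
    Complex.cpow_add _ _ hX']
  have : ((1 / 2 : ℝ) : ℂ) * -s = -(s / 2) := by
    push_cast
    ring
  rw [this]
  ring

theorem rpow_mul_rieszBessel_eq {ρ a m X : ℝ} (ha : 0 < a) (hb : a ≤ (ρ + 5 / 4) / 3) (hm : 0 < m)
    (hX : 0 < X) : ((X ^ (ρ + 1 / 2) : ℝ) : ℂ) * rieszBessel ρ (m * √X) =
      ∫ t : ℝ, rieszKer ρ (a + t * Complex.I) * (m : ℂ) ^ (-(a + t * Complex.I)) *
        (X : ℂ) ^ (ρ + 1 / 2 - (a + t * Complex.I) / 2) := by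
  rw [← integral_rieszKer_mul_cpow_eq ha hb (by positivity), ← integral_const_mul]
  congr 1
  ext t
  rw [mul_assoc, ← cpow_mul_sqrt_eq hm.le hX, Complex.ofReal_cpow hX.le]
  push_cast
  ring

theorem hasDerivAt_rpow_mul_rieszBessel {ρ m X : ℝ} (hρ : 0 < ρ) (hm : 0 < m) (hX : 0 < X) :
    HasDerivAt (fun Y : ℝ => ((Y ^ (ρ + 1 + 1 / 2) : ℝ) : ℂ) * rieszBessel (ρ + 1) (m * √Y))
      (((X ^ (ρ + 1 / 2) : ℝ) : ℂ) * rieszBessel ρ (m * √X)) X := by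
  set a : ℝ := (ρ + 5 / 4) / 3 with ha
  have ha0 : 0 < a := by positivity
  have hY0 : ∀ Y ∈ Metric.ball X (X / 2), X / 2 ≤ Y ∧ Y ≤ 2 * X := by
    intro Y hY
    rw [Metric.mem_ball, Real.dist_eq, abs_lt] at hY
    constructor <;> linarith [hY.1, hY.2]
  set F : ℝ → ℝ → ℂ := fun Y t => rieszKer (ρ + 1) (a + t * Complex.I) *
    (m : ℂ) ^ (-(a + t * Complex.I)) *
        (Y : ℂ) ^ (((ρ + 1 : ℝ) : ℂ) + 1 / 2 - (a + t * Complex.I) / 2) with hF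
  set F' : ℝ → ℝ → ℂ := fun Y t => rieszKer ρ (a + t * Complex.I) *
    (m : ℂ) ^ (-(a + t * Complex.I)) *
        (Y : ℂ) ^ (ρ + 1 / 2 - (a + t * Complex.I) / 2) with hF'
  have hInt : ∀ Y : ℝ, 0 < Y → Integrable (F Y) := by
    intro Y hY
    have h := (integrable_rieszKer_mul_cpow (ρ := ρ + 1) ha0 (by linarith)
      (mul_pos hm (Real.sqrt_pos.2 hY))).const_mul ((Y : ℂ) ^ (((ρ + 1 : ℝ) : ℂ) + 1 / 2))
    refine h.congr (Eventually.of_forall fun t => ?_)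
    simp only [hF]
    rw [mul_assoc (rieszKer (ρ + 1) _), ← cpow_mul_sqrt_eq hm.le hY]
    ring
  have hInt' : Integrable (F' X) := by
    have h := (integrable_rieszKer_mul_cpow (ρ := ρ) ha0 le_rfl
      (mul_pos hm (Real.sqrt_pos.2 hX))).const_mul ((X : ℂ) ^ (ρ + 1 / 2 : ℂ))
    refine h.congr (Eventually.of_forall fun t => ?_)
    simp only [hF']
    rw [mul_assoc (rieszKer ρ _), ← cpow_mul_sqrt_eq hm.le hX]
    ring
  set e : ℝ := ρ + 1 / 2 - a / 2 with he
  have hbd := (integrable_rieszKer_mul_cpow (ρ := ρ) ha0 le_rfl hm).norm.mul_const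
    ((X / 2) ^ e + (2 * X) ^ e)
  have key := (hasDerivAt_integral_of_dominated_loc_of_deriv_le (F := F) (F' := F') (x₀ := X)
    (s := Metric.ball X (X / 2)) (μ := volume) (Metric.ball_mem_nhds X (by positivity))
    (by
      filter_upwards [lt_mem_nhds hX] with Y hY
      exact (hInt Y hY).aestronglyMeasurable)
    (hInt X hX) hInt'.aestronglyMeasurable
    (Eventually.of_forall fun t Y hY => by
      obtain ⟨h1, h2⟩ := hY0 Y hY
      simp only [hF']
      rw [norm_mul, Complex.norm_cpow_eq_rpow_re_of_pos (by linarith : 0 < Y)]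
      refine mul_le_mul_of_nonneg_left ?_ (norm_nonneg _)
      have : ((ρ : ℂ) + 1 / 2 - (a + t * Complex.I) / 2).re = e := by
        simp [he]
      rw [this]
      exact rpow_le_rpow_add_rpow (by positivity) h1 h2)
    hbd
    (Eventually.of_forall fun t Y hY => by
      obtain ⟨h1, h2⟩ := hY0 Y hY
      have hY : 0 < Y := by linarith
      have h3 := ((hasDerivAt_id (Y : ℂ)).cpow_const
        (c := ((ρ + 1 : ℝ) : ℂ) + 1 / 2 - (a + t * Complex.I) / 2)
        (Complex.ofReal_mem_slitPlane.2 hY)).comp_ofReal.const_mul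
        (rieszKer (ρ + 1) (a + t * Complex.I) * (m : ℂ) ^ (-(a + t * Complex.I)))
      refine h3.congr_deriv ?_
      simp only [hF']
      rw [← rieszKer_add_one ρ]
      have e1 : ((ρ + 1 : ℝ) : ℂ) + 1 / 2 - (a + t * Complex.I) / 2 - 1 =
        ρ + 1 / 2 - (a + t * Complex.I) / 2 := by
        push_cast
        ring
      have e2 : ((ρ + 1 : ℝ) : ℂ) + 1 / 2 - (a + t * Complex.I) / 2 =
        ρ + 3 / 2 - (a + t * Complex.I) / 2 := by
        push_cast
        ring
      rw [e1, e2]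
      simp only [id]
      ring)).2
  rw [rpow_mul_rieszBessel_eq ha0 le_rfl hm hX]
  refine key.congr_of_eventuallyEq ?_
  filter_upwards [lt_mem_nhds hX] with Y hY
  exact rpow_mul_rieszBessel_eq ha0 (by linarith) hm hY

theorem hasDerivAt_max_rpow {ρ : ℝ} (hρ : 0 < ρ) (u : ℝ) :
    HasDerivAt (fun u : ℝ => max u 0 ^ (ρ + 1)) ((ρ + 1) * max u 0 ^ ρ) u := by
  have h : ∀ u : ℝ, HasDerivAt (fun u : ℝ => u ^ (ρ + 1)) ((ρ + 1) * u ^ ρ) u := by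
    intro u
    have := Real.hasDerivAt_rpow_const (x := u) (p := ρ + 1) (Or.inr (by linarith))
    rwa [add_sub_cancel_right] at this
  rcases lt_trichotomy u 0 with hu | rfl | hu
  · rw [max_eq_right hu.le, Real.zero_rpow hρ.ne', mul_zero]
    refine (hasDerivAt_const u (0 : ℝ)).congr_of_eventuallyEq ?_
    filter_upwards [gt_mem_nhds hu] with v hv
    rw [max_eq_right hv.le, Real.zero_rpow (by linarith)]
  · rw [max_self, ← hasDerivWithinAt_univ, ← Set.Iic_union_Ici (a := (0 : ℝ))]
    refine HasDerivWithinAt.union ?_ ?_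
    · rw [Real.zero_rpow hρ.ne', mul_zero]
      refine (hasDerivWithinAt_const (0 : ℝ) (Set.Iic 0) (0 : ℝ)).congr (fun v hv => ?_) ?_
      · rw [max_eq_right hv, Real.zero_rpow (by linarith)]
      · rw [max_self, Real.zero_rpow (by linarith)]
    · refine (h 0).hasDerivWithinAt.congr (fun v hv => ?_) ?_
      · rw [max_eq_left hv]
      · rw [max_self]
  · rw [max_eq_left hu.le]
    refine (h u).congr_of_eventuallyEq ?_
    filter_upwards [lt_mem_nhds hu] with v hv
    rw [max_eq_left hv.le]

theorem rieszMean_eq_sum (a : ℕ → ℂ) {ρ X : ℝ} (hρ : 0 < ρ) {K : ℕ} (hK : X ≤ K) :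
    rieszMean a ρ X = ∑ n ∈ Finset.range K,
      ((max (X - (n : ℝ) ^ 2) 0 ^ ρ : ℝ) : ℂ) / Complex.Gamma (ρ + 1) * a n := by
  rw [rieszMean, tsum_eq_sum]
  intro n hn
  rw [Finset.mem_range, not_lt] at hn
  have h1 : (K : ℝ) ≤ n := by exact_mod_cast hn
  have h2 : (n : ℝ) ≤ (n : ℝ) ^ 2 := by
    exact_mod_cast Nat.le_self_pow two_ne_zero n
  rw [max_eq_right (by linarith), Real.zero_rpow hρ.ne']
  simp

theorem hasDerivAt_rieszMean (a : ℕ → ℂ) {ρ : ℝ} (hρ : 0 < ρ) (X : ℝ) :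
    HasDerivAt (rieszMean a (ρ + 1)) (rieszMean a ρ X) X := by
  obtain ⟨K, hK⟩ := exists_nat_gt X
  rw [rieszMean_eq_sum a hρ hK.le]
  have h : HasDerivAt (fun Y : ℝ => ∑ n ∈ Finset.range K,
      ((max (Y - (n : ℝ) ^ 2) 0 ^ (ρ + 1) : ℝ) : ℂ) / Complex.Gamma ((ρ + 1 : ℝ) + 1) * a n)
      (∑ n ∈ Finset.range K,
        ((max (X - (n : ℝ) ^ 2) 0 ^ ρ : ℝ) : ℂ) / Complex.Gamma (ρ + 1) * a n) X := by
    refine HasDerivAt.fun_sum fun n _ => HasDerivAt.mul_const ?_ _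
    have h1 := (((hasDerivAt_max_rpow hρ (X - (n : ℝ) ^ 2)).comp X
      ((hasDerivAt_id X).sub_const ((n : ℝ) ^ 2))).ofReal_comp).div_const
        (Complex.Gamma ((ρ + 1 : ℝ) + 1))
    refine h1.congr_deriv ?_
    have h2 : ((ρ + 1 : ℝ) : ℂ) ≠ 0 := by
      have : ρ + 1 ≠ 0 := by positivity
      exact_mod_cast this
    rw [Complex.Gamma_add_one _ h2]
    push_cast
    push_cast at h2
    field_simp
  refine h.congr_of_eventuallyEq ?_
  filter_upwards [gt_mem_nhds hK] with Y hY
  exact rieszMean_eq_sum a (by linarith) hY.le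

/-- The Voronoi formula for Riesz means of order `ρ`. -/
def HasVoronoi (a b : ℕ → ℂ) (c : ℝ) (M κ : ℂ) (ρ : ℝ) : Prop :=
  ∀ X : ℝ, 0 < X → rieszMean a ρ X = M * (X ^ (ρ + 1 / 2) : ℝ) / Complex.Gamma (ρ + 3 / 2) +
    κ * (X ^ (ρ + 1 / 2) : ℝ) * ∑' n : ℕ, b n * rieszBessel ρ (c * √X * n)

variable {a b : ℕ → ℂ} {c : ℝ} {M κ : ℂ} {ρ : ℝ}

/-- The terms of the Bessel series are dominated by a convergent Dirichlet series. -/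
theorem exists_norm_rieszBessel_term_le (hb0 : b 0 = 0) (hc : 0 < c) (hρ : 0 < ρ) :
    ∃ C, 0 < C ∧ ∀ (X : ℝ) (n : ℕ), 0 < X →
      ‖((X ^ (ρ + 1 / 2) : ℝ) : ℂ) * (b n * rieszBessel ρ (c * √X * n))‖ ≤
        C * (‖b n‖ * (n : ℝ) ^ (-((ρ + 2) / 3))) * X ^ ((5 * ρ + 1) / 6) := by
  obtain ⟨C, hC, h⟩ := exists_norm_integral_rieszKer_le ρ hρ
  refine ⟨C * c ^ (-((ρ + 2) / 3)), by positivity, fun X n hX => ?_⟩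
  rcases eq_or_ne n 0 with rfl | hn
  · simp [hb0]
  have hn0 : (0 : ℝ) < n := by positivity
  have h1 : ‖rieszBessel ρ (c * √X * n)‖ ≤ C * (c * √X * n) ^ (-((ρ + 2) / 3)) :=
    h _ (by positivity)
  have h2 : (c * √X * n) ^ (-((ρ + 2) / 3)) = c ^ (-((ρ + 2) / 3)) *
      X ^ (1 / 2 * (-((ρ + 2) / 3))) * (n : ℝ) ^ (-((ρ + 2) / 3)) := by
    rw [Real.mul_rpow (by positivity) hn0.le, Real.mul_rpow hc.le (Real.sqrt_nonneg X),
      Real.sqrt_eq_rpow, ← Real.rpow_mul hX.le]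
  rw [h2] at h1
  have e : X ^ ((5 * ρ + 1) / 6) = X ^ (ρ + 1 / 2) * X ^ (1 / 2 * (-((ρ + 2) / 3))) := by
    rw [← Real.rpow_add hX]
    congr 1
    ring
  rw [norm_mul, norm_mul, Complex.norm_real, Real.norm_of_nonneg (by positivity), e]
  calc _ ≤ X ^ (ρ + 1 / 2) * (‖b n‖ * (C * (c ^ (-((ρ + 2) / 3)) *
        X ^ (1 / 2 * (-((ρ + 2) / 3))) * (n : ℝ) ^ (-((ρ + 2) / 3))))) :=
        mul_le_mul_of_nonneg_left (mul_le_mul_of_nonneg_left h1 (norm_nonneg _)) (by positivity)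
    _ = _ := by ring

theorem HasVoronoi.of_add_one (hb0 : b 0 = 0)
    (hb : ∀ s : ℝ, 1 < s → Summable fun n : ℕ => ‖b n‖ * (n : ℝ) ^ (-s)) (hc : 0 < c) (hρ : 1 < ρ)
    (h : HasVoronoi a b c M κ (ρ + 1)) : HasVoronoi a b c M κ ρ := by
  intro X hX
  have hρ0 : 0 < ρ := by linarith
  obtain ⟨C, hC, hbd⟩ := exists_norm_rieszBessel_term_le hb0 hc hρ0
  obtain ⟨C₁, hC₁, hbd₁⟩ := exists_norm_rieszBessel_term_le hb0 hc (by linarith : 0 < ρ + 1)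
  have hser : HasDerivAt (fun Y : ℝ => ∑' n : ℕ, ((Y ^ (ρ + 1 + 1 / 2) : ℝ) : ℂ) *
        (b n * rieszBessel (ρ + 1) (c * √Y * n)))
      (∑' n : ℕ, ((X ^ (ρ + 1 / 2) : ℝ) : ℂ) * (b n * rieszBessel ρ (c * √X * n))) X := by
    refine hasDerivAt_tsum_of_isPreconnected (𝕜 := ℝ) (t := Set.Ioo 0 (2 * X)) (y₀ := X)
      (u := fun n => C * (‖b n‖ * (n : ℝ) ^ (-((ρ + 2) / 3))) * (2 * X) ^ ((5 * ρ + 1) / 6))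
      (g' := fun n Y => ((Y ^ (ρ + 1 / 2) : ℝ) : ℂ) * (b n * rieszBessel ρ (c * √Y * n)))
      (((hb _ (by linarith)).mul_left C).mul_right _) isOpen_Ioo isPreconnected_Ioo
      (fun n Y hY => ?_) (fun n Y hY => ?_) ⟨hX, by linarith⟩ ?_ ⟨hX, by linarith⟩
    · rcases eq_or_ne n 0 with rfl | hn
      · simp only [hb0, zero_mul, mul_zero]
        exact hasDerivAt_const _ _
      · have hn0 : (0 : ℝ) < n := by positivity
        have h1 := (hasDerivAt_rpow_mul_rieszBessel hρ0 (mul_pos hc hn0) hY.1).const_mul (b n)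
        simp only [mul_left_comm (b n), mul_right_comm c (n : ℝ)] at h1
        exact h1
    · refine (hbd Y n hY.1).trans (mul_le_mul_of_nonneg_left ?_ (by positivity))
      exact Real.rpow_le_rpow hY.1.le hY.2.le (by positivity)
    · exact Summable.of_norm_bounded
        (((hb _ (by linarith : 1 < (ρ + 1 + 2) / 3)).mul_left C₁).mul_right _)
        (fun n => hbd₁ X n hX)
  have hmain : HasDerivAt (fun Y : ℝ => M * ((Y ^ (ρ + 1 + 1 / 2) : ℝ) : ℂ) /
        Complex.Gamma ((ρ + 1 : ℝ) + 3 / 2))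
      (M * ((X ^ (ρ + 1 / 2) : ℝ) : ℂ) / Complex.Gamma (ρ + 3 / 2)) X := by
    have h1 := ((Real.hasDerivAt_rpow_const (x := X) (p := ρ + 1 + 1 / 2)
      (Or.inl hX.ne')).ofReal_comp.const_mul M).div_const (Complex.Gamma ((ρ + 1 : ℝ) + 3 / 2))
    refine h1.congr_deriv ?_
    have h2 : (ρ : ℂ) + 3 / 2 ≠ 0 := by
      have : ((ρ + 3 / 2 : ℝ) : ℂ) ≠ 0 := Complex.ofReal_ne_zero.2 (by positivity)
      push_cast at this
      exact this
    have e1 : ((ρ + 1 : ℝ) : ℂ) + 3 / 2 = ρ + 3 / 2 + 1 := by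
      push_cast
      ring
    have e2 : ρ + 1 + 1 / 2 - 1 = ρ + 1 / 2 := by ring
    have e3 : ((ρ + 1 + 1 / 2 : ℝ) : ℂ) = ρ + 3 / 2 := by
      push_cast
      ring
    rw [e1, Complex.Gamma_add_one _ h2, e2, Complex.ofReal_mul, e3, mul_left_comm,
      mul_div_mul_left _ _ h2]
  have htot := hmain.add (hser.const_mul κ)
  have huniq := (hasDerivAt_rieszMean a hρ0 X).unique (htot.congr_of_eventuallyEq (by
    filter_upwards [lt_mem_nhds hX] with Y hY
    rw [h Y hY, Pi.add_apply]
    rw [tsum_mul_left, mul_assoc κ]))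
  rw [huniq, tsum_mul_left, mul_assoc κ]

theorem HasVoronoi.of_large (hb0 : b 0 = 0)
    (hb : ∀ s : ℝ, 1 < s → Summable fun n : ℕ => ‖b n‖ * (n : ℝ) ^ (-s)) (hc : 0 < c) {R : ℝ}
    (h : ∀ ρ, R < ρ → HasVoronoi a b c M κ ρ) (hρ : 1 < ρ) : HasVoronoi a b c M κ ρ := by
  have key : ∀ (k : ℕ) (ρ : ℝ), 1 < ρ → HasVoronoi a b c M κ (ρ + k) →
      HasVoronoi a b c M κ ρ := by
    intro k
    induction k with
    | zero => simp
    | succ k ih =>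
      intro ρ hρ hk
      refine HasVoronoi.of_add_one hb0 hb hc hρ (ih (ρ + 1) (by linarith) ?_)
      convert hk using 1
      push_cast
      ring
  obtain ⟨k, hk⟩ := exists_nat_gt (R - ρ)
  exact key k ρ hρ (h _ (by linarith))

theorem HasVoronoi.exists_norm_sub_le (hb0 : b 0 = 0)
    (hb : ∀ s : ℝ, 1 < s → Summable fun n : ℕ => ‖b n‖ * (n : ℝ) ^ (-s)) (hc : 0 < c) (hρ : 1 < ρ)
    (h : HasVoronoi a b c M κ ρ) : ∃ C, ∀ X : ℝ, 0 < X →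
      ‖rieszMean a ρ X - M * (X ^ (ρ + 1 / 2) : ℝ) / Complex.Gamma (ρ + 3 / 2)‖ ≤
        C * X ^ ((5 * ρ + 1) / 6) := by
  obtain ⟨C, hC, hbd⟩ := exists_norm_rieszBessel_term_le hb0 hc (by linarith : 0 < ρ)
  refine ⟨‖κ‖ * ∑' n : ℕ, C * (‖b n‖ * (n : ℝ) ^ (-((ρ + 2) / 3))), fun X hX => ?_⟩
  have hs := ((hb ((ρ + 2) / 3) (by linarith)).mul_left C).mul_right (X ^ ((5 * ρ + 1) / 6))
  rw [h X hX, add_sub_cancel_left, mul_assoc κ, ← tsum_mul_left, norm_mul, mul_assoc,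
    ← tsum_mul_right]
  exact mul_le_mul_of_nonneg_left (tsum_of_norm_bounded hs.hasSum fun n => hbd X n hX)
    (norm_nonneg _)

end Descent

theorem tendsto_sum_inv_mul_character {M : ℕ} [NeZero M] (hM : 1 < M) {χ : DirichletCharacter ℂ M}
    (hχ : χ ≠ 1) : Tendsto (fun n : ℕ => ∑ k ∈ Finset.range n, (k : ℂ)⁻¹ * χ (k : ZMod M)) atTop
      (𝓝 (DirichletCharacter.LFunction χ 1)) := by
  obtain ⟨B, hB⟩ := exists_norm_sum_character_le hχ
  set E : ℝ → ℂ := fun t => ∑ k ∈ Finset.Icc 1 ⌊t⌋₊, χ (k : ZMod M) with hE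
  have hEm : Measurable E :=
    (measurable_from_nat (f := fun n : ℕ => ∑ k ∈ Finset.Icc 1 n, χ (k : ZMod M))).comp
      Nat.measurable_floor
  have hEB : ∀ t : ℝ, 0 ≤ t → ‖E t‖ ≤ B := fun t _ => hB _
  have hχ0 : χ ((0 : ℕ) : ZMod M) = 0 := by
    rw [Nat.cast_zero]
    have : Nontrivial (ZMod M) := ZMod.nontrivial_iff.2 hM.ne'
    exact χ.map_zero
  have hsum : ∀ n : ℕ, ∑ k ∈ Finset.Icc 0 n, χ (k : ZMod M) =
      ∑ k ∈ Finset.Icc 1 n, χ (k : ZMod M) := by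
    intro n
    rw [← Finset.add_sum_Ioc_eq_sum_Icc (Nat.zero_le n), hχ0, zero_add]
    rfl
  have hL : DirichletCharacter.LFunction χ 1 =
      ∫ t in Set.Ioi (1 : ℝ), E t * (t : ℂ) ^ (-((1 : ℂ) + 1)) := by
    have hc1 : ContinuousAt (DirichletCharacter.LFunction χ) 1 :=
      (DirichletCharacter.differentiable_LFunction hχ).continuous.continuousAt
    have hc2 : ContinuousAt (fun s : ℂ =>
        s * ∫ t in Set.Ioi (1 : ℝ), E t * (t : ℂ) ^ (-(s + 1))) 1 :=
      continuousAt_id.mul (differentiableAt_integral_mul_cpow hEm hEB (by simp)).continuousAt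
    have hre : ∀ᶠ s : ℂ in 𝓝[≠] 1, 0 < s.re :=
      nhdsWithin_le_nhds ((isOpen_lt continuous_const Complex.continuous_re).mem_nhds (by simp))
    have heq : ∀ᶠ s in 𝓝[≠] (1 : ℂ), DirichletCharacter.LFunction χ s =
        s * ∫ t in Set.Ioi (1 : ℝ), E t * (t : ℂ) ^ (-(s + 1)) := by
      filter_upwards [hre, self_mem_nhdsWithin] with s hs hs1
      have h := sub_one_mul_LFunction_eq (χ := χ) (κ := 0) (B := B)
        (fun t _ => by simpa using hB _) hs hs1
      have h' : s - 1 ≠ 0 := sub_ne_zero.2 hs1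
      simp only [zero_mul, sub_zero, zero_add] at h
      refine mul_left_cancel₀ h' (h.trans ?_)
      ring
    have := tendsto_nhds_unique_of_eventuallyEq (hc1.tendsto.mono_left nhdsWithin_le_nhds)
      (hc2.tendsto.mono_left nhdsWithin_le_nhds) heq
    rwa [one_mul] at this
  have hd : ∀ t : ℝ, 1 ≤ t → HasDerivAt (fun t : ℝ => (t : ℂ)⁻¹) (-((t : ℂ) ^ 2)⁻¹) t := by
    intro t ht
    have h0 : (t : ℂ) ≠ 0 := by
      exact_mod_cast (by linarith : t ≠ 0)
    simpa using (hasDerivAt_inv h0).comp_ofReal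
  have hd' : ∀ t : ℝ, 1 ≤ t → deriv (fun t : ℝ => (t : ℂ)⁻¹) t = -((t : ℂ) ^ 2)⁻¹ :=
    fun t ht => (hd t ht).deriv
  have hInt : ∀ t : ℝ, 1 < t →
      deriv (fun t : ℝ => (t : ℂ)⁻¹) t * ∑ k ∈ Finset.Icc 0 ⌊t⌋₊, χ (k : ZMod M) =
        -(E t * (t : ℂ) ^ (-((1 : ℂ) + 1))) := by
    intro t ht
    rw [hd' t ht.le, hsum, show -((1 : ℂ) + 1) = ((-2 : ℤ) : ℂ) by norm_num, Complex.cpow_intCast]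
    simp only [hE, zpow_neg]
    norm_cast
    push_cast
    ring
  have key := tendsto_sum_mul_atTop_nhds_one_sub_integral₀ (f := fun t : ℝ => (t : ℂ)⁻¹) (l := 0)
    (fun k : ℕ => χ (k : ZMod M)) hχ0 (fun t ht => (hd t ht).differentiableAt) ?_ ?_
    (g := fun t => B * t ^ (-2 : ℝ)) ?_ ?_
  · rw [setIntegral_congr_fun measurableSet_Ioi hInt, integral_neg, ← hL, sub_neg_eq_add,
      zero_add] at key
    refine (tendsto_add_atTop_iff_nat 1).1 (key.congr fun n => ?_)
    rw [← Nat.range_succ_eq_Icc_zero]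
    norm_num
  · refine ContinuousOn.locallyIntegrableOn ?_ measurableSet_Ici
    refine ContinuousOn.congr (f := fun t : ℝ => -((t : ℂ) ^ 2)⁻¹) ?_ hd'
    refine ContinuousOn.neg (ContinuousOn.inv₀ (by fun_prop) fun t ht => ?_)
    have : (1 : ℝ) ≤ t := ht
    exact pow_ne_zero 2 (by exact_mod_cast (by linarith : t ≠ 0))
  · refine squeeze_zero_norm (a := fun n : ℕ => (n : ℝ)⁻¹ * B) (fun n => ?_) ?_
    · rw [norm_mul, hsum]
      refine mul_le_mul (by simp) (hB n) (norm_nonneg _) (by positivity)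
    · simpa using tendsto_inv_atTop_nhds_zero_nat (𝕜 := ℝ) |>.mul_const B
  · refine IsBigO.of_bound 1 ?_
    filter_upwards [eventually_gt_atTop 1] with t ht
    have hB0 : 0 ≤ B := (norm_nonneg _).trans (hB 0)
    have ht0 : 0 < t := by linarith
    rw [hInt t ht, norm_neg, norm_mul, Complex.norm_cpow_eq_rpow_re_of_pos ht0, one_mul,
      Real.norm_of_nonneg (by positivity)]
    refine mul_le_mul (hEB t ht0.le) (le_of_eq ?_) (by positivity) hB0
    norm_num
  · refine ⟨Set.Ioi 1, Ioi_mem_atTop 1, ?_⟩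
    exact (integrableOn_Ioi_rpow_of_lt (by norm_num) one_pos).const_mul B

theorem mul_gaussSum_inv_eq {M : ℕ} [NeZero M] {χ : DirichletCharacter ℂ M}
    (hχ : χ.IsPrimitive) (a : ZMod M) : χ a * gaussSum χ⁻¹ (ZMod.stdAddChar (N := M)) =
      ∑ h, χ⁻¹ h * ZMod.stdAddChar (a * h) := by
  have := gaussSum_mulShift_of_isPrimitive (ZMod.stdAddChar (N := M)) (isPrimitive_inv hχ) a
  rw [inv_inv] at this
  rw [← this, gaussSum]
  rfl

theorem gaussSum_mul_gaussSum_inv {M : ℕ} [NeZero M] {χ : DirichletCharacter ℂ M}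
    (hχ : χ.IsPrimitive) (heven : χ.Even) :
    gaussSum χ (ZMod.stdAddChar (N := M)) * gaussSum χ⁻¹ (ZMod.stdAddChar (N := M)) = M := by
  have h1 := mul_gaussSum_inv_eq hχ
  calc gaussSum χ (ZMod.stdAddChar (N := M)) * gaussSum χ⁻¹ (ZMod.stdAddChar (N := M))
      = ∑ a : ZMod M, ∑ h : ZMod M, χ⁻¹ h * ZMod.stdAddChar (a * (1 + h)) := by
        rw [gaussSum, Finset.sum_mul]
        refine Finset.sum_congr rfl fun a _ => ?_
        rw [mul_right_comm, h1, Finset.sum_mul]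
        refine Finset.sum_congr rfl fun h _ => ?_
        rw [mul_add, mul_one, AddChar.map_add_eq_mul]
        ring
    _ = ∑ h : ZMod M, χ⁻¹ h * if 1 + h = 0 then (M : ℂ) else 0 := by
        rw [Finset.sum_comm]
        refine Finset.sum_congr rfl fun h _ => ?_
        rw [← Finset.mul_sum, AddChar.sum_mulShift (1 + h) (ZMod.isPrimitive_stdAddChar M),
          ZMod.card]
        push_cast
        rfl
    _ = M := by
        rw [Finset.sum_eq_single (-1 : ZMod M)]
        · rw [if_pos (by ring), (even_inv heven : χ⁻¹ (-1) = 1), one_mul]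
        · intro h _ hh
          rw [if_neg, mul_zero]
          contrapose! hh
          linear_combination hh
        · simp

theorem gaussSum_inv_mul_LFunction_one {M : ℕ} [NeZero M] (hM : 1 < M)
    {χ : DirichletCharacter ℂ M} (hχ : χ ≠ 1) (hprim : χ.IsPrimitive) :
    gaussSum χ⁻¹ (ZMod.stdAddChar (N := M)) * DirichletCharacter.LFunction χ 1 =
      -∑ h : ZMod M, χ⁻¹ h * Complex.log (1 - ZMod.stdAddChar h) := by
  have : Nontrivial (ZMod M) := ZMod.nontrivial_iff.2 hM.ne'
  set G := gaussSum χ⁻¹ (ZMod.stdAddChar (N := M)) with hG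
  have h1 := mul_gaussSum_inv_eq hprim
  have hnorm : ∀ h : ZMod M, ‖(ZMod.stdAddChar h : ℂ)‖ = 1 := fun h => by
    rw [ZMod.stdAddChar_apply]
    exact Circle.norm_coe _
  have h2 := (Complex.tendsto_tsum_powerSeries_nhdsWithin_lt
    (tendsto_sum_inv_mul_character hM hχ)).const_mul G
  rw [tendsto_map'_iff] at h2
  have h3 : ∀ᶠ r : ℝ in 𝓝[<] 1, ((fun z : ℂ => G * ∑' n : ℕ, (n : ℂ)⁻¹ * χ (n : ZMod M) * z ^ n) ∘
      Complex.ofReal) r = -∑ h : ZMod M, χ⁻¹ h * Complex.log (1 - ZMod.stdAddChar h * r) := by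
    have : ∀ᶠ r : ℝ in 𝓝[<] 1, 0 < r := nhdsWithin_le_nhds (lt_mem_nhds one_pos)
    filter_upwards [this, self_mem_nhdsWithin] with r hr0 hr1
    have hr1 : r < 1 := hr1
    have h4 : ∀ h : ZMod M, HasSum (fun n : ℕ => χ⁻¹ h * ((ZMod.stdAddChar h * (r : ℂ)) ^ n / n))
        (χ⁻¹ h * -Complex.log (1 - ZMod.stdAddChar h * r)) := fun h => by
      refine (Complex.hasSum_taylorSeries_neg_log ?_).mul_left _
      rw [norm_mul, hnorm, one_mul, Complex.norm_real, Real.norm_of_nonneg hr0.le]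
      exact hr1
    have h5 := hasSum_sum (s := Finset.univ) fun h _ => h4 h
    simp only [Function.comp_apply]
    rw [← tsum_mul_left, ← Finset.sum_neg_distrib]
    simp only [← mul_neg]
    rw [← h5.tsum_eq]
    refine tsum_congr fun n => ?_
    calc G * ((n : ℂ)⁻¹ * χ (n : ZMod M) * (r : ℂ) ^ n)
        = (n : ℂ)⁻¹ * (r : ℂ) ^ n * (χ (n : ZMod M) * G) := by ring
      _ = _ := by
        rw [h1, Finset.mul_sum]
        refine Finset.sum_congr rfl fun h _ => ?_
        rw [← nsmul_eq_mul, AddChar.map_nsmul_eq_pow, mul_pow]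
        ring
  refine tendsto_nhds_unique_of_eventuallyEq h2 ?_ h3
  refine (tendsto_finsetSum _ fun h _ => ?_).neg
  by_cases hh : h = 0
  · have : χ⁻¹ h = 0 := by
      rw [hh]
      exact χ⁻¹.map_zero
    simp [this]
  · have hne : (ZMod.stdAddChar h : ℂ) ≠ 1 := fun he => hh (ZMod.injective_stdAddChar
      (he.trans (AddChar.map_zero_eq_one _).symm))
    have hre : (ZMod.stdAddChar h : ℂ).re < 1 := by
      refine lt_of_le_of_ne ((Complex.re_le_norm _).trans (hnorm h).le) fun he => hne ?_
      have h6 := Complex.sq_norm (ZMod.stdAddChar h : ℂ)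
      rw [hnorm, Complex.normSq_apply, he] at h6
      refine Complex.ext he ?_
      rw [Complex.one_im]
      nlinarith
    have hslit : 1 - (ZMod.stdAddChar h : ℂ) * ((1 : ℝ) : ℂ) ∈ Complex.slitPlane := by
      left
      simpa using hre
    have hc : ContinuousAt (fun r : ℝ => χ⁻¹ h * Complex.log (1 - ZMod.stdAddChar h * (r : ℂ))) 1 :=
      continuousAt_const.mul (ContinuousAt.clog (by fun_prop) hslit)
    have := hc.tendsto.mono_left (nhdsWithin_le_nhds (s := Set.Iio 1))
    simpa using this

theorem sum_inv_mul_log_eq {M : ℕ} [NeZero M] {χ : DirichletCharacter ℂ M} (heven : χ.Even) :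
    ∑ h : ZMod M, χ⁻¹ h * Complex.log (1 - ZMod.stdAddChar h) =
      ∑ h : ZMod M, χ⁻¹ h * (Real.log ‖1 - (ZMod.stdAddChar h : ℂ)‖ : ℂ) := by
  have hconj : ∀ h : ZMod M,
      Complex.log (1 - ZMod.stdAddChar h) + Complex.log (1 - ZMod.stdAddChar (-h)) =
        2 * (Real.log ‖1 - (ZMod.stdAddChar h : ℂ)‖ : ℂ) := by
    intro h
    have hz : 1 - (ZMod.stdAddChar (-h) : ℂ) = (starRingEnd ℂ) (1 - ZMod.stdAddChar h) := by
      rw [AddChar.map_neg_eq_conj, map_sub, map_one]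
    by_cases h0 : (1 - ZMod.stdAddChar h : ℂ) = 0
    · rw [hz, h0]
      simp
    have harg : (1 - ZMod.stdAddChar h : ℂ).arg ≠ π := by
      intro he
      rw [Complex.arg_eq_pi_iff] at he
      have h1 : (ZMod.stdAddChar h : ℂ).re ≤ 1 := by
        refine (Complex.re_le_norm _).trans (le_of_eq ?_)
        rw [ZMod.stdAddChar_apply]
        exact Circle.norm_coe _
      have h2 := he.1
      simp at h2
      linarith
    rw [hz, Complex.log_conj _ harg, Complex.add_conj, Complex.log_re]
    push_cast
    rfl
  have hswap : ∑ h : ZMod M, χ⁻¹ h * Complex.log (1 - ZMod.stdAddChar h) =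
      ∑ h : ZMod M, χ⁻¹ h * Complex.log (1 - ZMod.stdAddChar (-h)) := by
    rw [← Equiv.sum_comp (Equiv.neg (ZMod M))]
    refine Finset.sum_congr rfl fun h _ => ?_
    rw [Equiv.neg_apply, (even_inv heven).eval_neg]
  have : (2 : ℂ) * ∑ h : ZMod M, χ⁻¹ h * Complex.log (1 - ZMod.stdAddChar h) =
      2 * ∑ h : ZMod M, χ⁻¹ h * (Real.log ‖1 - (ZMod.stdAddChar h : ℂ)‖ : ℂ) := by
    rw [two_mul]
    nth_rewrite 2 [hswap]
    rw [← Finset.sum_add_distrib, Finset.mul_sum]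
    refine Finset.sum_congr rfl fun h _ => ?_
    rw [← mul_add, hconj]
    ring
  exact mul_left_cancel₀ two_ne_zero this

theorem sum_Ico_one_eq_sum_zmod {M : ℕ} [NeZero M] {f : ZMod M → ℂ} (hf : f 0 = 0) :
    ∑ n ∈ Finset.Ico 1 M, f (n : ZMod M) = ∑ h : ZMod M, f h := by
  have h1 : ∑ n ∈ Finset.range M, f (n : ZMod M) = ∑ h : ZMod M, f h :=
    Finset.sum_bij' (fun k _ => (k : ZMod M)) (fun a _ => a.val) (fun _ _ => Finset.mem_univ _)
      (fun a _ => Finset.mem_range.2 (ZMod.val_lt a))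
      (fun k hk => ZMod.val_cast_of_lt (Finset.mem_range.1 hk))
      (fun a _ => ZMod.natCast_zmod_val a) (fun k _ => rfl)
  rw [← h1, Finset.range_eq_Ico, Finset.sum_eq_sum_Ico_succ_bot (NeZero.pos M), Nat.cast_zero, hf,
    zero_add]

theorem stdAddChar_natCast {M : ℕ} [NeZero M] (n : ℕ) :
    (ZMod.stdAddChar (n : ZMod M) : ℂ) = Complex.exp (2 * π * Complex.I * n / M) := by
  simpa using ZMod.stdAddChar_coe (N := M) n

theorem gaussSum'_eq_gaussSum {M : ℕ} [NeZero M] (hM : 1 < M) (χ : DirichletCharacter ℂ M) :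
    gaussSum' χ = gaussSum χ (ZMod.stdAddChar (N := M)) := by
  have : Nontrivial (ZMod M) := ZMod.nontrivial_iff.2 hM.ne'
  rw [gaussSum, ← sum_Ico_one_eq_sum_zmod (by rw [χ.map_zero, zero_mul]), gaussSum']
  refine Finset.sum_congr rfl fun n _ => ?_
  rw [stdAddChar_natCast]

theorem norm_one_sub_stdAddChar_natCast {M : ℕ} [NeZero M] {n : ℕ} (hn : n ≤ M) :
    ‖1 - (ZMod.stdAddChar (n : ZMod M) : ℂ)‖ = 2 * Real.sin (π * n / M) := by
  have hM : (0 : ℝ) < M := by exact_mod_cast NeZero.pos M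
  have h1 : (2 * π * Complex.I * n / M : ℂ) = Complex.I * ((2 * (π * n / M) : ℝ) : ℂ) := by
    push_cast
    ring
  rw [norm_sub_rev, stdAddChar_natCast, h1, Complex.norm_exp_I_mul_ofReal_sub_one,
    mul_div_cancel_left₀ _ two_ne_zero, Real.norm_of_nonneg]
  refine mul_nonneg zero_le_two (Real.sin_nonneg_of_nonneg_of_le_pi (by positivity) ?_)
  rw [div_le_iff₀ hM]
  exact mul_le_mul_of_nonneg_left (by exact_mod_cast hn) Real.pi_pos.le

/-- The value at `1` of the `L`-function of an even primitive character. -/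
theorem LFunction_one_eq {M : ℕ} [NeZero M] (hM : 1 < M) {χ : DirichletCharacter ℂ M}
    (hχ : χ ≠ 1) (heven : χ.Even) (hprim : χ.IsPrimitive) :
    DirichletCharacter.LFunction χ 1 = -(gaussSum' χ / M) *
      ∑ n ∈ Finset.Ico 1 M, (starRingEnd ℂ) (χ (n : ZMod M)) *
        (Real.log (2 * Real.sin (π * n / M)) : ℂ) := by
  have : Nontrivial (ZMod M) := ZMod.nontrivial_iff.2 hM.ne'
  have hM0 : (M : ℂ) ≠ 0 := by exact_mod_cast NeZero.ne M
  have h1 := gaussSum_inv_mul_LFunction_one hM hχ hprim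
  have h2 := gaussSum_mul_gaussSum_inv hprim heven
  rw [sum_inv_mul_log_eq heven, ← sum_Ico_one_eq_sum_zmod (by rw [χ⁻¹.map_zero, zero_mul])] at h1
  have h3 : ∑ n ∈ Finset.Ico 1 M, χ⁻¹ (n : ZMod M) *
      (Real.log ‖1 - (ZMod.stdAddChar (n : ZMod M) : ℂ)‖ : ℂ) =
      ∑ n ∈ Finset.Ico 1 M, (starRingEnd ℂ) (χ (n : ZMod M)) *
        (Real.log (2 * Real.sin (π * n / M)) : ℂ) := by
    refine Finset.sum_congr rfl fun n hn => ?_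
    rw [norm_one_sub_stdAddChar_natCast (Finset.mem_Ico.1 hn).2.le]
    congr 1
    exact (MulChar.star_apply' χ _).symm
  rw [h3] at h1
  rw [gaussSum'_eq_gaussSum hM]
  refine mul_left_cancel₀ hM0 ?_
  rw [← h2, mul_assoc, h1, h2]
  field_simp

theorem summable_norm_scrDchi_mul_rpow {N q : ℕ} [NeZero N] [NeZero q] (χ₁ : DirichletCharacter ℂ N)
    (χ : DirichletCharacter ℂ q) {s : ℝ} (hs : 1 < s) :
    Summable fun n : ℕ => ‖scrDchi χ₁ χ n‖ * (n : ℝ) ^ (-s) := by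
  have h := (LSeriesHasSum_scrDchi χ₁ χ (s := (s : ℂ)) (by simpa using hs)).LSeriesSummable.norm
  refine h.congr fun n => ?_
  rw [LSeries.norm_term_eq]
  split_ifs with hn
  · rw [hn, scrDchi_zero, norm_zero, zero_mul]
  · rw [Complex.ofReal_re, Real.rpow_neg n.cast_nonneg, div_eq_mul_inv]

theorem rieszMean_sq_eq_sum_Icc {a : ℕ → ℂ} (ha : a 0 = 0) {ρ x : ℝ} (hρ : 0 < ρ) (hx : 0 ≤ x) :
    rieszMean a ρ (x ^ 2) = 1 / (Real.Gamma (ρ + 1) : ℂ) *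
      ∑ n ∈ Finset.Icc 1 ⌊x⌋₊, (((x ^ 2 - (n : ℝ) ^ 2) ^ ρ : ℝ) : ℂ) * a n := by
  rw [rieszMean, tsum_eq_sum (s := Finset.Icc 1 ⌊x⌋₊), Finset.mul_sum]
  · refine Finset.sum_congr rfl fun n hn => ?_
    have h1 : (n : ℝ) ≤ x := (Nat.le_floor_iff hx).1 (Finset.mem_Icc.1 hn).2
    have h2 : (n : ℝ) ^ 2 ≤ x ^ 2 := pow_le_pow_left₀ n.cast_nonneg h1 2
    rw [max_eq_left (sub_nonneg.2 h2), ← Complex.Gamma_ofReal]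
    push_cast
    ring
  · intro n hn
    rcases Nat.eq_zero_or_pos n with rfl | hpos
    · rw [ha, mul_zero]
    · have h1 : x < n := by
        by_contra! h
        exact hn (Finset.mem_Icc.2 ⟨hpos, (Nat.le_floor_iff hx).2 h⟩)
      have h2 : x ^ 2 ≤ (n : ℝ) ^ 2 := pow_le_pow_left₀ hx h1.le 2
      rw [max_eq_right (sub_nonpos.2 h2), Real.zero_rpow hρ.ne', Complex.ofReal_zero, zero_div,
        zero_mul]

end RieszVoronoi

open RieszVoronoi

theorem statement11 (N : ℕ) [NeZero N] (hN : 1 < N) (χ₁ : DirichletCharacter ℂ N)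
    (hreal : ∀ a : ZMod N, (χ₁ a).im = 0) (heven₁ : χ₁.Even) (hnp₁ : χ₁ ≠ 1)
    (hprim₁ : χ₁.IsPrimitive)
    (q : ℕ) (hq : 1 < q) (χ : DirichletCharacter ℂ q)
    (heven : χ.Even) (hnp : χ ≠ 1) (hprim : χ.IsPrimitive)
    (ρ : ℝ) (hρ : 1 < ρ) :
    (fun x : ℝ =>
        (1 / (Real.Gamma (ρ + 1) : ℂ)) *
            ∑ n ∈ Finset.Icc 1 ⌊x⌋₊, (((x ^ 2 - (n : ℝ) ^ 2) ^ ρ : ℝ) : ℂ) * scrDchi χ₁ χ n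
          - (-(gaussSum' χ * (Real.sqrt π : ℂ) * DirichletCharacter.LFunction χ₁ 1) /
              (2 * (q : ℂ) * (Real.Gamma (ρ + 3 / 2) : ℂ)) * ((x ^ (1 + 2 * ρ) : ℝ) : ℂ) *
              ∑ n ∈ Finset.Ico 1 q,
                (starRingEnd ℂ) (χ (n : ZMod q)) * (Real.log (2 * Real.sin (π * n / q)) : ℂ)))
      =O[atTop] fun x : ℝ => x ^ ((5 * ρ + 1) / 3) := by
  have : NeZero q := ⟨by omega⟩
  obtain ⟨κ, hκ⟩ := exists_voronoi_of_large hN.ne' hnp₁ heven₁ hprim₁ hnp heven hprim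
  have hc : 0 < π ^ 3 / (N * q : ℝ) := by
    have h1 : (0 : ℝ) < N := by exact_mod_cast NeZero.pos N
    have h2 : (0 : ℝ) < q := by exact_mod_cast NeZero.pos q
    positivity
  have hV := HasVoronoi.of_large (scrDchi_zero χ₁⁻¹ χ⁻¹)
    (fun s hs => summable_norm_scrDchi_mul_rpow χ₁⁻¹ χ⁻¹ hs) hc
    (fun ρ hρ X hX => hκ ρ X hρ hX) hρ
  obtain ⟨C, hC⟩ := hV.exists_norm_sub_le (scrDchi_zero χ₁⁻¹ χ⁻¹)
    (fun s hs => summable_norm_scrDchi_mul_rpow χ₁⁻¹ χ⁻¹ hs) hc hρ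
  refine IsBigO.of_bound C ?_
  filter_upwards [eventually_gt_atTop 0] with x hx
  have h1 : (x ^ 2) ^ ((5 * ρ + 1) / 6) = x ^ ((5 * ρ + 1) / 3) := by
    rw [← Real.rpow_natCast, ← Real.rpow_mul hx.le]
    congr 1
    push_cast
    ring
  have h2 : (x ^ 2) ^ (ρ + 1 / 2) = x ^ (1 + 2 * ρ) := by
    rw [← Real.rpow_natCast, ← Real.rpow_mul hx.le]
    congr 1
    push_cast
    ring
  have h3 : (Real.Gamma (ρ + 3 / 2) : ℂ) = Complex.Gamma (ρ + 3 / 2) := by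
    rw [← Complex.Gamma_ofReal]
    push_cast
    rfl
  have h := hC (x ^ 2) (by positivity)
  rw [h1, h2, rieszMean_sq_eq_sum_Icc (scrDchi_zero χ₁ χ) (by linarith) hx.le,
    LFunction_one_eq hq hnp heven hprim] at h
  rw [Real.norm_of_nonneg (Real.rpow_nonneg hx.le _)]
  refine le_of_eq_of_le (congrArg norm (congrArg _ ?_)) h
  rw [h3]
  ring
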